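/- Let A : ℝ → ℝ be Lipschitz with constant L, let p ∈ (1,∞), and let b be a smooth compactly supported function on ℝ. Then the commutator [b, C_Γ] is a compact operator on L^p(ℝ). -/

import Mathlib

open MeasureTheory Filter Set
open scoped ENNReal

/-- The Cauchy kernel `K(x,y) = 1/(y - x + i(A(y) - A(x)))` associated to `A`. -/
noncomputable def cauchyKernel (A : ℝ → ℝ) (x y : ℝ) : ℂ :=
  ((y : ℂ) - (x : ℂ) + Complex.I * ((A y : ℂ) - (A x : ℂ)))⁻¹

/-- `cauchyPV A f x v` : the principal value `C_Γ f (x)` exists and equals `v`. -/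
def cauchyPV (A : ℝ → ℝ) (f : ℝ → ℂ) (x : ℝ) (v : ℂ) : Prop :=
  Filter.Tendsto (fun δ : ℝ => ∫ y in {y : ℝ | δ < |y - x|}, cauchyKernel A x y * f y)
    (nhdsWithin 0 (Set.Ioi 0)) (nhds v)

/-- `g` agrees a.e. with the commutator `[b, C_Γ] f = b • C_Γ f - C_Γ (b f)`. -/
def IsCommutatorFn (A b : ℝ → ℝ) (f g : ℝ → ℂ) : Prop :=
  ∀ᵐ x : ℝ, ∃ u w : ℂ,
    cauchyPV A f x u ∧ cauchyPV A (fun y => (b y : ℂ) * f y) x w ∧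
    g x = (b x : ℂ) * u - w

/-- Average of `b` over the interval `I(x,r) = (x - r, x + r)`. -/
noncomputable def intervalAvg (b : ℝ → ℝ) (x r : ℝ) : ℝ :=
  (2 * r)⁻¹ * ∫ y in Set.Ioo (x - r) (x + r), b y

/-- Mean oscillation `M(b, I(x,r))`. -/
noncomputable def meanOsc (b : ℝ → ℝ) (x r : ℝ) : ℝ :=
  (2 * r)⁻¹ * ∫ y in Set.Ioo (x - r) (x + r), |b y - intervalAvg b x r|

def IsBMOWith (b : ℝ → ℝ) (N : ℝ) : Prop :=
  MeasureTheory.LocallyIntegrable b volume ∧ ∀ x r : ℝ, 0 < r → meanOsc b x r ≤ N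

/-- `b ∈ BMO(ℝ)`. -/
def IsBMO (b : ℝ → ℝ) : Prop := ∃ N : ℝ, IsBMOWith b N

/-- `‖b‖_BMO`, the supremum of the mean oscillations of `b` over all bounded intervals. -/
noncomputable def bmoNorm (b : ℝ → ℝ) : ℝ := sInf {N : ℝ | IsBMOWith b N}


section Kernel

variable {A : ℝ → ℝ} {L : ℝ}

theorem re_cauchyKernel_denominator (A : ℝ → ℝ) (x y : ℝ) :
    ((y : ℂ) - (x : ℂ) + Complex.I * ((A y : ℂ) - (A x : ℂ))).re = y - x := by
  simp

theorem im_cauchyKernel_denominator (A : ℝ → ℝ) (x y : ℝ) :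
    ((y : ℂ) - (x : ℂ) + Complex.I * ((A y : ℂ) - (A x : ℂ))).im = A y - A x := by
  simp

theorem cauchyKernel_denominator_ne_zero {x y : ℝ} (h : y ≠ x) :
    (y : ℂ) - (x : ℂ) + Complex.I * ((A y : ℂ) - (A x : ℂ)) ≠ 0 := by
  intro h0
  have := congrArg Complex.re h0
  rw [re_cauchyKernel_denominator, Complex.zero_re] at this
  exact h (by linarith)

theorem cauchyKernel_self (A : ℝ → ℝ) (x : ℝ) : cauchyKernel A x x = 0 := by
  simp [cauchyKernel]

theorem cauchyKernel_swap (A : ℝ → ℝ) (x y : ℝ) :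
    cauchyKernel A y x = -cauchyKernel A x y := by
  unfold cauchyKernel
  rw [← inv_neg]
  congr 1
  ring

theorem norm_cauchyKernel_le (A : ℝ → ℝ) (x y : ℝ) : ‖cauchyKernel A x y‖ ≤ |y - x|⁻¹ := by
  rcases eq_or_ne y x with rfl | h
  · simp [cauchyKernel_self]
  unfold cauchyKernel
  rw [norm_inv]
  have hpos : 0 < |y - x| := abs_pos.2 (sub_ne_zero.2 h)
  apply inv_anti₀ hpos
  have := Complex.abs_re_le_norm ((y : ℂ) - (x : ℂ) + Complex.I * ((A y : ℂ) - (A x : ℂ)))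
  rwa [re_cauchyKernel_denominator] at this

theorem norm_cauchyKernel_denominator_le (hA : ∀ x₁ x₂ : ℝ, |A x₁ - A x₂| ≤ L * |x₁ - x₂|)
    (x y : ℝ) :
    ‖(y : ℂ) - (x : ℂ) + Complex.I * ((A y : ℂ) - (A x : ℂ))‖ ≤ (1 + L) * |y - x| := by
  have := Complex.norm_le_abs_re_add_abs_im
    ((y : ℂ) - (x : ℂ) + Complex.I * ((A y : ℂ) - (A x : ℂ)))
  rw [re_cauchyKernel_denominator, im_cauchyKernel_denominator] at this
  linarith [hA y x]

theorem norm_cauchyKernel_sub_le (hA : ∀ x₁ x₂ : ℝ, |A x₁ - A x₂| ≤ L * |x₁ - x₂|)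
    {x y w : ℝ} (hx : w ≠ x) (hy : w ≠ y) :
    ‖cauchyKernel A x w - cauchyKernel A y w‖ ≤ (1 + L) * |y - x| * (|w - x|⁻¹ * |w - y|⁻¹) := by
  have h1 := cauchyKernel_denominator_ne_zero (A := A) hx
  have h2 := cauchyKernel_denominator_ne_zero (A := A) hy
  have key : cauchyKernel A x w - cauchyKernel A y w =
      -((y : ℂ) - (x : ℂ) + Complex.I * ((A y : ℂ) - (A x : ℂ))) *
        (cauchyKernel A x w * cauchyKernel A y w) := by
    unfold cauchyKernel
    field_simp
    ring
  rw [key, norm_mul, norm_mul, norm_neg]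
  gcongr
  · exact (norm_nonneg _).trans (norm_cauchyKernel_denominator_le hA x y)
  · exact norm_cauchyKernel_denominator_le hA x y
  · exact norm_cauchyKernel_le A x w
  · exact norm_cauchyKernel_le A y w

theorem continuous_of_abs_sub_le (hA : ∀ x₁ x₂ : ℝ, |A x₁ - A x₂| ≤ L * |x₁ - x₂|) :
    Continuous A :=
  (LipschitzWith.of_dist_le' (K := L) fun x y => by
    simpa [Real.dist_eq] using hA x y).continuous

theorem measurable_cauchyKernel (hA : Continuous A) :
    Measurable fun q : ℝ × ℝ => cauchyKernel A q.1 q.2 := by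
  unfold cauchyKernel
  apply Measurable.inv
  apply Continuous.measurable
  fun_prop

/-- The Cauchy kernel truncated at distance `ε` from the diagonal. -/
noncomputable def truncatedKernel (A : ℝ → ℝ) (ε x y : ℝ) : ℂ :=
  if ε < |y - x| then cauchyKernel A x y else 0

theorem truncatedKernel_swap (A : ℝ → ℝ) (ε x y : ℝ) :
    truncatedKernel A ε y x = -truncatedKernel A ε x y := by
  unfold truncatedKernel
  rw [abs_sub_comm x y, cauchyKernel_swap]
  split_ifs <;> simp

theorem norm_truncatedKernel_le (A : ℝ → ℝ) {ε : ℝ} (hε : 0 < ε) (x y : ℝ) :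
    ‖truncatedKernel A ε x y‖ ≤ ε⁻¹ := by
  unfold truncatedKernel
  split_ifs with h
  · exact (norm_cauchyKernel_le A x y).trans (inv_anti₀ hε h.le)
  · simpa using hε.le

theorem measurable_truncatedKernel (hA : Continuous A) (ε : ℝ) :
    Measurable fun q : ℝ × ℝ => truncatedKernel A ε q.1 q.2 := by
  unfold truncatedKernel
  refine Measurable.ite ?_ (measurable_cauchyKernel hA) measurable_const
  exact measurableSet_lt measurable_const (by fun_prop)

/-- The second divided difference of `A` (zero if two of the nodes coincide). -/
noncomputable def secondDividedDiff (A : ℝ → ℝ) (x y z : ℝ) : ℝ :=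
  ((A y - A x) * (z - x) - (A z - A x) * (y - x)) / ((y - x) * (z - x) * (z - y))

/-- The symmetrization of `k(z,x) * conj k(z,y)` for the truncated kernel. -/
noncomputable def symmKernel (A : ℝ → ℝ) (ε x y z : ℝ) : ℝ :=
  (truncatedKernel A ε z x * starRingEnd ℂ (truncatedKernel A ε z y)).re +
  (truncatedKernel A ε x y * starRingEnd ℂ (truncatedKernel A ε x z)).re +
  (truncatedKernel A ε y x * starRingEnd ℂ (truncatedKernel A ε y z)).re

/-- The error kernel of the symmetrization, when `x` and `y` are close and `z` is far from `x`. -/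
noncomputable def errorKernel (ε x y z : ℝ) : ℝ :=
  if |y - x| ≤ ε ∧ ε < |z - x| then 2 / (z - x) ^ 2 else 0

theorem errorKernel_nonneg (ε x y z : ℝ) : 0 ≤ errorKernel ε x y z := by
  unfold errorKernel
  split_ifs <;> positivity

theorem re_mul_conj_le_errorKernel (A : ℝ → ℝ) {ε x y z : ℝ} (hε : 0 < ε) (h : |y - x| ≤ ε) :
    |(truncatedKernel A ε z x * starRingEnd ℂ (truncatedKernel A ε z y)).re| ≤
      errorKernel ε x y z := by
  by_cases h1 : ε < |x - z|
  · by_cases h2 : ε < |y - z|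
    · refine (Complex.abs_re_le_norm _).trans ?_
      rw [norm_mul, RCLike.norm_conj]
      have hz : |z - x| = |x - z| := abs_sub_comm _ _
      rw [errorKernel, if_pos ⟨h, hz ▸ h1⟩, truncatedKernel, truncatedKernel, if_pos h1, if_pos h2]
      have e1 := norm_cauchyKernel_le A z x
      have e2 := norm_cauchyKernel_le A z y
      have p1 : 0 < |x - z| := hε.trans h1
      have p2 : 0 < |y - z| := hε.trans h2
      have e3 : |y - z|⁻¹ ≤ 2 * |x - z|⁻¹ := by
        have : |x - z| ≤ 2 * |y - z| := by
          have := abs_sub_le x y z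
          rw [abs_sub_comm x y] at this
          linarith
        rw [← div_eq_mul_inv, inv_eq_one_div, div_le_div_iff₀ p2 p1]
        linarith
      calc ‖cauchyKernel A z x‖ * ‖cauchyKernel A z y‖
          ≤ |x - z|⁻¹ * (2 * |x - z|⁻¹) := by
            gcongr
            exact e2.trans e3
        _ = 2 / (z - x) ^ 2 := by
            rw [← sq_abs (z - x), hz]
            field_simp
    · simp only [truncatedKernel, if_neg h2, map_zero, mul_zero, Complex.zero_re, abs_zero]
      exact errorKernel_nonneg _ _ _ _
  · simp only [truncatedKernel, if_neg h1, zero_mul, Complex.zero_re, abs_zero]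
    exact errorKernel_nonneg _ _ _ _

theorem re_inv_mul_conj_inv_sum (u v : ℂ) (hu : u.re ≠ 0) (hv : v.re ≠ 0) (hw : (v - u).re ≠ 0) :
    |((u⁻¹ * starRingEnd ℂ v⁻¹).re + (-u⁻¹ * starRingEnd ℂ (v - u)⁻¹).re +
      (-v⁻¹ * starRingEnd ℂ (-(v - u)⁻¹)).re)| ≤
      2 * ((u.im * v.re - v.im * u.re) / (u.re * v.re * (v - u).re)) ^ 2 := by
  obtain ⟨a, b⟩ := u
  obtain ⟨c, d⟩ := v
  simp only [Complex.sub_re] at *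
  have nu : 0 < a * a + b * b :=
    add_pos_of_pos_of_nonneg (mul_self_pos.2 hu) (mul_self_nonneg b)
  have nv : 0 < c * c + d * d :=
    add_pos_of_pos_of_nonneg (mul_self_pos.2 hv) (mul_self_nonneg d)
  have nw : 0 < (c - a) * (c - a) + (d - b) * (d - b) :=
    add_pos_of_pos_of_nonneg (mul_self_pos.2 hw) (mul_self_nonneg (d - b))
  have key : (((⟨a, b⟩ : ℂ)⁻¹ * starRingEnd ℂ (⟨c, d⟩ : ℂ)⁻¹).re +
      (-(⟨a, b⟩ : ℂ)⁻¹ * starRingEnd ℂ ((⟨c, d⟩ : ℂ) - ⟨a, b⟩)⁻¹).re +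
      (-(⟨c, d⟩ : ℂ)⁻¹ * starRingEnd ℂ (-((⟨c, d⟩ : ℂ) - ⟨a, b⟩)⁻¹)).re) =
      2 * (b * c - d * a) ^ 2 / ((a * a + b * b) * (c * c + d * d) *
        ((c - a) * (c - a) + (d - b) * (d - b))) := by
    simp only [Complex.mul_re, Complex.neg_re, Complex.neg_im, Complex.inv_re, Complex.inv_im,
      Complex.conj_re, Complex.conj_im, Complex.normSq_apply, Complex.sub_re, Complex.sub_im,
      map_neg]
    field_simp
    ring
  rw [key, abs_of_nonneg (by positivity), div_pow, ← mul_div_assoc]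
  apply div_le_div_of_nonneg_left (by positivity) (by positivity)
  calc (a * c * (c - a)) ^ 2 = (a * a) * (c * c) * ((c - a) * (c - a)) := by ring
    _ ≤ _ := by
      gcongr
      all_goals nlinarith [mul_self_nonneg b, mul_self_nonneg d, mul_self_nonneg (d - b),
        mul_self_nonneg a, mul_self_nonneg c, mul_self_nonneg (c - a)]

theorem abs_symmKernel_le (A : ℝ → ℝ) {ε : ℝ} (hε : 0 < ε) (x y z : ℝ) :
    |symmKernel A ε x y z| ≤ 2 * secondDividedDiff A x y z ^ 2 +
      errorKernel ε x y z + errorKernel ε y z x + errorKernel ε z x y := by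
  have p0 : 0 ≤ 2 * secondDividedDiff A x y z ^ 2 := by positivity
  have p1 := errorKernel_nonneg ε x y z
  have p2 := errorKernel_nonneg ε y z x
  have p3 := errorKernel_nonneg ε z x y
  have zero : ∀ {a b : ℝ} (c : ℝ), |b - a| ≤ ε →
      (truncatedKernel A ε a b * starRingEnd ℂ (truncatedKernel A ε a c)).re = 0 ∧
      (truncatedKernel A ε a c * starRingEnd ℂ (truncatedKernel A ε a b)).re = 0 := by
    intro a b c h
    simp [truncatedKernel, not_lt.2 h]
  by_cases hxy : |y - x| ≤ ε
  · unfold symmKernel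
    rw [(zero z hxy).1, (zero z (abs_sub_comm y x ▸ hxy)).1, add_zero, add_zero]
    linarith [re_mul_conj_le_errorKernel A (z := z) hε hxy]
  by_cases hyz : |z - y| ≤ ε
  · unfold symmKernel
    rw [(zero x (abs_sub_comm z y ▸ hyz)).2, (zero x hyz).2, add_zero, zero_add]
    linarith [re_mul_conj_le_errorKernel A (z := x) hε hyz]
  by_cases hzx : |x - z| ≤ ε
  · unfold symmKernel
    rw [(zero y hzx).1, (zero y (abs_sub_comm x z ▸ hzx)).2, zero_add, zero_add]
    have e := re_mul_conj_le_errorKernel A (z := y) hε hzx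
    have : (truncatedKernel A ε y x * starRingEnd ℂ (truncatedKernel A ε y z)).re =
      (truncatedKernel A ε y z * starRingEnd ℂ (truncatedKernel A ε y x)).re := by
        simp only [Complex.mul_re, Complex.conj_re, Complex.conj_im]; ring
    rw [this]
    linarith
  push Not at hxy hyz hzx
  have nxy : y - x ≠ 0 := abs_pos.1 (hε.trans hxy)
  have nyz : z - y ≠ 0 := abs_pos.1 (hε.trans hyz)
  have nzx : x - z ≠ 0 := abs_pos.1 (hε.trans hzx)
  have key := re_inv_mul_conj_inv_sum
    ((y : ℂ) - (x : ℂ) + Complex.I * ((A y : ℂ) - (A x : ℂ)))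
    ((z : ℂ) - (x : ℂ) + Complex.I * ((A z : ℂ) - (A x : ℂ)))
    (by rwa [re_cauchyKernel_denominator])
    (by rw [re_cauchyKernel_denominator]; contrapose! nzx; linarith)
    (by rw [Complex.sub_re, re_cauchyKernel_denominator, re_cauchyKernel_denominator]
        contrapose! nyz; linarith)
  rw [show (z : ℂ) - (x : ℂ) + Complex.I * ((A z : ℂ) - (A x : ℂ)) -
    ((y : ℂ) - (x : ℂ) + Complex.I * ((A y : ℂ) - (A x : ℂ))) =
    (z : ℂ) - (y : ℂ) + Complex.I * ((A z : ℂ) - (A y : ℂ)) by ring] at key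
  simp only [re_cauchyKernel_denominator, im_cauchyKernel_denominator] at key
  have e : symmKernel A ε x y z =
      (cauchyKernel A x y * starRingEnd ℂ (cauchyKernel A x z)).re +
      (-cauchyKernel A x y * starRingEnd ℂ (cauchyKernel A y z)).re +
      (-cauchyKernel A x z * starRingEnd ℂ (-cauchyKernel A y z)).re := by
    unfold symmKernel
    rw [← cauchyKernel_swap, ← cauchyKernel_swap, ← cauchyKernel_swap]
    simp only [truncatedKernel, if_pos hxy, if_pos hyz, if_pos hzx,
      if_pos (abs_sub_comm y x ▸ hxy), if_pos (abs_sub_comm z y ▸ hyz),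
      if_pos (abs_sub_comm x z ▸ hzx)]
    ring
  rw [e]
  unfold cauchyKernel
  refine key.trans ?_
  unfold secondDividedDiff
  linarith

theorem symmKernel_swap (A : ℝ → ℝ) (ε x y z : ℝ) :
    symmKernel A ε y x z = symmKernel A ε x y z := by
  unfold symmKernel
  simp only [Complex.mul_re, Complex.conj_re, Complex.conj_im]
  ring

end Kernel

section Curvature

theorem lintegral_div_sub_div_le {N : ℝ → ℝ} (hm : Measurable N) (h0 : ∀ t, 0 ≤ N t) {C ℓ : ℝ}
    (hC : ∀ t, 0 < t → t ≤ ℓ → N t ≤ C) {θ ε : ℝ} (hθ : 0 < θ) (hθ1 : θ ≤ 1) (hε : 0 < ε)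
    (hεℓ : ε ≤ ℓ) :
    IntervalIntegrable (fun ρ => N (θ * ρ) / ρ) volume ε ℓ ∧
    IntervalIntegrable (fun ρ => N ρ / ρ) volume ε ℓ ∧
    (∫ ρ in ε..ℓ, N (θ * ρ) / ρ) - ∫ ρ in ε..ℓ, N ρ / ρ ≤ C * -Real.log θ := by
  have hℓ : 0 < ℓ := hε.trans_le hεℓ
  have key : ∀ a b, 0 < a → a ≤ b → b ≤ ℓ → IntervalIntegrable (fun ρ => N ρ / ρ) volume a b := by
    intro a b ha hab hb
    rw [intervalIntegrable_iff_integrableOn_Ioc_of_le hab]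
    refine Measure.integrableOn_of_bounded (M := C / a) (by simp)
      (hm.div measurable_id).aestronglyMeasurable ?_
    refine (ae_restrict_iff' measurableSet_Ioc).2 (ae_of_all _ fun t ht => ?_)
    have ht0 : 0 < t := ha.trans ht.1
    rw [Real.norm_eq_abs, abs_of_nonneg (div_nonneg (h0 t) ht0.le)]
    have := hC t ht0 (ht.2.trans hb)
    exact div_le_div₀ ((h0 t).trans this) this ha ht.1.le
  have hsc : ∀ ρ, N (θ * ρ) / ρ = θ * (N (θ * ρ) / (θ * ρ)) := by
    intro ρ
    rcases eq_or_ne ρ 0 with rfl | h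
    · simp
    field_simp
  have hθε : θ * ε ≤ ε := by nlinarith
  have hθℓ : θ * ℓ ≤ ℓ := by nlinarith
  have hθεℓ : θ * ε ≤ θ * ℓ := by nlinarith
  have p1 : 0 < θ * ε := by positivity
  have I1 := key (θ * ε) (θ * ℓ) p1 hθεℓ hθℓ
  have I2 := key ε ℓ hε hεℓ le_rfl
  refine ⟨?_, I2, ?_⟩
  · simp_rw [hsc]
    apply IntervalIntegrable.const_mul
    have := I1.comp_mul_left (c := θ)
    rw [mul_div_cancel_left₀ _ hθ.ne', mul_div_cancel_left₀ _ hθ.ne'] at this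
    exact this
  · simp_rw [hsc]
    rw [intervalIntegral.integral_const_mul,
      intervalIntegral.integral_comp_mul_left (fun u => N u / u) hθ.ne', smul_eq_mul,
      ← mul_assoc, mul_inv_cancel₀ hθ.ne', one_mul]
    have I3 := key (θ * ε) ε p1 hθε hεℓ
    have I4 := key (θ * ℓ) ℓ (by positivity) hθℓ le_rfl
    have e1 := intervalIntegral.integral_add_adjacent_intervals I3 I2
    have e2 := intervalIntegral.integral_add_adjacent_intervals I1 I4
    have n4 : 0 ≤ ∫ u in (θ * ℓ)..ℓ, N u / u :=
      intervalIntegral.integral_nonneg hθℓ fun u hu =>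
        div_nonneg (h0 u) ((by positivity : (0:ℝ) ≤ θ * ℓ).trans hu.1)
    have u3 : ∫ u in (θ * ε)..ε, N u / u ≤ ∫ u in (θ * ε)..ε, C * u⁻¹ := by
      apply intervalIntegral.integral_mono_on hθε I3
      · apply IntervalIntegrable.const_mul
        apply intervalIntegral.intervalIntegrable_inv
        · intro x hx
          rw [uIcc_of_le hθε] at hx
          exact (p1.trans_le hx.1).ne'
        · exact continuousOn_id
      · intro u hu
        have : 0 < u := p1.trans_le hu.1
        rw [div_eq_mul_inv]
        gcongr
        exact hC u this (hu.2.trans hεℓ)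
    rw [intervalIntegral.integral_const_mul, integral_inv_of_pos p1 hε,
      div_mul_cancel_right₀ hε.ne', Real.log_inv] at u3
    linarith

theorem lintegral_convexity_gap_le {N : ℝ → ℝ} (hm : Measurable N) (h0 : ∀ t, 0 ≤ N t) {C ℓ : ℝ}
    (hC : ∀ t, 0 < t → t ≤ ℓ → N t ≤ C) (hℓ : 0 < ℓ) {θ : ℝ} (hθ : 0 < θ) (hθ1 : θ < 1)
    (hgap : ∀ ρ, 0 < ρ → 0 ≤ θ * N (θ * ρ) + (1 - θ) * N ((1 - θ) * ρ) - N ρ) :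
    ∫⁻ ρ in Ioc 0 ℓ, ENNReal.ofReal
      ((θ * N (θ * ρ) + (1 - θ) * N ((1 - θ) * ρ) - N ρ) / ρ) ≤
    ENNReal.ofReal (C * (θ * -Real.log θ + (1 - θ) * -Real.log (1 - θ))) := by
  have hU : Ioc 0 ℓ = ⋃ n : ℕ, Ioc (ℓ / (n + 1)) ℓ := by
    ext x
    simp only [mem_Ioc, mem_iUnion]
    constructor
    · rintro ⟨h1, h2⟩
      obtain ⟨n, hn⟩ := exists_nat_gt (ℓ / x)
      refine ⟨n, ?_, h2⟩
      rw [div_lt_iff₀ (by positivity)]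
      rw [div_lt_iff₀ h1] at hn
      nlinarith
    · rintro ⟨n, h1, h2⟩
      exact ⟨(by positivity : 0 ≤ ℓ / ((n : ℝ) + 1)).trans_lt h1, h2⟩
  rw [hU, setLIntegral_iUnion_of_directed]
  swap
  · apply Monotone.directed_le
    intro m n hmn
    apply Ioc_subset_Ioc_left
    have : (m : ℝ) ≤ n := by exact_mod_cast hmn
    gcongr
  refine iSup_le fun n => ?_
  set ε := ℓ / ((n : ℝ) + 1) with hε_def
  have hε : 0 < ε := by positivity
  have hεℓ : ε ≤ ℓ := div_le_self hℓ.le (by linarith [(Nat.cast_nonneg n : (0:ℝ) ≤ n)])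
  obtain ⟨i1, i3, e1⟩ := lintegral_div_sub_div_le hm h0 hC hθ hθ1.le hε hεℓ
  obtain ⟨i2, -, e2⟩ := lintegral_div_sub_div_le hm h0 hC (sub_pos.2 hθ1) (by linarith) hε hεℓ
  have hfun : ∀ ρ, (θ * N (θ * ρ) + (1 - θ) * N ((1 - θ) * ρ) - N ρ) / ρ =
      θ * (N (θ * ρ) / ρ) + (1 - θ) * (N ((1 - θ) * ρ) / ρ) - N ρ / ρ := fun ρ => by ring
  have i12 := (i1.const_mul θ).add (i2.const_mul (1 - θ))
  have i123 := i12.sub i3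
  simp only [hfun]
  rw [← ofReal_integral_eq_lintegral_ofReal]
  · rw [← intervalIntegral.integral_of_le hεℓ, intervalIntegral.integral_sub i12 i3,
      intervalIntegral.integral_add (i1.const_mul θ) (i2.const_mul (1 - θ)),
      intervalIntegral.integral_const_mul, intervalIntegral.integral_const_mul]
    apply ENNReal.ofReal_le_ofReal
    have := mul_le_mul_of_nonneg_left e1 hθ.le
    have := mul_le_mul_of_nonneg_left e2 (sub_pos.2 hθ1).le
    linarith
  · rw [← IntegrableOn, ← intervalIntegrable_iff_integrableOn_Ioc_of_le hεℓ]
    exact i123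
  · refine (ae_restrict_iff' measurableSet_Ioc).2 (ae_of_all _ fun ρ hρ => ?_)
    have hρ0 := hε.trans hρ.1
    have := div_nonneg (hgap ρ hρ0) hρ0.le
    rw [hfun ρ] at this
    exact this

theorem neg_log_div_one_sub_le {θ : ℝ} (h0 : 0 < θ) (h1 : θ < 1) :
    -Real.log θ / (1 - θ) ≤ 2 * θ ^ (-(1 / 2) : ℝ) := by
  set s := θ ^ (-(1 / 2) : ℝ) with hs
  have hs0 : 0 < s := Real.rpow_pos_of_pos h0 _
  have hlog : Real.log s = -(1 / 2) * Real.log θ := Real.log_rpow h0 _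
  have h2 : s * s * θ = 1 := by
    rw [hs, ← Real.rpow_add h0]
    norm_num
    rw [Real.rpow_neg_one, inv_mul_cancel₀ h0.ne']
  have h3 := Real.log_le_sub_one_of_pos hs0
  rw [div_le_iff₀ (by linarith)]
  have h4 : 1 < s := by
    by_contra h
    push Not at h
    nlinarith [mul_pos hs0 h0]
  have : s * θ ≤ 1 := by nlinarith
  nlinarith

theorem lintegral_entropy_lt_top (C : ℝ) :
    ∫⁻ θ in Ioo (0 : ℝ) 1, ENNReal.ofReal
      (C * (θ * -Real.log θ + (1 - θ) * -Real.log (1 - θ)) / (θ * (1 - θ))) < ∞ := by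
  have i1 : IntervalIntegrable (fun θ : ℝ => θ ^ (-(1 / 2) : ℝ)) volume 0 1 :=
    intervalIntegral.intervalIntegrable_rpow' (by norm_num)
  have i2 : IntervalIntegrable (fun θ : ℝ => (1 - θ) ^ (-(1 / 2) : ℝ)) volume 0 1 := by
    have := (i1.comp_sub_left 1).symm
    simpa using this
  have i3 := ((i1.const_mul 2).add (i2.const_mul 2)).const_mul |C|
  rw [intervalIntegrable_iff_integrableOn_Ioo_of_le zero_le_one] at i3
  refine lt_of_le_of_lt ?_ i3.lintegral_lt_top
  refine setLIntegral_mono' measurableSet_Ioo fun θ hθ => ENNReal.ofReal_le_ofReal ?_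
  have h0 := hθ.1
  have h1 := hθ.2
  have h1' : 0 < 1 - θ := sub_pos.2 h1
  have e1 := neg_log_div_one_sub_le h0 h1
  have e2 := neg_log_div_one_sub_le h1' (by linarith)
  rw [sub_sub_cancel] at e2
  have l1 : 0 ≤ -Real.log θ := by linarith [Real.log_nonpos h0.le h1.le]
  have l2 : 0 ≤ -Real.log (1 - θ) := by linarith [Real.log_nonpos h1'.le (by linarith)]
  calc C * (θ * -Real.log θ + (1 - θ) * -Real.log (1 - θ)) / (θ * (1 - θ))
      = C * (-Real.log θ / (1 - θ) + -Real.log (1 - θ) / θ) := by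
        field_simp
    _ ≤ |C| * (-Real.log θ / (1 - θ) + -Real.log (1 - θ) / θ) := by
        gcongr
        exact le_abs_self C
    _ ≤ _ := by
        gcongr

end Curvature

section Curvature

variable {a : ℝ → ℝ} {L R : ℝ}

theorem lintegral_swap_left {f : ℝ → ℝ → ℝ → ℝ≥0∞}
    (hf : Measurable fun q : ℝ × ℝ × ℝ => f q.1 q.2.1 q.2.2) (μ ν κ : Measure ℝ) [SFinite μ]
    [SFinite ν] [SFinite κ] :
    ∫⁻ x, ∫⁻ y, ∫⁻ z, f x y z ∂κ ∂ν ∂μ = ∫⁻ y, ∫⁻ x, ∫⁻ z, f x y z ∂κ ∂μ ∂ν := by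
  apply lintegral_lintegral_swap
  apply Measurable.aemeasurable
  apply Measurable.lintegral_prod_right' (f := fun q : (ℝ × ℝ) × ℝ => f q.1.1 q.1.2 q.2)
  exact hf.comp (f := fun q : (ℝ × ℝ) × ℝ => (q.1.1, q.1.2, q.2)) (by fun_prop)

theorem lintegral_swap_right {f : ℝ → ℝ → ℝ → ℝ≥0∞}
    (hf : Measurable fun q : ℝ × ℝ × ℝ => f q.1 q.2.1 q.2.2) (μ ν κ : Measure ℝ)
    [SFinite ν] [SFinite κ] :
    ∫⁻ x, ∫⁻ y, ∫⁻ z, f x y z ∂κ ∂ν ∂μ = ∫⁻ x, ∫⁻ z, ∫⁻ y, f x y z ∂ν ∂κ ∂μ := by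
  refine lintegral_congr fun x => lintegral_lintegral_swap (Measurable.aemeasurable ?_)
  exact hf.comp (f := fun q : ℝ × ℝ => (x, q.1, q.2)) (by fun_prop)

theorem measurable_secondDividedDiff (ha : Continuous a) :
    Measurable fun q : ℝ × ℝ × ℝ => secondDividedDiff a q.1 q.2.1 q.2.2 := by
  unfold secondDividedDiff
  apply Measurable.div <;> apply Continuous.measurable <;> fun_prop

theorem sq_increment_le_indicator (ha : ∀ x₁ x₂ : ℝ, |a x₁ - a x₂| ≤ L * |x₁ - x₂|)
    (hl : ∀ x ≤ -R, a x = a (-R)) (hr : ∀ x, R ≤ x → a x = a R) {t : ℝ} (ht : 0 ≤ t) (x : ℝ) :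
    (a (x + t) - a x) ^ 2 ≤ (Icc (-R - t) R).indicator (fun _ => L ^ 2 * t ^ 2) x := by
  by_cases hx : x ∈ Icc (-R - t) R
  · rw [indicator_of_mem hx, ← mul_pow]
    apply sq_le_sq'
    · have := (abs_le.1 (ha (x + t) x)).1
      rwa [add_sub_cancel_left, abs_of_nonneg ht] at this
    · have := (abs_le.1 (ha (x + t) x)).2
      rwa [add_sub_cancel_left, abs_of_nonneg ht] at this
  · rw [indicator_of_notMem hx]
    have : a (x + t) = a x := by
      rw [mem_Icc, not_and_or] at hx
      rcases hx with hx | hx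
      · rw [hl (x + t) (by linarith), hl x (by linarith)]
      · rw [hr (x + t) (by linarith), hr x (by linarith)]
    simp [this]

theorem integrable_sq_increment (ha : ∀ x₁ x₂ : ℝ, |a x₁ - a x₂| ≤ L * |x₁ - x₂|)
    (hl : ∀ x ≤ -R, a x = a (-R)) (hr : ∀ x, R ≤ x → a x = a R) {t : ℝ} (ht : 0 ≤ t) :
    Integrable fun x => (a (x + t) - a x) ^ 2 := by
  have hc := continuous_of_abs_sub_le ha
  have hi : Integrable ((Icc (-R - t) R).indicator (fun _ : ℝ => L ^ 2 * t ^ 2)) := by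
    rw [integrable_indicator_iff measurableSet_Icc]
    exact integrableOn_const (by simp)
  refine hi.mono' (Continuous.aestronglyMeasurable (by fun_prop)) (ae_of_all _ fun x => ?_)
  rw [Real.norm_eq_abs, abs_of_nonneg (sq_nonneg _)]
  exact sq_increment_le_indicator ha hl hr ht x

theorem integral_sq_increment_le (ha : ∀ x₁ x₂ : ℝ, |a x₁ - a x₂| ≤ L * |x₁ - x₂|) (hR : 0 ≤ R)
    (hl : ∀ x ≤ -R, a x = a (-R)) (hr : ∀ x, R ≤ x → a x = a R) {t : ℝ} (ht : 0 ≤ t) :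
    ∫ x, (a (x + t) - a x) ^ 2 ≤ L ^ 2 * t ^ 2 * (2 * R + t) := by
  have hi : Integrable ((Icc (-R - t) R).indicator (fun _ : ℝ => L ^ 2 * t ^ 2)) := by
    rw [integrable_indicator_iff measurableSet_Icc]
    exact integrableOn_const (by simp)
  refine (integral_mono (integrable_sq_increment ha hl hr ht) hi
    fun x => sq_increment_le_indicator ha hl hr ht x).trans ?_
  rw [integral_indicator measurableSet_Icc, setIntegral_const]
  simp only [Measure.real, Real.volume_Icc, smul_eq_mul]
  rw [ENNReal.toReal_ofReal (by linarith)]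
  apply le_of_eq
  ring

/-- The mean square of the difference quotients of `a` with step `t`. -/
noncomputable def meanSqSlope (a : ℝ → ℝ) (t : ℝ) : ℝ := (∫ x, (a (x + t) - a x) ^ 2) / t ^ 2

theorem meanSqSlope_nonneg (a : ℝ → ℝ) (t : ℝ) : 0 ≤ meanSqSlope a t :=
  div_nonneg (integral_nonneg fun _ => sq_nonneg _) (sq_nonneg _)

theorem meanSqSlope_le (ha : ∀ x₁ x₂ : ℝ, |a x₁ - a x₂| ≤ L * |x₁ - x₂|) (hR : 0 ≤ R)
    (hl : ∀ x ≤ -R, a x = a (-R)) (hr : ∀ x, R ≤ x → a x = a R) {t : ℝ} (ht : 0 < t)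
    (ht' : t ≤ 2 * R) : meanSqSlope a t ≤ L ^ 2 * (4 * R) := by
  unfold meanSqSlope
  rw [div_le_iff₀ (by positivity)]
  refine (integral_sq_increment_le ha hR hl hr ht.le).trans ?_
  nlinarith [mul_nonneg (sq_nonneg L) (sq_nonneg t)]

theorem measurable_meanSqSlope (ha : Continuous a) : Measurable (meanSqSlope a) := by
  unfold meanSqSlope
  refine Measurable.div ?_ (by fun_prop)
  have : StronglyMeasurable (Function.uncurry fun t x : ℝ => (a (x + t) - a x) ^ 2) := by
    apply Continuous.stronglyMeasurable
    unfold Function.uncurry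
    fun_prop
  exact this.integral_prod_right.measurable

theorem secondDividedDiff_sq_eq (a : ℝ → ℝ) {θ ρ : ℝ} (hθ : 0 < θ) (hθ1 : θ < 1) (hρ : 0 < ρ)
    (x : ℝ) :
    secondDividedDiff a x (x + θ * ρ) (x + ρ) ^ 2 =
      (θ * ((a (x + θ * ρ) - a x) ^ 2 / (θ * ρ) ^ 2) +
        (1 - θ) * ((a ((x + θ * ρ) + (1 - θ) * ρ) - a (x + θ * ρ)) ^ 2 / ((1 - θ) * ρ) ^ 2) -
        (a (x + ρ) - a x) ^ 2 / ρ ^ 2) * (θ * (1 - θ) * ρ ^ 2)⁻¹ := by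
  have h1 : 1 - θ ≠ 0 := (sub_pos.2 hθ1).ne'
  have e : x + θ * ρ + (1 - θ) * ρ = x + ρ := by ring
  have e1 : x + θ * ρ - x = θ * ρ := by ring
  have e2 : x + ρ - x = ρ := by ring
  have e3 : x + ρ - (x + θ * ρ) = (1 - θ) * ρ := by ring
  rw [e]
  unfold secondDividedDiff
  rw [e1, e2, e3]
  generalize a (x + θ * ρ) = p
  generalize a (x + ρ) = q
  field_simp
  ring

theorem integral_secondDividedDiff_sq (ha : ∀ x₁ x₂ : ℝ, |a x₁ - a x₂| ≤ L * |x₁ - x₂|)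
    (hl : ∀ x ≤ -R, a x = a (-R)) (hr : ∀ x, R ≤ x → a x = a R) {θ ρ : ℝ} (hθ : 0 < θ)
    (hθ1 : θ < 1) (hρ : 0 < ρ) :
    Integrable (fun x => secondDividedDiff a x (x + θ * ρ) (x + ρ) ^ 2) ∧
    ∫ x, secondDividedDiff a x (x + θ * ρ) (x + ρ) ^ 2 =
      (θ * meanSqSlope a (θ * ρ) + (1 - θ) * meanSqSlope a ((1 - θ) * ρ) - meanSqSlope a ρ) *
        (θ * (1 - θ) * ρ ^ 2)⁻¹ := by
  have h1 : 0 < 1 - θ := sub_pos.2 hθ1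
  simp_rw [secondDividedDiff_sq_eq a hθ hθ1 hρ]
  have i1 := integrable_sq_increment ha hl hr (mul_pos hθ hρ).le
  have i2' := integrable_sq_increment ha hl hr (mul_pos h1 hρ).le
  have i2 := i2'.comp_add_right (θ * ρ)
  have i3 := integrable_sq_increment ha hl hr hρ.le
  have j1 := (i1.div_const ((θ * ρ) ^ 2)).const_mul θ
  have j2 := (i2.div_const (((1 - θ) * ρ) ^ 2)).const_mul (1 - θ)
  have j3 := i3.div_const (ρ ^ 2)
  refine ⟨((j1.add j2).sub j3).mul_const _, ?_⟩
  have e1 := integral_sub (j1.add j2) j3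
  simp only [Pi.add_apply] at e1
  rw [integral_mul_const, e1, integral_add j1 j2, integral_const_mul,
    integral_const_mul, integral_div, integral_div, integral_div,
    integral_add_right_eq_self (fun x => (a (x + (1 - θ) * ρ) - a x) ^ 2)]
  rfl

theorem lintegral_secondDividedDiff_sq_polar_lt_top
    (ha : ∀ x₁ x₂ : ℝ, |a x₁ - a x₂| ≤ L * |x₁ - x₂|) (hR : 0 < R)
    (hl : ∀ x ≤ -R, a x = a (-R)) (hr : ∀ x, R ≤ x → a x = a R) :
    ∫⁻ θ in Ioo (0 : ℝ) 1, ∫⁻ ρ in Ioc 0 (2 * R), ∫⁻ x, ENNReal.ofReal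
      (ρ * secondDividedDiff a x (x + θ * ρ) (x + ρ) ^ 2) < ∞ := by
  refine lt_of_le_of_lt ?_ (lintegral_entropy_lt_top (L ^ 2 * (4 * R)))
  refine setLIntegral_mono' measurableSet_Ioo fun θ hθ => ?_
  have h1 : 0 < 1 - θ := sub_pos.2 hθ.2
  have hθ0 : 0 < θ := hθ.1
  have hid : ∀ ρ, 0 < ρ → ∫⁻ x, ENNReal.ofReal
      (ρ * secondDividedDiff a x (x + θ * ρ) (x + ρ) ^ 2) = ENNReal.ofReal (θ * (1 - θ))⁻¹ *
      ENNReal.ofReal ((θ * meanSqSlope a (θ * ρ) + (1 - θ) * meanSqSlope a ((1 - θ) * ρ) -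
        meanSqSlope a ρ) / ρ) := by
    intro ρ hρ
    obtain ⟨i, e⟩ := integral_secondDividedDiff_sq ha hl hr hθ.1 hθ.2 hρ
    rw [← ofReal_integral_eq_lintegral_ofReal (i.const_mul ρ)
      (ae_of_all _ fun x => by simp only [Pi.zero_apply]; positivity), integral_const_mul, e,
      ← ENNReal.ofReal_mul (by positivity)]
    congr 1
    field_simp
  have hgap : ∀ ρ, 0 < ρ → 0 ≤ θ * meanSqSlope a (θ * ρ) +
      (1 - θ) * meanSqSlope a ((1 - θ) * ρ) - meanSqSlope a ρ := by
    intro ρ hρ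
    have e := (integral_secondDividedDiff_sq ha hl hr hθ.1 hθ.2 hρ).2
    have : 0 ≤ ∫ x, secondDividedDiff a x (x + θ * ρ) (x + ρ) ^ 2 :=
      integral_nonneg fun _ => sq_nonneg _
    rw [e] at this
    exact nonneg_of_mul_nonneg_left this (by positivity)
  rw [setLIntegral_congr_fun measurableSet_Ioc fun ρ hρ => hid ρ hρ.1, lintegral_const_mul' _ _
    ENNReal.ofReal_ne_top, mul_comm]
  refine (mul_le_mul_left (lintegral_convexity_gap_le
    (measurable_meanSqSlope (continuous_of_abs_sub_le ha)) (meanSqSlope_nonneg a)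
    (fun t h h' => meanSqSlope_le ha hR.le hl hr h h') (by positivity) hθ.1 hθ.2 hgap) _).trans ?_
  rw [← ENNReal.ofReal_mul' (by positivity), div_eq_mul_inv]

theorem lintegral_ordered_secondDividedDiff_sq_lt_top
    (ha : ∀ x₁ x₂ : ℝ, |a x₁ - a x₂| ≤ L * |x₁ - x₂|) (hR : 0 < R)
    (hl : ∀ x ≤ -R, a x = a (-R)) (hr : ∀ x, R ≤ x → a x = a R) :
    ∫⁻ x, ∫⁻ z in Ioc x (x + 2 * R), ∫⁻ y in Ioo x z,
      ENNReal.ofReal (secondDividedDiff a x y z ^ 2) < ∞ := by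
  have hm := measurable_secondDividedDiff (continuous_of_abs_sub_le ha)
  have hF : Measurable fun q : ℝ × ℝ × ℝ =>
      ENNReal.ofReal (q.2.1 * secondDividedDiff a q.1 (q.1 + q.2.2 * q.2.1) (q.1 + q.2.1) ^ 2) := by
    apply Measurable.ennreal_ofReal
    apply Measurable.mul (by fun_prop)
    apply Measurable.pow_const
    exact hm.comp (f := fun q : ℝ × ℝ × ℝ => (q.1, q.1 + q.2.2 * q.2.1, q.1 + q.2.1)) (by fun_prop)
  refine lt_of_eq_of_lt ?_ (lintegral_secondDividedDiff_sq_polar_lt_top ha hR hl hr)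
  have h1 : ∀ x z, x < z → ∫⁻ y in Ioo x z, ENNReal.ofReal (secondDividedDiff a x y z ^ 2) =
      ∫⁻ θ in Ioo (0:ℝ) 1, ENNReal.ofReal ((z - x) *
        secondDividedDiff a x (x + θ * (z - x)) z ^ 2) := by
    intro x z hxz
    have hs : 0 < z - x := sub_pos.2 hxz
    have himg : (fun θ : ℝ => x + θ * (z - x)) '' Ioo 0 1 = Ioo x z := by
      ext y
      simp only [mem_image, mem_Ioo]
      constructor
      · rintro ⟨θ, ⟨h0, h1⟩, rfl⟩
        constructor <;> nlinarith
      · rintro ⟨h0, h1⟩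
        refine ⟨(y - x) / (z - x), ⟨by apply div_pos <;> linarith, ?_⟩, ?_⟩
        · rw [div_lt_one hs]; linarith
        · rw [div_mul_cancel₀ _ hs.ne']; ring
    rw [← himg, lintegral_image_eq_lintegral_abs_deriv_mul measurableSet_Ioo
      (f' := fun _ => z - x)]
    · refine lintegral_congr fun θ => ?_
      rw [abs_of_pos hs, ENNReal.ofReal_mul hs.le]
    · intro θ _
      have := ((hasDerivAt_id θ).mul_const (z - x)).const_add x
      simpa using this.hasDerivWithinAt
    · intro u _ v _ huv
      have : u * (z - x) = v * (z - x) := by simpa using huv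
      exact mul_right_cancel₀ hs.ne' this
  have h2 : ∀ x, ∫⁻ z in Ioc x (x + 2 * R), ∫⁻ y in Ioo x z,
      ENNReal.ofReal (secondDividedDiff a x y z ^ 2) =
      ∫⁻ ρ in Ioc 0 (2 * R), ∫⁻ θ in Ioo (0:ℝ) 1, ENNReal.ofReal
        (ρ * secondDividedDiff a x (x + θ * ρ) (x + ρ) ^ 2) := by
    intro x
    rw [setLIntegral_congr_fun measurableSet_Ioc fun z hz => h1 x z hz.1]
    have := (measurePreserving_add_left volume x).setLIntegral_comp_emb
      (measurableEmbedding_addLeft x) (fun z => ∫⁻ θ in Ioo (0:ℝ) 1, ENNReal.ofReal ((z - x) *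
        secondDividedDiff a x (x + θ * (z - x)) z ^ 2)) (Ioc 0 (2 * R))
    simp only [image_const_add_Ioc, add_zero, add_sub_cancel_left] at this
    exact this.symm
  simp_rw [h2]
  rw [lintegral_swap_left (f := fun x ρ θ => ENNReal.ofReal
    (ρ * secondDividedDiff a x (x + θ * ρ) (x + ρ) ^ 2)) hF]
  rw [lintegral_swap_right (f := fun ρ x θ => ENNReal.ofReal
    (ρ * secondDividedDiff a x (x + θ * ρ) (x + ρ) ^ 2))
    (hF.comp (f := fun q : ℝ × ℝ × ℝ => (q.2.1, q.1, q.2.2)) (by fun_prop))]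
  rw [lintegral_swap_left (f := fun ρ θ x => ENNReal.ofReal
    (ρ * secondDividedDiff a x (x + θ * ρ) (x + ρ) ^ 2))
    (hF.comp (f := fun q : ℝ × ℝ × ℝ => (q.2.2, q.1, q.2.1)) (by fun_prop))]

end Curvature

section UniformBound

variable {A : ℝ → ℝ} {L R : ℝ}

theorem lintegral_inv_sq_le {d : ℝ} (hd : 0 < d) (x : ℝ) :
    ∫⁻ y in {y | d ≤ |y - x|}, ENNReal.ofReal (((y - x) ^ 2)⁻¹) ≤ ENNReal.ofReal (2 / d) := by
  have half : ∫⁻ t in Ici d, ENNReal.ofReal ((t ^ 2)⁻¹) = ENNReal.ofReal (1 / d) := by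
    rw [setLIntegral_congr Ioi_ae_eq_Ici.symm]
    have e : ∀ t ∈ Ioi d, ENNReal.ofReal ((t ^ 2)⁻¹) = ENNReal.ofReal (t ^ (-2 : ℝ)) := by
      intro t ht
      have : 0 < t := hd.trans ht
      rw [Real.rpow_neg this.le]
      norm_num
    rw [setLIntegral_congr_fun measurableSet_Ioi e,
      ← ofReal_integral_eq_lintegral_ofReal (integrableOn_Ioi_rpow_of_lt (by norm_num) hd),
      integral_Ioi_rpow_of_lt (by norm_num) hd]
    · congr 1
      norm_num
      rw [Real.rpow_neg_one]
    · refine (ae_restrict_iff' measurableSet_Ioi).2 (ae_of_all _ fun t ht => ?_)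
      exact Real.rpow_nonneg (hd.trans ht).le _
  have right : ∫⁻ y in Ici (x + d), ENNReal.ofReal (((y - x) ^ 2)⁻¹) =
      ENNReal.ofReal (1 / d) := by
    have := (measurePreserving_add_left volume x).setLIntegral_comp_emb
      (measurableEmbedding_addLeft x) (fun y => ENNReal.ofReal (((y - x) ^ 2)⁻¹)) (Ici d)
    simp only [image_const_add_Ici, add_sub_cancel_left] at this
    rw [← half, this]
  have left : ∫⁻ y in Iic (x - d), ENNReal.ofReal (((y - x) ^ 2)⁻¹) =
      ENNReal.ofReal (1 / d) := by
    have := (Measure.measurePreserving_sub_left volume x).setLIntegral_comp_emb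
      (MeasurableEquiv.subLeft x).measurableEmbedding
      (fun y => ENNReal.ofReal (((y - x) ^ 2)⁻¹)) (Ici d)
    simp only [image_const_sub_Ici] at this
    rw [← half, ← this]
    congr 1
    ext t
    ring_nf
  have hsub : {y | d ≤ |y - x|} ⊆ Ici (x + d) ∪ Iic (x - d) := by
    intro y hy
    rcases le_abs.1 (show d ≤ |y - x| from hy) with h | h
    · left; simp only [mem_Ici]; linarith
    · right; simp only [mem_Iic]; linarith
  refine (lintegral_mono_set hsub).trans ((lintegral_union_le _ _ _).trans ?_)
  rw [right, left, ← ENNReal.ofReal_add (by positivity) (by positivity)]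
  apply le_of_eq
  congr 1
  ring

theorem secondDividedDiff_swap_left (a : ℝ → ℝ) (x y z : ℝ) :
    secondDividedDiff a y x z = secondDividedDiff a x y z := by
  unfold secondDividedDiff
  rw [← neg_div_neg_eq]
  congr 1 <;> ring

theorem secondDividedDiff_swap_right (a : ℝ → ℝ) (x y z : ℝ) :
    secondDividedDiff a x z y = secondDividedDiff a x y z := by
  unfold secondDividedDiff
  rw [← neg_div_neg_eq]
  congr 1 <;> ring

theorem lintegral_add_triple {f g : ℝ → ℝ → ℝ → ℝ≥0∞}
    (hf : Measurable fun q : ℝ × ℝ × ℝ => f q.1 q.2.1 q.2.2) (μ : Measure ℝ) [SFinite μ] :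
    ∫⁻ x, ∫⁻ y, ∫⁻ z, (f x y z + g x y z) ∂μ ∂μ ∂μ =
      ∫⁻ x, ∫⁻ y, ∫⁻ z, f x y z ∂μ ∂μ ∂μ + ∫⁻ x, ∫⁻ y, ∫⁻ z, g x y z ∂μ ∂μ ∂μ := by
  have h2 : Measurable fun q : ℝ × ℝ => ∫⁻ z, f q.1 q.2 z ∂μ := by
    apply Measurable.lintegral_prod_right' (f := fun q : (ℝ × ℝ) × ℝ => f q.1.1 q.1.2 q.2)
    exact hf.comp (f := fun q : (ℝ × ℝ) × ℝ => (q.1.1, q.1.2, q.2)) (by fun_prop)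
  have h1 : Measurable fun x : ℝ => ∫⁻ y, ∫⁻ z, f x y z ∂μ ∂μ := h2.lintegral_prod_right'
  rw [← lintegral_add_left h1]
  refine lintegral_congr fun x => ?_
  have h3 : Measurable fun y : ℝ => ∫⁻ z, f x y z ∂μ :=
    h2.comp (f := fun y : ℝ => (x, y)) (by fun_prop)
  rw [← lintegral_add_left h3]
  refine lintegral_congr fun y => ?_
  exact lintegral_add_left (hf.comp (f := fun z : ℝ => (x, y, z)) (by fun_prop)) _

theorem lintegral_ordered_cube_lt_top (hA : ∀ x₁ x₂ : ℝ, |A x₁ - A x₂| ≤ L * |x₁ - x₂|)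
    (hR : 0 < R) :
    ∫⁻ x in Icc (-R) R, ∫⁻ y in Icc (-R) R, ∫⁻ z in Icc (-R) R,
      (if x < y ∧ y < z then ENNReal.ofReal (secondDividedDiff A x y z ^ 2) else 0) < ∞ := by
  have hL : 0 ≤ L := by simpa using (abs_nonneg _).trans (hA 1 0)
  set a : ℝ → ℝ := fun x => A (max (-R) (min x R)) with ha_def
  have haA : ∀ x ∈ Icc (-R) R, a x = A x := by
    intro x hx
    simp only [ha_def]
    rw [min_eq_left hx.2, max_eq_right hx.1]
  have ha : ∀ x₁ x₂ : ℝ, |a x₁ - a x₂| ≤ L * |x₁ - x₂| := by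
    intro x₁ x₂
    refine (hA _ _).trans (mul_le_mul_of_nonneg_left ?_ hL)
    rw [max_comm, max_comm (-R)]
    refine (abs_max_sub_max_le_abs (min x₁ R) (min x₂ R) (-R)).trans ?_
    refine (abs_min_sub_min_le_max x₁ R x₂ R).trans ?_
    simp
  have hl : ∀ x ≤ -R, a x = a (-R) := by
    intro x hx
    simp only [ha_def]
    rw [min_eq_left (by linarith), max_eq_left hx, min_eq_left (by linarith), max_self]
  have hr : ∀ x, R ≤ x → a x = a R := by
    intro x hx
    simp only [ha_def]
    rw [min_eq_right hx, min_self]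
  have hm := measurable_secondDividedDiff (continuous_of_abs_sub_le hA)
  have hG : Measurable fun q : ℝ × ℝ × ℝ => (if q.1 < q.2.1 ∧ q.2.1 < q.2.2 then
      ENNReal.ofReal (secondDividedDiff A q.1 q.2.1 q.2.2 ^ 2) else 0) := by
    refine Measurable.ite ?_ (by fun_prop) measurable_const
    exact (measurableSet_lt measurable_fst measurable_snd.fst).inter
      (measurableSet_lt measurable_snd.fst measurable_snd.snd)
  rw [lintegral_swap_right (f := fun x y z =>
    (if x < y ∧ y < z then ENNReal.ofReal (secondDividedDiff A x y z ^ 2) else 0)) hG]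
  refine lt_of_le_of_lt ?_ (lintegral_ordered_secondDividedDiff_sq_lt_top ha hR hl hr)
  rw [← lintegral_indicator measurableSet_Icc]
  refine lintegral_mono fun x => ?_
  refine indicator_apply_le' (fun hx => ?_) fun _ => zero_le
  rw [← lintegral_indicator measurableSet_Icc, ← lintegral_indicator measurableSet_Ioc]
  refine lintegral_mono fun z => ?_
  refine indicator_apply_le' (fun hz => ?_) fun _ => zero_le
  by_cases hxz : x < z
  · rw [indicator_of_mem (by exact ⟨hxz, by linarith [hx.1, hz.2]⟩)]
    rw [← lintegral_indicator measurableSet_Icc, ← lintegral_indicator measurableSet_Ioo]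
    refine lintegral_mono fun y => ?_
    refine indicator_apply_le' (fun hy => ?_) fun _ => zero_le
    split_ifs with h
    · rw [indicator_of_mem (by exact h)]
      unfold secondDividedDiff
      rw [haA x hx, haA y hy, haA z hz]
    · exact zero_le
  · have : ∀ y, ¬ (x < y ∧ y < z) := fun y h => hxz (h.1.trans h.2)
    simp [this]

theorem lintegral_secondDividedDiff_sq_cube_lt_top
    (hA : ∀ x₁ x₂ : ℝ, |A x₁ - A x₂| ≤ L * |x₁ - x₂|) (hR : 0 < R) :
    ∫⁻ x in Icc (-R) R, ∫⁻ y in Icc (-R) R, ∫⁻ z in Icc (-R) R,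
      ENNReal.ofReal (secondDividedDiff A x y z ^ 2) < ∞ := by
  set μ := (volume : Measure ℝ).restrict (Icc (-R) R)
  have hm := measurable_secondDividedDiff (continuous_of_abs_sub_le hA)
  set G : ℝ → ℝ → ℝ → ℝ≥0∞ := fun x y z =>
    if x < y ∧ y < z then ENNReal.ofReal (secondDividedDiff A x y z ^ 2) else 0 with hG_def
  have hG : Measurable fun q : ℝ × ℝ × ℝ => G q.1 q.2.1 q.2.2 := by
    refine Measurable.ite ?_ (by fun_prop) measurable_const
    exact (measurableSet_lt measurable_fst measurable_snd.fst).inter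
      (measurableSet_lt measurable_snd.fst measurable_snd.snd)
  have hfin : ∫⁻ x, ∫⁻ y, ∫⁻ z, G x y z ∂μ ∂μ ∂μ < ∞ := lintegral_ordered_cube_lt_top hA hR
  set J := ∫⁻ x, ∫⁻ y, ∫⁻ z, G x y z ∂μ ∂μ ∂μ
  have m2 : Measurable fun q : ℝ × ℝ × ℝ => G q.2.1 q.1 q.2.2 :=
    hG.comp (f := fun q : ℝ × ℝ × ℝ => (q.2.1, q.1, q.2.2)) (by fun_prop)
  have m3 : Measurable fun q : ℝ × ℝ × ℝ => G q.1 q.2.2 q.2.1 :=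
    hG.comp (f := fun q : ℝ × ℝ × ℝ => (q.1, q.2.2, q.2.1)) (by fun_prop)
  have m4 : Measurable fun q : ℝ × ℝ × ℝ => G q.2.1 q.2.2 q.1 :=
    hG.comp (f := fun q : ℝ × ℝ × ℝ => (q.2.1, q.2.2, q.1)) (by fun_prop)
  have m5 : Measurable fun q : ℝ × ℝ × ℝ => G q.2.2 q.1 q.2.1 :=
    hG.comp (f := fun q : ℝ × ℝ × ℝ => (q.2.2, q.1, q.2.1)) (by fun_prop)
  have e2 : ∫⁻ x, ∫⁻ y, ∫⁻ z, G y x z ∂μ ∂μ ∂μ = J :=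
    (lintegral_swap_left (f := G) hG μ μ μ).symm
  have e3 : ∫⁻ x, ∫⁻ y, ∫⁻ z, G x z y ∂μ ∂μ ∂μ = J :=
    (lintegral_swap_right (f := G) hG μ μ μ).symm
  have e4 : ∫⁻ x, ∫⁻ y, ∫⁻ z, G y z x ∂μ ∂μ ∂μ = J := by
    rw [← e3]
    exact (lintegral_swap_left (f := fun x y z => G x z y) m3 μ μ μ).symm
  have e5 : ∫⁻ x, ∫⁻ y, ∫⁻ z, G z x y ∂μ ∂μ ∂μ = J := by
    rw [← e2]
    exact (lintegral_swap_right (f := fun x y z => G y x z) m2 μ μ μ).symm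
  have e6 : ∫⁻ x, ∫⁻ y, ∫⁻ z, G z y x ∂μ ∂μ ∂μ = J := by
    rw [← e5]
    exact (lintegral_swap_left (f := fun x y z => G z x y) m5 μ μ μ).symm
  have key : ∀ x y z, ENNReal.ofReal (secondDividedDiff A x y z ^ 2) ≤
      G x y z + (G y x z + (G x z y + (G y z x + (G z x y + G z y x)))) := by
    intro x y z
    have s1 := secondDividedDiff_swap_left A x y z
    have s2 := secondDividedDiff_swap_right A x y z
    have s3 : secondDividedDiff A y z x = secondDividedDiff A x y z := by
      rw [secondDividedDiff_swap_right, s1]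
    have s4 : secondDividedDiff A z x y = secondDividedDiff A x y z := by
      rw [secondDividedDiff_swap_left, s2]
    have s5 : secondDividedDiff A z y x = secondDividedDiff A x y z := by
      rw [secondDividedDiff_swap_right, s4]
    simp only [hG_def, s1, s2, s3, s4, s5]
    by_cases h0 : x = y ∨ y = z ∨ z = x
    · have : secondDividedDiff A x y z = 0 := by
        unfold secondDividedDiff
        rcases h0 with rfl | rfl | rfl <;> simp
      simp [this]
    push Not at h0
    obtain ⟨n1, n2, n3⟩ := h0
    set c := ENNReal.ofReal (secondDividedDiff A x y z ^ 2)
    rcases lt_or_gt_of_ne n1 with h1 | h1 <;> rcases lt_or_gt_of_ne n2 with h2 | h2 <;>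
      rcases lt_or_gt_of_ne n3 with h3 | h3 <;>
      simp only [h1, h2, h3, not_lt_of_gt, and_true, and_false, if_true, if_false, and_self,
        add_zero, zero_add, le_refl] <;> exact le_self_add
  calc ∫⁻ x, ∫⁻ y, ∫⁻ z, ENNReal.ofReal (secondDividedDiff A x y z ^ 2) ∂μ ∂μ ∂μ
      ≤ ∫⁻ x, ∫⁻ y, ∫⁻ z, (G x y z + (G y x z + (G x z y + (G y z x + (G z x y + G z y x)))))
          ∂μ ∂μ ∂μ := lintegral_mono fun x => lintegral_mono fun y => lintegral_mono fun z =>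
            key x y z
    _ = J + (J + (J + (J + (J + J)))) := by
      rw [lintegral_add_triple (f := G) hG, lintegral_add_triple (f := fun x y z => G y x z) m2,
        lintegral_add_triple (f := fun x y z => G x z y) m3,
        lintegral_add_triple (f := fun x y z => G y z x) m4,
        lintegral_add_triple (f := fun x y z => G z x y) m5, e2, e3, e4, e5, e6]
    _ < ∞ := by simp [hfin]

theorem measurable_errorKernel (ε : ℝ) :
    Measurable fun q : ℝ × ℝ × ℝ => errorKernel ε q.1 q.2.1 q.2.2 := by
  unfold errorKernel
  refine Measurable.ite ?_ (by fun_prop) measurable_const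
  exact (measurableSet_le (f := fun q : ℝ × ℝ × ℝ => |q.2.1 - q.1|) (by fun_prop)
    measurable_const).inter (measurableSet_lt (g := fun q : ℝ × ℝ × ℝ => |q.2.2 - q.1|)
    measurable_const (by fun_prop))

theorem lintegral_errorKernel_le (R : ℝ) {ε : ℝ} (hε : 0 < ε) :
    ∫⁻ x in Icc (-R) R, ∫⁻ y in Icc (-R) R, ∫⁻ z in Icc (-R) R,
      ENNReal.ofReal (errorKernel ε x y z) ≤ ENNReal.ofReal (16 * R) := by
  have h1 : ∀ x y, ∫⁻ z in Icc (-R) R, ENNReal.ofReal (errorKernel ε x y z) ≤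
      (Icc (x - ε) (x + ε)).indicator (fun _ => ENNReal.ofReal (4 / ε)) y := by
    intro x y
    by_cases hy : |y - x| ≤ ε
    · have hy' : y ∈ Icc (x - ε) (x + ε) := by
        rw [abs_le] at hy
        constructor <;> linarith
      rw [indicator_of_mem hy']
      calc ∫⁻ z in Icc (-R) R, ENNReal.ofReal (errorKernel ε x y z)
          ≤ ∫⁻ z, ENNReal.ofReal (errorKernel ε x y z) := setLIntegral_le_lintegral _ _
        _ ≤ ∫⁻ z in {z | ε ≤ |z - x|}, 2 * ENNReal.ofReal (((z - x) ^ 2)⁻¹) := by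
          rw [← lintegral_indicator (measurableSet_le (by fun_prop) (by fun_prop))]
          refine lintegral_mono fun z => ?_
          unfold errorKernel
          split_ifs with h
          · rw [indicator_of_mem (by exact h.2.le), div_eq_mul_inv,
              ENNReal.ofReal_mul (by norm_num)]
            norm_num
          · simp
        _ ≤ 2 * ENNReal.ofReal (2 / ε) := by
          rw [lintegral_const_mul' _ _ (by norm_num)]
          gcongr
          exact lintegral_inv_sq_le hε x
        _ = ENNReal.ofReal (4 / ε) := by
          rw [show (2 : ℝ≥0∞) = ENNReal.ofReal 2 by norm_num, ← ENNReal.ofReal_mul (by norm_num)]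
          congr 1
          ring
    · simp [errorKernel, hy]
  calc ∫⁻ x in Icc (-R) R, ∫⁻ y in Icc (-R) R, ∫⁻ z in Icc (-R) R,
        ENNReal.ofReal (errorKernel ε x y z)
      ≤ ∫⁻ x in Icc (-R) R, ENNReal.ofReal 8 := by
        refine lintegral_mono fun x => ?_
        refine (lintegral_mono fun y => h1 x y).trans ?_
        refine (setLIntegral_le_lintegral _ _).trans ?_
        rw [lintegral_indicator measurableSet_Icc, setLIntegral_const, Real.volume_Icc,
          ← ENNReal.ofReal_mul (by positivity)]
        apply ENNReal.ofReal_le_ofReal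
        apply le_of_eq
        field_simp
        ring
    _ = ENNReal.ofReal (16 * R) := by
        rw [setLIntegral_const, Real.volume_Icc, ← ENNReal.ofReal_mul (by positivity)]
        congr 1
        ring

theorem measurable_symmKernel (hA : Continuous A) (ε : ℝ) :
    Measurable fun q : ℝ × ℝ × ℝ => symmKernel A ε q.1 q.2.1 q.2.2 := by
  have h := measurable_truncatedKernel hA ε
  have h' : ∀ f g : ℝ × ℝ × ℝ → ℝ, Measurable f → Measurable g →
      Measurable fun q => truncatedKernel A ε (f q) (g q) := fun f g hf hg =>
    h.comp (hf.prodMk hg)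
  unfold symmKernel
  refine Measurable.add (Measurable.add ?_ ?_) ?_ <;>
  · refine Complex.measurable_re.comp (Measurable.mul (h' _ _ (by fun_prop) (by fun_prop)) ?_)
    exact Complex.continuous_conj.measurable.comp (h' _ _ (by fun_prop) (by fun_prop))

theorem exists_lintegral_symmKernel_le
    (hA : ∀ x₁ x₂ : ℝ, |A x₁ - A x₂| ≤ L * |x₁ - x₂|) (hR : 0 < R) :
    ∃ K : ℝ, 0 ≤ K ∧ ∀ ε, 0 < ε → ∫⁻ x in Icc (-R) R, ∫⁻ y in Icc (-R) R, ∫⁻ z in Icc (-R) R,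
      ENNReal.ofReal |symmKernel A ε x y z| ≤ ENNReal.ofReal K := by
  set μ := (volume : Measure ℝ).restrict (Icc (-R) R)
  have hm := measurable_secondDividedDiff (continuous_of_abs_sub_le hA)
  have hfin := lintegral_secondDividedDiff_sq_cube_lt_top hA hR
  refine ⟨2 * (∫⁻ x, ∫⁻ y, ∫⁻ z, ENNReal.ofReal (secondDividedDiff A x y z ^ 2) ∂μ ∂μ ∂μ).toReal +
    16 * R + 16 * R + 16 * R, by positivity, fun ε hε => ?_⟩
  set E := fun x y z => ENNReal.ofReal (errorKernel ε x y z) with hE_def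
  have hE : Measurable fun q : ℝ × ℝ × ℝ => E q.1 q.2.1 q.2.2 :=
    (measurable_errorKernel ε).ennreal_ofReal
  have hE' : Measurable fun q : ℝ × ℝ × ℝ => E q.2.1 q.1 q.2.2 :=
    hE.comp (f := fun q : ℝ × ℝ × ℝ => (q.2.1, q.1, q.2.2)) (by fun_prop)
  have hE'' : Measurable fun q : ℝ × ℝ × ℝ => E q.1 q.2.2 q.2.1 :=
    hE.comp (f := fun q : ℝ × ℝ × ℝ => (q.1, q.2.2, q.2.1)) (by fun_prop)
  have b1 : ∫⁻ x, ∫⁻ y, ∫⁻ z, E x y z ∂μ ∂μ ∂μ ≤ ENNReal.ofReal (16 * R) :=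
    lintegral_errorKernel_le R hε
  have b2 : ∫⁻ x, ∫⁻ y, ∫⁻ z, E y z x ∂μ ∂μ ∂μ ≤ ENNReal.ofReal (16 * R) := by
    refine le_of_eq_of_le ?_ b1
    rw [lintegral_swap_right (f := E) hE μ μ μ]
    exact (lintegral_swap_left (f := fun x y z => E x z y) hE'' μ μ μ).symm
  have b3 : ∫⁻ x, ∫⁻ y, ∫⁻ z, E z x y ∂μ ∂μ ∂μ ≤ ENNReal.ofReal (16 * R) := by
    refine le_of_eq_of_le ?_ b1
    rw [lintegral_swap_left (f := E) hE μ μ μ]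
    exact (lintegral_swap_right (f := fun x y z => E y x z) hE' μ μ μ).symm
  have key : ∀ x y z, ENNReal.ofReal |symmKernel A ε x y z| ≤
      ENNReal.ofReal (secondDividedDiff A x y z ^ 2) +
      (ENNReal.ofReal (secondDividedDiff A x y z ^ 2) + (E x y z + (E y z x + E z x y))) := by
    intro x y z
    simp only [hE_def]
    have := errorKernel_nonneg ε x y z
    have := errorKernel_nonneg ε y z x
    have := errorKernel_nonneg ε z x y
    rw [← ENNReal.ofReal_add, ← ENNReal.ofReal_add, ← ENNReal.ofReal_add, ← ENNReal.ofReal_add]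
    · apply ENNReal.ofReal_le_ofReal
      linarith [abs_symmKernel_le A hε x y z]
    all_goals positivity
  refine (lintegral_mono fun x => lintegral_mono fun y => lintegral_mono fun z =>
    key x y z).trans ?_
  rw [lintegral_add_triple (f := fun x y z => ENNReal.ofReal (secondDividedDiff A x y z ^ 2))
      (by fun_prop),
    lintegral_add_triple (f := fun x y z => ENNReal.ofReal (secondDividedDiff A x y z ^ 2))
      (by fun_prop),
    lintegral_add_triple (f := E) hE, lintegral_add_triple (f := fun x y z => E y z x)
      (hE.comp (f := fun q : ℝ × ℝ × ℝ => (q.2.1, q.2.2, q.1)) (by fun_prop))]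
  set J := ∫⁻ x, ∫⁻ y, ∫⁻ z, ENNReal.ofReal (secondDividedDiff A x y z ^ 2) ∂μ ∂μ ∂μ
  rw [ENNReal.ofReal_add (by positivity) (by positivity),
    ENNReal.ofReal_add (by positivity) (by positivity),
    ENNReal.ofReal_add (by positivity) (by positivity), two_mul,
    ENNReal.ofReal_add (by positivity) (by positivity), ENNReal.ofReal_toReal hfin.ne]
  simp only [add_assoc]
  gcongr

end UniformBound

section FiniteMeasure

variable {μ : Measure ℝ} [IsFiniteMeasure μ] {E : Type*} [NormedAddCommGroup E] [NormedSpace ℝ E]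

theorem integrable_slice {F : ℝ → ℝ → ℝ → E}
    (hF : StronglyMeasurable fun q : ℝ × ℝ × ℝ => F q.1 q.2.1 q.2.2) {C : ℝ}
    (hC : ∀ x y z, ‖F x y z‖ ≤ C) :
    Integrable (fun q : ℝ × ℝ => ∫ z, F q.1 q.2 z ∂μ) (μ.prod μ) := by
  refine Integrable.of_bound (C := C * μ.real univ) ?_ (ae_of_all _ fun q => ?_)
  · have : StronglyMeasurable fun q : (ℝ × ℝ) × ℝ => F q.1.1 q.1.2 q.2 :=
      hF.comp_measurable (g := fun q : (ℝ × ℝ) × ℝ => (q.1.1, q.1.2, q.2)) (by fun_prop)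
    exact this.integral_prod_right'.aestronglyMeasurable
  · exact norm_integral_le_of_norm_le_const (ae_of_all _ fun z => hC _ _ z)

theorem integral_triple_eq {F : ℝ → ℝ → ℝ → E}
    (hF : StronglyMeasurable fun q : ℝ × ℝ × ℝ => F q.1 q.2.1 q.2.2) {C : ℝ}
    (hC : ∀ x y z, ‖F x y z‖ ≤ C) :
    ∫ x, ∫ y, ∫ z, F x y z ∂μ ∂μ ∂μ = ∫ q, F q.1 q.2.1 q.2.2 ∂(μ.prod (μ.prod μ)) := by
  rw [integral_prod _ (Integrable.of_bound hF.aestronglyMeasurable C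
    (ae_of_all _ fun q => hC _ _ _))]
  congr 1
  ext x
  rw [integral_prod]
  refine Integrable.of_bound ?_ C (ae_of_all _ fun q => hC _ _ _)
  exact (hF.comp_measurable (g := fun q : ℝ × ℝ => (x, q.1, q.2))
    (by fun_prop)).aestronglyMeasurable

theorem integral_swap_left {F : ℝ → ℝ → ℝ → E}
    (hF : StronglyMeasurable fun q : ℝ × ℝ × ℝ => F q.1 q.2.1 q.2.2) {C : ℝ}
    (hC : ∀ x y z, ‖F x y z‖ ≤ C) :
    ∫ x, ∫ y, ∫ z, F x y z ∂μ ∂μ ∂μ = ∫ y, ∫ x, ∫ z, F x y z ∂μ ∂μ ∂μ :=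
  integral_integral_swap (integrable_slice hF hC)

theorem integral_swap_right {F : ℝ → ℝ → ℝ → E}
    (hF : StronglyMeasurable fun q : ℝ × ℝ × ℝ => F q.1 q.2.1 q.2.2) {C : ℝ}
    (hC : ∀ x y z, ‖F x y z‖ ≤ C) :
    ∫ x, ∫ y, ∫ z, F x y z ∂μ ∂μ ∂μ = ∫ x, ∫ z, ∫ y, F x y z ∂μ ∂μ ∂μ := by
  congr 1
  ext x
  refine integral_integral_swap (Integrable.of_bound ?_ C (ae_of_all _ fun q => hC _ _ _))
  exact (hF.comp_measurable (g := fun q : ℝ × ℝ => (x, q.1, q.2))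
    (by fun_prop)).aestronglyMeasurable

end FiniteMeasure

section TruncatedOperator

variable {A : ℝ → ℝ}

/-- The truncated Cauchy integral operator with respect to the measure `μ`. -/
noncomputable def cauchyTrunc (A : ℝ → ℝ) (ε : ℝ) (μ : Measure ℝ) (g : ℝ → ℂ) (x : ℝ) : ℂ :=
  ∫ y, truncatedKernel A ε x y * g y ∂μ

theorem measurable_cauchyTrunc {μ : Measure ℝ} [IsFiniteMeasure μ]
    (hA : Continuous A) (ε : ℝ) {g : ℝ → ℂ} (hg : Measurable g) :
    Measurable (cauchyTrunc A ε μ g) := by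
  unfold cauchyTrunc
  have : StronglyMeasurable fun q : ℝ × ℝ => truncatedKernel A ε q.1 q.2 * g q.2 :=
    ((measurable_truncatedKernel hA ε).mul (hg.comp measurable_snd)).stronglyMeasurable
  exact this.integral_prod_right'.measurable

theorem norm_cauchyTrunc_le {μ : Measure ℝ} [IsFiniteMeasure μ] (A : ℝ → ℝ) {ε : ℝ}
    (hε : 0 < ε) {g : ℝ → ℂ} {C : ℝ}
    (hg : ∀ x, ‖g x‖ ≤ C) (x : ℝ) : ‖cauchyTrunc A ε μ g x‖ ≤ ε⁻¹ * C * μ.real univ := by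
  refine norm_integral_le_of_norm_le_const (ae_of_all _ fun y => ?_)
  rw [norm_mul]
  exact mul_le_mul (norm_truncatedKernel_le A hε x y) (hg y) (norm_nonneg _) (by positivity)

theorem integrable_truncatedKernel_mul {μ : Measure ℝ} (hA : Continuous A) {ε : ℝ}
    (hε : 0 < ε) {g : ℝ → ℂ}
    (hg : Integrable g μ) (x : ℝ) :
    Integrable (fun y => truncatedKernel A ε x y * g y) μ := by
  refine hg.bdd_mul (c := ε⁻¹) ?_ (ae_of_all _ fun y => norm_truncatedKernel_le A hε x y)
  exact ((measurable_truncatedKernel hA ε).comp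
    (measurable_const.prodMk measurable_id)).aestronglyMeasurable

theorem integral_norm_sq_cauchyTrunc_add {μ : Measure ℝ} [IsFiniteMeasure μ]
    (hA : Continuous A) {ε : ℝ} (hε : 0 < ε) {f : ℝ → ℝ} (hf : Measurable f)
    {C : ℝ} (hC : ∀ x, |f x| ≤ C) :
    ∫ x, ‖cauchyTrunc A ε μ (fun y => (f y : ℂ)) x‖ ^ 2 ∂μ +
      2 * (∫ x, f x * cauchyTrunc A ε μ (fun y => (f y : ℂ)) x *
        starRingEnd ℂ (cauchyTrunc A ε μ (fun _ => 1) x) ∂μ).re =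
    ∫ x, ∫ y, ∫ z, symmKernel A ε x y z * (f x * f y) ∂μ ∂μ ∂μ := by
  have hk := measurable_truncatedKernel hA ε
  have hk' : ∀ u v : ℝ × ℝ × ℝ → ℝ, Measurable u → Measurable v →
      Measurable fun q => truncatedKernel A ε (u q) (v q) := fun u v hu hv =>
    hk.comp (hu.prodMk hv)
  have hconj := Complex.continuous_conj.measurable
  have hC0 : 0 ≤ C := (abs_nonneg _).trans (hC 0)
  have hbd : ∀ u v u' v' x y, ‖truncatedKernel A ε u v *
      starRingEnd ℂ (truncatedKernel A ε u' v') * (f x * f y : ℂ)‖ ≤ ε⁻¹ * ε⁻¹ * (C * C) := by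
    intro u v u' v' x y
    rw [norm_mul, norm_mul, norm_mul, RCLike.norm_conj, Complex.norm_real, Complex.norm_real]
    have := norm_truncatedKernel_le A hε u v
    have := norm_truncatedKernel_le A hε u' v'
    have := hC x
    have := hC y
    have : 0 ≤ ε⁻¹ := by positivity
    simp only [Real.norm_eq_abs]
    gcongr
  set Fa : ℝ → ℝ → ℝ → ℂ := fun x y z => truncatedKernel A ε z x *
    starRingEnd ℂ (truncatedKernel A ε z y) * (f x * f y) with hFa
  set Fb : ℝ → ℝ → ℝ → ℂ := fun x y z => truncatedKernel A ε x y *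
    starRingEnd ℂ (truncatedKernel A ε x z) * (f x * f y) with hFb
  have hff : Measurable fun q : ℝ × ℝ × ℝ => (f q.1 * f q.2.1 : ℂ) := by fun_prop
  have ma : Measurable fun q : ℝ × ℝ × ℝ => Fa q.1 q.2.1 q.2.2 :=
    ((hk' _ _ (by fun_prop) (by fun_prop)).mul
      (hconj.comp (hk' _ _ (by fun_prop) (by fun_prop)))).mul hff
  have mb : Measurable fun q : ℝ × ℝ × ℝ => Fb q.1 q.2.1 q.2.2 :=
    ((hk' _ _ (by fun_prop) (by fun_prop)).mul
      (hconj.comp (hk' _ _ (by fun_prop) (by fun_prop)))).mul hff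
  have mb' : Measurable fun q : ℝ × ℝ × ℝ => Fb q.2.1 q.1 q.2.2 :=
    mb.comp (f := fun q : ℝ × ℝ × ℝ => (q.2.1, q.1, q.2.2)) (by fun_prop)
  have ma' : Measurable fun q : ℝ × ℝ × ℝ => Fa q.1 q.2.2 q.2.1 :=
    ma.comp (f := fun q : ℝ × ℝ × ℝ => (q.1, q.2.2, q.2.1)) (by fun_prop)
  have ba : ∀ x y z, ‖Fa x y z‖ ≤ ε⁻¹ * ε⁻¹ * (C * C) := fun x y z => hbd _ _ _ _ _ _
  have bb : ∀ x y z, ‖Fb x y z‖ ≤ ε⁻¹ * ε⁻¹ * (C * C) := fun x y z => hbd _ _ _ _ _ _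
  have ea : ∫ x, ∫ y, ∫ z, Fa x y z ∂μ ∂μ ∂μ =
      ((∫ x, ‖cauchyTrunc A ε μ (fun y => (f y : ℂ)) x‖ ^ 2 ∂μ : ℝ) : ℂ) := by
    rw [integral_swap_right ma.stronglyMeasurable ba,
      integral_swap_left (F := fun x z y => Fa x y z) ma'.stronglyMeasurable
        (fun x z y => ba x y z), ← integral_complex_ofReal]
    congr 1
    ext z
    have e1 : ∀ x y, Fa x y z = (truncatedKernel A ε z x * f x) *
        starRingEnd ℂ (truncatedKernel A ε z y * f y) := by
      intro x y
      simp only [hFa, map_mul, Complex.conj_ofReal]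
      ring
    simp_rw [e1, integral_const_mul, integral_mul_const]
    rw [integral_conj]
    push_cast
    exact RCLike.mul_conj _
  have eb : ∫ x, ∫ y, ∫ z, Fb x y z ∂μ ∂μ ∂μ = ∫ x, f x *
      cauchyTrunc A ε μ (fun y => (f y : ℂ)) x *
        starRingEnd ℂ (cauchyTrunc A ε μ (fun _ => 1) x) ∂μ := by
    congr 1
    ext x
    have e1 : ∀ y z, Fb x y z = (f x * (truncatedKernel A ε x y * f y)) *
        starRingEnd ℂ (truncatedKernel A ε x z) := by
      intro y z
      simp only [hFb]
      ring
    simp_rw [e1, integral_const_mul, integral_mul_const]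
    rw [integral_conj, integral_const_mul]
    simp [cauchyTrunc]
  have eb' := integral_swap_left (μ := μ) mb.stronglyMeasurable bb
  rw [integral_triple_eq (mb.stronglyMeasurable) bb, integral_triple_eq
    (F := fun y x z => Fb x y z) mb'.stronglyMeasurable (fun y x z => bb x y z)] at eb'
  rw [integral_triple_eq ma.stronglyMeasurable ba] at ea
  rw [integral_triple_eq mb.stronglyMeasurable bb] at eb
  have hFint : ∀ {F : ℝ → ℝ → ℝ → ℂ} {D : ℝ}, (Measurable fun q : ℝ × ℝ × ℝ => F q.1 q.2.1 q.2.2) →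
      (∀ x y z, ‖F x y z‖ ≤ D) →
      Integrable (fun q : ℝ × ℝ × ℝ => F q.1 q.2.1 q.2.2) (μ.prod (μ.prod μ)) :=
    fun {F} {D} hm hb => Integrable.of_bound hm.aestronglyMeasurable D
      (ae_of_all _ fun q => hb _ _ _)
  have i1 := hFint ma ba
  have i2 := hFint mb bb
  have i3 := hFint (F := fun y x z => Fb x y z) mb' (fun y x z => bb x y z)
  have es : ∀ x y z, symmKernel A ε x y z * (f x * f y) = (Fa x y z + Fb x y z + Fb y x z).re := by
    intro x y z
    have r : ∀ w : ℂ, (w * ((f x : ℂ) * f y)).re = w.re * (f x * f y) := by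
      intro w
      rw [← Complex.ofReal_mul, Complex.re_mul_ofReal]
    simp only [hFa, hFb, mul_comm (f y : ℂ) (f x), Complex.add_re, r]
    unfold symmKernel
    ring
  have bs : ∀ x y z, ‖(Fa x y z + Fb x y z + Fb y x z).re‖ ≤ 3 * (ε⁻¹ * ε⁻¹ * (C * C)) := by
    intro x y z
    refine (Complex.abs_re_le_norm _).trans ((norm_add₃_le).trans ?_)
    linarith [ba x y z, bb x y z, bb y x z]
  simp_rw [es]
  rw [integral_triple_eq (F := fun x y z => (Fa x y z + Fb x y z + Fb y x z).re)
    (Complex.measurable_re.comp ((ma.add mb).add mb')).stronglyMeasurable bs]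
  have hre := integral_re ((i1.add i2).add i3)
  have hadd := integral_add (i1.add i2) i3
  have hadd' := integral_add i1 i2
  simp only [Pi.add_apply] at hre hadd hadd'
  refine Eq.trans ?_ hre.symm
  rw [hadd, hadd', ea, ← eb', eb]
  simp only [RCLike.re_to_complex, Complex.add_re, Complex.ofReal_re]
  ring

end TruncatedOperator

section GoodSet

variable {A : ℝ → ℝ} {L R : ℝ}

theorem abs_symmKernel_le_const (A : ℝ → ℝ) {ε : ℝ} (hε : 0 < ε) (x y z : ℝ) :
    |symmKernel A ε x y z| ≤ 3 * (ε⁻¹ * ε⁻¹) := by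
  have h : ∀ u v u' v', |(truncatedKernel A ε u v *
      starRingEnd ℂ (truncatedKernel A ε u' v')).re| ≤ ε⁻¹ * ε⁻¹ := by
    intro u v u' v'
    refine (Complex.abs_re_le_norm _).trans ?_
    rw [norm_mul, RCLike.norm_conj]
    exact mul_le_mul (norm_truncatedKernel_le A hε u v) (norm_truncatedKernel_le A hε u' v')
      (norm_nonneg _) (by positivity)
  unfold symmKernel
  refine (abs_add_three _ _ _).trans ?_
  linarith [h z x z y, h x y x z, h y x y z]

/-- The integral of `|symmKernel|` over the last two variables. -/
noncomputable def symmPotential (A : ℝ → ℝ) (ε : ℝ) (μ : Measure ℝ) (x : ℝ) : ℝ :=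
  ∫ y, ∫ z, |symmKernel A ε x y z| ∂μ ∂μ

theorem integral_norm_sq_cauchyTrunc_le_of_support {μ : Measure ℝ} [IsFiniteMeasure μ]
    (hA : Continuous A) {ε : ℝ} (hε : 0 < ε) {f : ℝ → ℝ} (hf : Measurable f) {C : ℝ}
    (hC : ∀ x, |f x| ≤ C) {M : ℝ} (hM : 1 ≤ M)
    (h1 : ∀ x, f x ≠ 0 → ‖cauchyTrunc A ε μ (fun _ => 1) x‖ ≤ M)
    (h2 : ∀ x, f x ≠ 0 → symmPotential A ε μ x ≤ M) :
    ∫ x, ‖cauchyTrunc A ε μ (fun y => (f y : ℂ)) x‖ ^ 2 ∂μ ≤ 6 * M ^ 2 * ∫ x, f x ^ 2 ∂μ := by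
  have hC0 : 0 ≤ C := (abs_nonneg _).trans (hC 0)
  have hms := measurable_symmKernel hA ε
  have hfm : Measurable fun q : ℝ × ℝ × ℝ => f q.1 := by fun_prop
  have hfm' : Measurable fun q : ℝ × ℝ × ℝ => f q.2.1 := by fun_prop
  have hsb := abs_symmKernel_le_const A hε
  have hsq : ∀ x, f x ^ 2 ≤ C ^ 2 := fun x => sq_le_sq' (abs_le.1 (hC x)).1 (abs_le.1 (hC x)).2
  have hif : Integrable (fun x => f x ^ 2) μ := Integrable.of_bound
    (hf.pow_const 2).aestronglyMeasurable (C ^ 2) (ae_of_all _ fun x => by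
      rw [Real.norm_eq_abs, abs_of_nonneg (sq_nonneg _)]; exact hsq x)
  set T := cauchyTrunc A ε μ (fun y => (f y : ℂ)) with hT
  have hTm : Measurable T := measurable_cauchyTrunc hA ε (by fun_prop)
  have hTb : ∀ x, ‖T x‖ ≤ ε⁻¹ * C * μ.real univ := norm_cauchyTrunc_le A hε fun x => by
    simpa using hC x
  have hiT : Integrable (fun x => ‖T x‖ ^ 2) μ := Integrable.of_bound
    (hTm.norm.pow_const 2).aestronglyMeasurable ((ε⁻¹ * C * μ.real univ) ^ 2)
    (ae_of_all _ fun x => by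
      rw [norm_pow, norm_norm]; exact pow_le_pow_left₀ (norm_nonneg _) (hTb x) 2)
  have key := integral_norm_sq_cauchyTrunc_add (μ := μ) hA hε hf hC
  rw [← hT] at key
  -- the symmetric term
  have b1 : ∀ x y z, ‖|symmKernel A ε x y z| * f x ^ 2‖ ≤ 3 * (ε⁻¹ * ε⁻¹) * C ^ 2 := by
    intro x y z
    rw [Real.norm_eq_abs, abs_of_nonneg (by positivity)]
    exact mul_le_mul (hsb x y z) (hsq x) (by positivity) (by positivity)
  have b2 : ∀ x y z, ‖|symmKernel A ε x y z| * f y ^ 2‖ ≤ 3 * (ε⁻¹ * ε⁻¹) * C ^ 2 := by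
    intro x y z
    rw [Real.norm_eq_abs, abs_of_nonneg (by positivity)]
    exact mul_le_mul (hsb x y z) (hsq y) (by positivity) (by positivity)
  have b3 : ∀ x y z, ‖symmKernel A ε x y z * (f x * f y)‖ ≤ 3 * (ε⁻¹ * ε⁻¹) * C ^ 2 := by
    intro x y z
    rw [norm_mul, sq]
    refine mul_le_mul (hsb x y z) ?_ (by positivity) (by positivity)
    rw [norm_mul]
    exact mul_le_mul (hC x) (hC y) (norm_nonneg _) hC0
  have m1 : Measurable fun q : ℝ × ℝ × ℝ => |symmKernel A ε q.1 q.2.1 q.2.2| * f q.1 ^ 2 :=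
    (hms.norm).mul (hfm.pow_const 2)
  have m2 : Measurable fun q : ℝ × ℝ × ℝ => |symmKernel A ε q.1 q.2.1 q.2.2| * f q.2.1 ^ 2 :=
    (hms.norm).mul (hfm'.pow_const 2)
  have m3 : Measurable fun q : ℝ × ℝ × ℝ => symmKernel A ε q.1 q.2.1 q.2.2 * (f q.1 * f q.2.1) :=
    hms.mul (hfm.mul hfm')
  have e1 : ∫ x, ∫ y, ∫ z, |symmKernel A ε x y z| * f x ^ 2 ∂μ ∂μ ∂μ =
      ∫ x, symmPotential A ε μ x * f x ^ 2 ∂μ := by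
    simp_rw [integral_mul_const]
    rfl
  have e2 : ∫ x, ∫ y, ∫ z, |symmKernel A ε x y z| * f y ^ 2 ∂μ ∂μ ∂μ =
      ∫ x, symmPotential A ε μ x * f x ^ 2 ∂μ := by
    rw [integral_swap_left (F := fun x y z => |symmKernel A ε x y z| * f y ^ 2)
      m2.stronglyMeasurable b2, ← e1]
    simp_rw [symmKernel_swap]
  have i1 : Integrable (fun q : ℝ × ℝ × ℝ => |symmKernel A ε q.1 q.2.1 q.2.2| * f q.1 ^ 2)
      (μ.prod (μ.prod μ)) := Integrable.of_bound m1.aestronglyMeasurable _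
        (ae_of_all _ fun q => b1 _ _ _)
  have i2 : Integrable (fun q : ℝ × ℝ × ℝ => |symmKernel A ε q.1 q.2.1 q.2.2| * f q.2.1 ^ 2)
      (μ.prod (μ.prod μ)) := Integrable.of_bound m2.aestronglyMeasurable _
        (ae_of_all _ fun q => b2 _ _ _)
  have i3 : Integrable (fun q : ℝ × ℝ × ℝ => symmKernel A ε q.1 q.2.1 q.2.2 * (f q.1 * f q.2.1))
      (μ.prod (μ.prod μ)) := Integrable.of_bound m3.aestronglyMeasurable _
        (ae_of_all _ fun q => b3 _ _ _)
  rw [integral_triple_eq (F := fun x y z => |symmKernel A ε x y z| * f x ^ 2)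
    m1.stronglyMeasurable b1] at e1
  rw [integral_triple_eq (F := fun x y z => |symmKernel A ε x y z| * f y ^ 2)
    m2.stronglyMeasurable b2] at e2
  rw [integral_triple_eq (F := fun x y z => symmKernel A ε x y z * (f x * f y))
    m3.stronglyMeasurable b3] at key
  have hpt : ∀ x y z, symmKernel A ε x y z * (f x * f y) ≤
      2⁻¹ * (|symmKernel A ε x y z| * f x ^ 2 + |symmKernel A ε x y z| * f y ^ 2) := by
    intro x y z
    refine (le_abs_self _).trans ?_
    rw [abs_mul, ← mul_add]
    have : |f x * f y| ≤ 2⁻¹ * (f x ^ 2 + f y ^ 2) := by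
      rw [abs_le]
      constructor <;> nlinarith [sq_nonneg (f x + f y), sq_nonneg (f x - f y)]
    nlinarith [abs_nonneg (symmKernel A ε x y z)]
  have hS := integral_mono i3 ((i1.add i2).const_mul 2⁻¹) fun q => hpt q.1 q.2.1 q.2.2
  rw [integral_const_mul, integral_add' i1 i2, e1, e2] at hS
  have hpot : ∫ x, symmPotential A ε μ x * f x ^ 2 ∂μ ≤ M * ∫ x, f x ^ 2 ∂μ := by
    rw [← integral_const_mul]
    refine integral_mono_of_nonneg (ae_of_all _ fun x => ?_) (hif.const_mul M)
      (ae_of_all _ fun x => ?_)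
    · exact mul_nonneg (integral_nonneg fun y => integral_nonneg fun z => abs_nonneg _)
        (sq_nonneg _)
    · by_cases hx : f x = 0
      · simp [hx]
      · exact mul_le_mul_of_nonneg_right (h2 x hx) (sq_nonneg _)
  -- the cross term
  have hcross : -(2 * M ^ 2 * ∫ x, f x ^ 2 ∂μ + 2⁻¹ * ∫ x, ‖T x‖ ^ 2 ∂μ) ≤
      2 * (∫ x, f x * T x * starRingEnd ℂ (cauchyTrunc A ε μ (fun _ => 1) x) ∂μ).re := by
    have hn : ‖∫ x, f x * T x * starRingEnd ℂ (cauchyTrunc A ε μ (fun _ => 1) x) ∂μ‖ ≤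
        ∫ x, (M ^ 2 * f x ^ 2 + 4⁻¹ * ‖T x‖ ^ 2) ∂μ := by
      refine norm_integral_le_of_norm_le ((hif.const_mul _).add (hiT.const_mul _))
        (ae_of_all _ fun x => ?_)
      by_cases hx : f x = 0
      · simp only [hx, Complex.ofReal_zero, zero_mul, norm_zero]
        positivity
      rw [norm_mul, norm_mul, RCLike.norm_conj, Complex.norm_real, Real.norm_eq_abs]
      have := h1 x hx
      have p : |f x| * ‖T x‖ * ‖cauchyTrunc A ε μ (fun _ => 1) x‖ ≤ |f x| * ‖T x‖ * M := by
        gcongr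
      rw [← sq_abs (f x)]
      nlinarith [sq_nonneg (M * |f x| - 2⁻¹ * ‖T x‖)]
    rw [integral_add (hif.const_mul _) (hiT.const_mul _), integral_const_mul,
      integral_const_mul] at hn
    have := (abs_le.1 (Complex.abs_re_le_norm
      (∫ x, f x * T x * starRingEnd ℂ (cauchyTrunc A ε μ (fun _ => 1) x) ∂μ))).1
    linarith
  have hF : 0 ≤ ∫ x, f x ^ 2 ∂μ := integral_nonneg fun _ => sq_nonneg _
  have hMM : M * ∫ x, f x ^ 2 ∂μ ≤ M ^ 2 * ∫ x, f x ^ 2 ∂μ := by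
    gcongr
    nlinarith
  linarith

theorem integral_mul_cauchyTrunc {μ : Measure ℝ} [IsFiniteMeasure μ] (hA : Continuous A) {ε : ℝ}
    (hε : 0 < ε) {g w : ℝ → ℂ} (hg : Measurable g) (hw : Measurable w) {C D : ℝ}
    (hgb : ∀ x, ‖g x‖ ≤ C) (hwb : ∀ x, ‖w x‖ ≤ D) :
    ∫ x, w x * cauchyTrunc A ε μ g x ∂μ = -∫ y, g y * cauchyTrunc A ε μ w y ∂μ := by
  unfold cauchyTrunc
  simp_rw [← integral_const_mul]
  rw [integral_integral_swap, ← integral_neg]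
  · congr 1
    ext y
    rw [← integral_neg]
    congr 1
    ext x
    rw [truncatedKernel_swap A ε y x]
    ring
  · refine Integrable.of_bound ?_ (D * (ε⁻¹ * C)) (ae_of_all _ fun q => ?_)
    · exact ((hw.comp measurable_fst).mul ((measurable_truncatedKernel hA ε).mul
        (hg.comp measurable_snd))).aestronglyMeasurable
    · simp only [Function.uncurry]
      rw [norm_mul, norm_mul]
      have := norm_truncatedKernel_le A hε q.1 q.2
      have := hgb q.2
      have := hwb q.1
      have : 0 ≤ D := (norm_nonneg _).trans this
      gcongr

theorem setIntegral_norm_sq_cauchyTrunc_le {μ : Measure ℝ} [IsFiniteMeasure μ] (hA : Continuous A)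
    {ε : ℝ} (hε : 0 < ε) {g : ℝ → ℂ} (hg : Measurable g) {C : ℝ} (hC : ∀ x, ‖g x‖ ≤ C)
    {M : ℝ} (hM : 1 ≤ M) {E : Set ℝ} (hE : MeasurableSet E)
    (h1 : ∀ x ∈ E, ‖cauchyTrunc A ε μ (fun _ => 1) x‖ ≤ M)
    (h2 : ∀ x ∈ E, symmPotential A ε μ x ≤ M) :
    ∫ x in E, ‖cauchyTrunc A ε μ g x‖ ^ 2 ∂μ ≤ 12 * M ^ 2 * ∫ x, ‖g x‖ ^ 2 ∂μ := by
  set T := cauchyTrunc A ε μ g with hT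
  set B := ε⁻¹ * C * μ.real univ
  have hTm : Measurable T := measurable_cauchyTrunc hA ε hg
  have hTb : ∀ x, ‖T x‖ ≤ B := norm_cauchyTrunc_le A hε hC
  have hB : 0 ≤ B := (norm_nonneg _).trans (hTb 0)
  set w : ℝ → ℂ := E.indicator fun x => starRingEnd ℂ (T x) with hw
  have hwm : Measurable w := (Complex.continuous_conj.measurable.comp hTm).indicator hE
  have hwb : ∀ x, ‖w x‖ ≤ B := fun x => (norm_indicator_le_norm_self _ _).trans (by
    rw [RCLike.norm_conj]; exact hTb x)
  have hw0 : ∀ x, w x ≠ 0 → x ∈ E := fun x hx => by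
    by_contra h
    exact hx (indicator_of_notMem h _)
  have bdd2 : ∀ {h : ℝ → ℂ} {D : ℝ}, Measurable h → (∀ x, ‖h x‖ ≤ D) →
      Integrable (fun x => ‖h x‖ ^ 2) μ := fun {h} {D} hm hb => Integrable.of_bound
    (hm.norm.pow_const 2).aestronglyMeasurable (D ^ 2)
    (ae_of_all _ fun x => by
      rw [norm_pow, norm_norm]; exact pow_le_pow_left₀ (norm_nonneg _) (hb x) 2)
  have bre := integral_norm_sq_cauchyTrunc_le_of_support (μ := μ) hA hε
    (f := fun x => (w x).re) (by fun_prop) (C := B)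
    (fun x => (Complex.abs_re_le_norm _).trans (hwb x)) hM
    (fun x hx => h1 x (hw0 x fun h => hx (by simp [h])))
    (fun x hx => h2 x (hw0 x fun h => hx (by simp [h])))
  have bim := integral_norm_sq_cauchyTrunc_le_of_support (μ := μ) hA hε
    (f := fun x => (w x).im) (by fun_prop) (C := B)
    (fun x => (Complex.abs_im_le_norm _).trans (hwb x)) hM
    (fun x hx => h1 x (hw0 x fun h => hx (by simp [h])))
    (fun x hx => h2 x (hw0 x fun h => hx (by simp [h])))
  set u := cauchyTrunc A ε μ fun y => ((w y).re : ℂ) with hu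
  set v := cauchyTrunc A ε μ fun y => ((w y).im : ℂ) with hv
  set W := cauchyTrunc A ε μ w with hW
  have hum : Measurable u := measurable_cauchyTrunc hA ε (by fun_prop)
  have hvm : Measurable v := measurable_cauchyTrunc hA ε (by fun_prop)
  have hWm : Measurable W := measurable_cauchyTrunc hA ε hwm
  have hub : ∀ x, ‖u x‖ ≤ ε⁻¹ * B * μ.real univ := norm_cauchyTrunc_le A hε fun x => by
    simpa using (Complex.abs_re_le_norm _).trans (hwb x)
  have hvb : ∀ x, ‖v x‖ ≤ ε⁻¹ * B * μ.real univ := norm_cauchyTrunc_le A hε fun x => by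
    simpa using (Complex.abs_im_le_norm _).trans (hwb x)
  have hWb : ∀ x, ‖W x‖ ≤ ε⁻¹ * B * μ.real univ := norm_cauchyTrunc_le A hε hwb
  have hWuv : ∀ x, W x = u x + v x * Complex.I := by
    intro x
    simp only [hW, hu, hv, cauchyTrunc]
    rw [← integral_mul_const, ← integral_add]
    · congr 1
      ext y
      conv_lhs => rw [← Complex.re_add_im (w y)]
      ring
    · apply integrable_truncatedKernel_mul hA hε
      refine Integrable.of_bound (by fun_prop) B (ae_of_all _ fun y => ?_)
      simpa using (Complex.abs_re_le_norm _).trans (hwb y)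
    · apply Integrable.mul_const
      apply integrable_truncatedKernel_mul hA hε
      refine Integrable.of_bound (by fun_prop) B (ae_of_all _ fun y => ?_)
      simpa using (Complex.abs_im_le_norm _).trans (hwb y)
  set Y := ∫ x in E, ‖T x‖ ^ 2 ∂μ with hY
  have hYw : Y = ∫ x, ‖w x‖ ^ 2 ∂μ := by
    rw [hY, ← integral_indicator hE]
    congr 1
    ext x
    by_cases hx : x ∈ E
    · rw [indicator_of_mem hx, hw, indicator_of_mem hx, RCLike.norm_conj]
    · rw [indicator_of_notMem hx, hw, indicator_of_notMem hx]
      simp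
  have hWY : ∫ x, ‖W x‖ ^ 2 ∂μ ≤ 12 * M ^ 2 * Y := by
    have h3 : ∫ x, ‖W x‖ ^ 2 ∂μ ≤ ∫ x, (2 * ‖u x‖ ^ 2 + 2 * ‖v x‖ ^ 2) ∂μ := by
      refine integral_mono (bdd2 hWm hWb) (((bdd2 hum hub).const_mul 2).add
        ((bdd2 hvm hvb).const_mul 2)) fun x => ?_
      simp only [hWuv]
      have := norm_add_le (u x) (v x * Complex.I)
      rw [norm_mul, Complex.norm_I, mul_one] at this
      nlinarith [norm_nonneg (u x + v x * Complex.I), sq_nonneg (‖u x‖ - ‖v x‖),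
        norm_nonneg (u x), norm_nonneg (v x)]
    rw [integral_add ((bdd2 hum hub).const_mul 2) ((bdd2 hvm hvb).const_mul 2),
      integral_const_mul, integral_const_mul] at h3
    have ire : Integrable (fun x => (w x).re ^ 2) μ := by
      refine (bdd2 hwm hwb).mono' (by fun_prop) (ae_of_all _ fun x => ?_)
      rw [Real.norm_eq_abs, abs_of_nonneg (sq_nonneg _), ← sq_abs]
      gcongr
      exact Complex.abs_re_le_norm _
    have iim : Integrable (fun x => (w x).im ^ 2) μ := by
      refine (bdd2 hwm hwb).mono' (by fun_prop) (ae_of_all _ fun x => ?_)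
      rw [Real.norm_eq_abs, abs_of_nonneg (sq_nonneg _), ← sq_abs]
      gcongr
      exact Complex.abs_im_le_norm _
    have h4 : Y = ∫ x, (w x).re ^ 2 ∂μ + ∫ x, (w x).im ^ 2 ∂μ := by
      rw [hYw, ← integral_add ire iim]
      congr 1
      ext x
      rw [← Complex.normSq_eq_norm_sq, Complex.normSq_apply]
      ring
    rw [h4, mul_add]
    linarith
  have hdual : Y ≤ 6 * M ^ 2 * ∫ x, ‖g x‖ ^ 2 ∂μ + (24 * M ^ 2)⁻¹ * ∫ x, ‖W x‖ ^ 2 ∂μ := by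
    have e1 : ((Y : ℝ) : ℂ) = ∫ x, w x * T x ∂μ := by
      rw [hYw, ← integral_complex_ofReal]
      congr 1
      ext x
      by_cases hx : x ∈ E
      · rw [hw, indicator_of_mem hx, RCLike.norm_conj, mul_comm]
        exact_mod_cast (RCLike.mul_conj (T x)).symm
      · rw [hw, indicator_of_notMem hx]
        simp
    rw [integral_mul_cauchyTrunc hA hε hg hwm hC hwb] at e1
    have e2 : Y ≤ ‖(Y : ℂ)‖ := by
      rw [Complex.norm_real]
      exact le_abs_self Y
    rw [e1, norm_neg] at e2
    refine e2.trans ?_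
    rw [← integral_const_mul, ← integral_const_mul, ← integral_add ((bdd2 hg hC).const_mul _)
      ((bdd2 hWm hWb).const_mul _)]
    refine norm_integral_le_of_norm_le (((bdd2 hg hC).const_mul _).add
      ((bdd2 hWm hWb).const_mul _)) (ae_of_all _ fun x => ?_)
    rw [norm_mul]
    have hM0 : (0 : ℝ) < 24 * M ^ 2 := by positivity
    rw [← sub_nonneg]
    have : 6 * M ^ 2 * ‖g x‖ ^ 2 + (24 * M ^ 2)⁻¹ * ‖W x‖ ^ 2 - ‖g x‖ * ‖W x‖ =
      (24 * M ^ 2)⁻¹ * (12 * M ^ 2 * ‖g x‖ - ‖W x‖) ^ 2 := by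
      field_simp
      ring
    rw [this]
    positivity
  have hfin : (24 * M ^ 2)⁻¹ * ∫ x, ‖W x‖ ^ 2 ∂μ ≤ 2⁻¹ * Y := by
    rw [inv_mul_le_iff₀ (by positivity)]
    linarith
  linarith

theorem exists_good_set (hA : ∀ x₁ x₂ : ℝ, |A x₁ - A x₂| ≤ L * |x₁ - x₂|) (hR : 0 < R) :
    ∃ K : ℝ, 0 ≤ K ∧ ∀ ε, 0 < ε → ∀ M, 1 ≤ M → ∃ E : Set ℝ, MeasurableSet E ∧
      volume (Icc (-R) R \ E) ≤ ENNReal.ofReal (K / M) ∧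
      ∀ (g : ℝ → ℂ) (C : ℝ), Measurable g → (∀ x, ‖g x‖ ≤ C) →
        ∫ x in E, ‖cauchyTrunc A ε (volume.restrict (Icc (-R) R)) g x‖ ^ 2
            ∂(volume.restrict (Icc (-R) R)) ≤
          12 * M ^ 2 * ∫ x in Icc (-R) R, ‖g x‖ ^ 2 := by
  have hAc := continuous_of_abs_sub_le hA
  obtain ⟨K, hK, hbound⟩ := exists_lintegral_symmKernel_le hA hR
  refine ⟨2 * K, by positivity, fun ε hε M hM => ?_⟩
  have hbound := hbound ε hε
  set μ := (volume : Measure ℝ).restrict (Icc (-R) R) with hμ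
  have hms := measurable_symmKernel hAc ε
  have hsb := abs_symmKernel_le_const A hε
  set T := cauchyTrunc A ε μ (fun _ => 1) with hT
  have hTm : Measurable T := measurable_cauchyTrunc hAc ε measurable_const
  have hTb : ∀ x, ‖T x‖ ≤ ε⁻¹ * 1 * μ.real univ := norm_cauchyTrunc_le A hε fun x => by simp
  have hiT : Integrable (fun x => ‖T x‖ ^ 2) μ := Integrable.of_bound
    (hTm.norm.pow_const 2).aestronglyMeasurable ((ε⁻¹ * 1 * μ.real univ) ^ 2)
    (ae_of_all _ fun x => by
      rw [norm_pow, norm_norm]; exact pow_le_pow_left₀ (norm_nonneg _) (hTb x) 2)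
  have hslice : StronglyMeasurable fun q : ℝ × ℝ => ∫ z, |symmKernel A ε q.1 q.2 z| ∂μ := by
    have : StronglyMeasurable fun q : (ℝ × ℝ) × ℝ => |symmKernel A ε q.1.1 q.1.2 q.2| :=
      (hms.comp (f := fun q : (ℝ × ℝ) × ℝ => (q.1.1, q.1.2, q.2))
        (by fun_prop)).norm.stronglyMeasurable
    exact this.integral_prod_right'
  have hqm : Measurable (symmPotential A ε μ) := hslice.integral_prod_right'.measurable
  have habs : ∀ x y z, ‖|symmKernel A ε x y z|‖ ≤ 3 * (ε⁻¹ * ε⁻¹) := fun x y z => by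
    rw [Real.norm_eq_abs, abs_abs]
    exact hsb x y z
  have hq0 : ∀ x, 0 ≤ symmPotential A ε μ x := fun x =>
    integral_nonneg fun y => integral_nonneg fun z => abs_nonneg _
  have hqi : Integrable (symmPotential A ε μ) μ :=
    (integrable_slice (F := fun x y z => |symmKernel A ε x y z|) hms.norm.stronglyMeasurable
      habs).integral_prod_left
  have htriple := integral_triple_eq (μ := μ) (F := fun x y z => |symmKernel A ε x y z|)
    hms.norm.stronglyMeasurable habs
  have hqK : ∫ x, symmPotential A ε μ x ∂μ ≤ K := by
    change ∫ x, ∫ y, ∫ z, |symmKernel A ε x y z| ∂μ ∂μ ∂μ ≤ K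
    rw [htriple, integral_eq_lintegral_of_nonneg_ae (ae_of_all _ fun q => abs_nonneg _)
      hms.norm.aestronglyMeasurable]
    refine ENNReal.toReal_le_of_le_ofReal hK (le_of_eq_of_le ?_ hbound)
    have hmo : Measurable fun q : ℝ × ℝ × ℝ =>
      ENNReal.ofReal |symmKernel A ε q.1 q.2.1 q.2.2| := hms.norm.ennreal_ofReal
    rw [lintegral_prod _ hmo.aemeasurable]
    refine lintegral_congr fun x => ?_
    have hmo' : Measurable fun q : ℝ × ℝ => ENNReal.ofReal |symmKernel A ε x q.1 q.2| :=
      hmo.comp (f := fun q : ℝ × ℝ => (x, q.1, q.2)) (by fun_prop)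
    exact lintegral_prod _ hmo'.aemeasurable
  have hTK : ∫ x, ‖T x‖ ^ 2 ∂μ ≤ K := by
    have h := integral_norm_sq_cauchyTrunc_add (μ := μ) hAc hε (f := fun _ => 1)
      measurable_const (C := 1) (fun x => by simp)
    simp only [Complex.ofReal_one, one_mul, mul_one] at h
    rw [← hT] at h
    have e : ∫ x, T x * starRingEnd ℂ (T x) ∂μ = ((∫ x, ‖T x‖ ^ 2 ∂μ : ℝ) : ℂ) := by
      rw [← integral_complex_ofReal]
      congr 1
      ext x
      push_cast
      exact RCLike.mul_conj _
    rw [e, Complex.ofReal_re] at h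
    have h' : ∫ x, ∫ y, ∫ z, symmKernel A ε x y z ∂μ ∂μ ∂μ ≤
        ∫ x, ∫ y, ∫ z, |symmKernel A ε x y z| ∂μ ∂μ ∂μ := by
      rw [htriple, integral_triple_eq hms.stronglyMeasurable hsb]
      refine integral_mono (Integrable.of_bound hms.aestronglyMeasurable _
        (ae_of_all _ fun q => hsb _ _ _)) (Integrable.of_bound hms.norm.aestronglyMeasurable _
        (ae_of_all _ fun q => habs _ _ _)) fun q => le_abs_self _
    have : 0 ≤ ∫ x, ‖T x‖ ^ 2 ∂μ := integral_nonneg fun _ => sq_nonneg _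
    have hqK' : ∫ x, ∫ y, ∫ z, |symmKernel A ε x y z| ∂μ ∂μ ∂μ ≤ K := hqK
    linarith
  refine ⟨{x | ‖T x‖ ≤ M} ∩ {x | symmPotential A ε μ x ≤ M},
    (measurableSet_le hTm.norm measurable_const).inter (measurableSet_le hqm measurable_const),
    ?_, fun g C hg hC => ?_⟩
  · have hmark := mul_meas_ge_le_integral_of_nonneg (μ := μ)
      (f := fun x => ‖T x‖ ^ 2 + symmPotential A ε μ x)
      (ae_of_all _ fun x => add_nonneg (sq_nonneg _) (hq0 x)) (hiT.add hqi) M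
    rw [integral_add hiT hqi] at hmark
    have hle : μ.real {x | M ≤ ‖T x‖ ^ 2 + symmPotential A ε μ x} ≤ 2 * K / M := by
      rw [le_div_iff₀ (by positivity)]
      linarith
    rw [Measure.real] at hle
    have := ENNReal.ofReal_le_ofReal hle
    rw [ENNReal.ofReal_toReal (measure_ne_top _ _)] at this
    refine le_trans ?_ this
    have hset : MeasurableSet {x | M ≤ ‖T x‖ ^ 2 + symmPotential A ε μ x} :=
      measurableSet_le measurable_const ((hTm.norm.pow_const 2).add hqm)
    rw [show μ {x | M ≤ ‖T x‖ ^ 2 + symmPotential A ε μ x} =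
      volume ({x | M ≤ ‖T x‖ ^ 2 + symmPotential A ε μ x} ∩ Icc (-R) R) from
      Measure.restrict_apply hset]
    refine measure_mono fun x hx => ⟨?_, hx.1⟩
    have h := hx.2
    simp only [mem_inter_iff, mem_ofPred_eq, not_and_or, not_le] at h ⊢
    rcases h with h | h
    · nlinarith [hq0 x]
    · nlinarith [sq_nonneg ‖T x‖]
  · exact setIntegral_norm_sq_cauchyTrunc_le hAc hε hg hC hM
      ((measurableSet_le hTm.norm measurable_const).inter (measurableSet_le hqm measurable_const))
      (fun x hx => hx.1) (fun x hx => hx.2)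

end GoodSet

section MaximalCovering

/-- Weak-type estimate for the centred maximal function of a measure on the line. -/
theorem volume_setOf_exists_le_measure_closedBall (ν : Measure ℝ) {c : ℝ} (hc : 0 < c) (R₀ : ℝ) :
    volume {x : ℝ | ∃ r, 0 < r ∧ r ≤ R₀ ∧ ENNReal.ofReal (c * r) ≤ ν (Metric.closedBall x r)} ≤
      ENNReal.ofReal (8 / c) * ν univ := by
  obtain ⟨u, hut, hdisj, hcov⟩ := Vitali.exists_disjoint_subfamily_covering_enlargement_closedBall
    {q : ℝ × ℝ | 0 < q.2 ∧ q.2 ≤ R₀ ∧ ENNReal.ofReal (c * q.2) ≤ ν (Metric.closedBall q.1 q.2)}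
    (fun q => q.1) (fun q => q.2) R₀ (fun q hq => hq.2.1) 4 (by norm_num)
  have hcount : u.Countable := hdisj.countable_of_nonempty_interior fun q hq =>
    ⟨q.1, mem_interior_iff_mem_nhds.2 (Metric.closedBall_mem_nhds _ (hut hq).1)⟩
  calc volume {x : ℝ | ∃ r, 0 < r ∧ r ≤ R₀ ∧ ENNReal.ofReal (c * r) ≤ ν (Metric.closedBall x r)}
      ≤ volume (⋃ q ∈ u, Metric.closedBall q.1 (4 * q.2)) := by
        refine measure_mono ?_
        rintro x ⟨r, hr, hrR, hν⟩
        obtain ⟨q, hq, hsub⟩ := hcov (x, r) ⟨hr, hrR, hν⟩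
        exact mem_biUnion hq (hsub (Metric.mem_closedBall_self hr.le))
    _ ≤ ∑' q : u, volume (Metric.closedBall q.1.1 (4 * q.1.2)) := measure_biUnion_le _ hcount _
    _ ≤ ∑' q : u, ENNReal.ofReal (8 / c) * ν (Metric.closedBall q.1.1 q.1.2) := by
        refine ENNReal.tsum_le_tsum fun q => ?_
        rw [Real.volume_closedBall]
        refine le_trans (le_of_eq ?_) (mul_le_mul_right (hut q.2).2.2 _)
        rw [← ENNReal.ofReal_mul (by positivity)]
        congr 1
        field_simp
        ring
    _ ≤ ENNReal.ofReal (8 / c) * ν univ := by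
        rw [ENNReal.tsum_mul_left]
        gcongr
        rw [← measure_biUnion hcount hdisj fun q _ => measurableSet_closedBall]
        exact measure_mono (subset_univ _)

end MaximalCovering

section MaximalTruncation

variable {A : ℝ → ℝ} {L R : ℝ}

theorem norm_cauchyTrunc_sub_le (hA : ∀ x₁ x₂ : ℝ, |A x₁ - A x₂| ≤ L * |x₁ - x₂|) (hL : 0 ≤ L)
    {μ : Measure ℝ} [IsFiniteMeasure μ] (hμ : μ ≤ volume) {g : ℝ → ℂ} {η : ℝ}
    (hg : Measurable g) (hη : ∀ x, ‖g x‖ ≤ η) {δ ε x y : ℝ} (hδ : 0 < δ) (hδε : 2 * δ ≤ ε)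
    (hy : |y - x| ≤ ε / 2) :
    ‖cauchyTrunc A ε μ g x - (cauchyTrunc A δ μ g y -
      cauchyTrunc A δ μ ((Metric.closedBall x ε).indicator g) y)‖ ≤ 2 * (1 + L) * η := by
  have hAc := continuous_of_abs_sub_le hA
  have hε : 0 < ε := by linarith
  have hη0 : 0 ≤ η := (norm_nonneg _).trans (hη 0)
  have hgi : Integrable g μ := Integrable.of_bound hg.aestronglyMeasurable η (ae_of_all _ hη)
  have hgB := hgi.indicator (measurableSet_closedBall (x := x) (ε := ε))
  unfold cauchyTrunc
  have hsub : Integrable (fun w => truncatedKernel A δ y w * g w -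
      truncatedKernel A δ y w * (Metric.closedBall x ε).indicator g w) μ :=
    (integrable_truncatedKernel_mul hAc hδ hgi y).sub (integrable_truncatedKernel_mul hAc hδ hgB y)
  rw [← integral_sub (integrable_truncatedKernel_mul hAc hδ hgi y)
    (integrable_truncatedKernel_mul hAc hδ hgB y),
    ← integral_sub (integrable_truncatedKernel_mul hAc hε hgi x) hsub]
  rw [← ENNReal.ofReal_le_ofReal_iff (by positivity), ofReal_norm]
  refine (enorm_integral_le_lintegral_enorm _).trans ?_
  calc _ ≤ ∫⁻ w, {w | ε ≤ |w - x|}.indicator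
        (fun w => ENNReal.ofReal ((1 + L) * ε * η) * ENNReal.ofReal (((w - x) ^ 2)⁻¹)) w := by
        refine lintegral_mono' hμ fun w => ?_
        by_cases hw : ε < |w - x|
        · have hwy : ε / 2 < |w - y| := by
            have := abs_sub_le w y x
            linarith
          have hwy2 : |w - x| / 2 ≤ |w - y| := by
            have := abs_sub_le w y x
            linarith
          have hwB : w ∉ Metric.closedBall x ε := by
            rw [Metric.mem_closedBall, Real.dist_eq]; exact not_le.2 hw
          have h1 : truncatedKernel A ε x w = cauchyKernel A x w := if_pos hw
          have h2 : truncatedKernel A δ y w = cauchyKernel A y w := if_pos (by linarith)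
          rw [h1, h2, indicator_of_notMem hwB, mul_zero, sub_zero, ← sub_mul,
            indicator_of_mem (show w ∈ {w | ε ≤ |w - x|} from hw.le),
            ← ENNReal.ofReal_mul (by positivity), ← ofReal_norm]
          refine ENNReal.ofReal_le_ofReal ?_
          have hx0 : 0 < |w - x| := hε.trans hw
          have hy0 : 0 < |w - y| := by linarith
          rw [norm_mul]
          have hk := norm_cauchyKernel_sub_le hA (x := x) (y := y) (w := w)
            (by rintro rfl; simp at hx0) (by rintro rfl; simp at hy0)
          have hi : |w - x|⁻¹ * |w - y|⁻¹ ≤ 2 * ((w - x) ^ 2)⁻¹ := by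
            have : |w - y|⁻¹ ≤ 2 * |w - x|⁻¹ := by
              rw [inv_le_comm₀ hy0 (by positivity), mul_inv, inv_inv]
              linarith
            calc |w - x|⁻¹ * |w - y|⁻¹ ≤ |w - x|⁻¹ * (2 * |w - x|⁻¹) := by gcongr
              _ = 2 * ((w - x) ^ 2)⁻¹ := by
                rw [← sq_abs (w - x), sq, mul_inv]; ring
          calc ‖cauchyKernel A x w - cauchyKernel A y w‖ * ‖g w‖
              ≤ ((1 + L) * |y - x| * (|w - x|⁻¹ * |w - y|⁻¹)) * η :=
                mul_le_mul hk (hη w) (norm_nonneg _) (by positivity)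
            _ ≤ ((1 + L) * (ε / 2) * (2 * ((w - x) ^ 2)⁻¹)) * η := by
                refine mul_le_mul_of_nonneg_right ?_ hη0
                refine mul_le_mul (mul_le_mul_of_nonneg_left hy (by positivity)) hi
                  (by positivity) (by positivity)
            _ = (1 + L) * ε * η * ((w - x) ^ 2)⁻¹ := by ring
        · have hwB : w ∈ Metric.closedBall x ε := by
            rw [Metric.mem_closedBall, Real.dist_eq]; exact not_lt.1 hw
          have h1 : truncatedKernel A ε x w = 0 := if_neg hw
          rw [h1, indicator_of_mem hwB, zero_mul, sub_self, sub_zero, enorm_zero]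
          exact zero_le
    _ ≤ ENNReal.ofReal (2 * (1 + L) * η) := by
        rw [lintegral_indicator (measurableSet_le measurable_const (by fun_prop)),
          lintegral_const_mul _ (by fun_prop)]
        refine (mul_le_mul_right (lintegral_inv_sq_le hε x) _).trans (le_of_eq ?_)
        rw [← ENNReal.ofReal_mul (by positivity)]
        congr 1
        field_simp

theorem exists_volume_maximal_cauchyTrunc_le
    (hA : ∀ x₁ x₂ : ℝ, |A x₁ - A x₂| ≤ L * |x₁ - x₂|) (hL : 0 ≤ L) (hR : 0 < R) :
    ∃ K : ℝ, 0 ≤ K ∧ ∀ δ, 0 < δ → ∀ M, 1 ≤ M → ∀ (g : ℝ → ℂ) (η lam : ℝ), Measurable g →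
      (∀ x, ‖g x‖ ≤ η) → 0 < lam → 28 * M * η ≤ lam → 8 * (1 + L) * η ≤ lam →
      volume {x | x ∈ Icc (-R + 1) (R - 1) ∧ ∃ ε, 2 * δ ≤ ε ∧ ε ≤ 1 ∧
        lam < ‖cauchyTrunc A ε (volume.restrict (Icc (-R) R)) g x‖} ≤
      ENNReal.ofReal (8 * (K / M + 96 * M ^ 2 * η ^ 2 * R / lam ^ 2)) := by
  have hAc := continuous_of_abs_sub_le hA
  obtain ⟨K, hK, hE⟩ := exists_good_set hA hR
  refine ⟨K, hK, fun δ hδ M hM g η lam hg hη hlam hM1 hL1 => ?_⟩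
  obtain ⟨E, hEm, hEI, hEg⟩ := hE δ hδ M hM
  have hη0 : 0 ≤ η := (norm_nonneg _).trans (hη 0)
  set I := Icc (-R) R with hI
  set μ := (volume : Measure ℝ).restrict I with hμ
  have hcheb : ∀ (f : ℝ → ℂ) (a S : ℝ), Measurable f → (∀ x, ‖f x‖ ≤ η) → 0 < a →
      ∫ x in I, ‖f x‖ ^ 2 ≤ S →
      volume (E ∩ I ∩ {y | a ≤ ‖cauchyTrunc A δ μ f y‖}) ≤
        ENNReal.ofReal (12 * M ^ 2 * S / a ^ 2) := by
    intro f a S hf hfη ha hS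
    have hTm : Measurable (cauchyTrunc A δ μ f) := measurable_cauchyTrunc hAc δ hf
    have hTb := norm_cauchyTrunc_le (μ := μ) A hδ hfη
    have hFint : Integrable (fun y => ‖cauchyTrunc A δ μ f y‖ ^ 2) (μ.restrict E) :=
      Integrable.of_bound (hTm.norm.pow_const 2).aestronglyMeasurable _
        (ae_of_all _ fun x => by
          rw [norm_pow, norm_norm]; exact pow_le_pow_left₀ (norm_nonneg _) (hTb x) 2)
    have hmark := mul_meas_ge_le_integral_of_nonneg (ae_of_all _ fun x => sq_nonneg _) hFint (a ^ 2)
    have hset : MeasurableSet {y | a ^ 2 ≤ ‖cauchyTrunc A δ μ f y‖ ^ 2} :=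
      measurableSet_le measurable_const (hTm.norm.pow_const 2)
    have hle : (μ.restrict E).real {y | a ^ 2 ≤ ‖cauchyTrunc A δ μ f y‖ ^ 2} ≤
        12 * M ^ 2 * S / a ^ 2 := by
      rw [le_div_iff₀ (by positivity), mul_comm]
      refine hmark.trans ((hEg f η hf hfη).trans ?_)
      gcongr
    rw [Measure.real] at hle
    have := ENNReal.ofReal_le_ofReal hle
    rw [ENNReal.ofReal_toReal (measure_ne_top _ _), Measure.restrict_apply hset,
      Measure.restrict_apply (hset.inter hEm)] at this
    refine le_trans (measure_mono ?_) this
    exact fun y hy => ⟨⟨pow_le_pow_left₀ ha.le hy.2 2, hy.1.1⟩, hy.1.2⟩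
  set U := (I \ E) ∪ (E ∩ I ∩ {y | lam / 2 ≤ ‖cauchyTrunc A δ μ g y‖}) with hU
  have hUm : volume U ≤ ENNReal.ofReal (K / M + 96 * M ^ 2 * η ^ 2 * R / lam ^ 2) := by
    refine (measure_union_le _ _).trans ?_
    rw [ENNReal.ofReal_add (by positivity) (by positivity)]
    refine add_le_add hEI ((hcheb g (lam / 2) (η ^ 2 * (2 * R)) hg hη (by positivity) ?_).trans
      (le_of_eq ?_))
    · have := norm_setIntegral_le_of_norm_le_const (μ := volume) (s := I)
        (f := fun x => ‖g x‖ ^ 2) (C := η ^ 2) (by simp [hI]) fun x _ => by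
          rw [norm_pow, norm_norm]; exact pow_le_pow_left₀ (norm_nonneg _) (hη x) 2
      refine (le_abs_self _).trans (this.trans (le_of_eq ?_))
      rw [hI, Real.volume_real_Icc_of_le (by linarith)]
      ring
    · congr 1
      field_simp
      ring
  refine le_trans (measure_mono (t := {x : ℝ | ∃ r, 0 < r ∧ r ≤ 1 ∧
    ENNReal.ofReal (1 * r) ≤ (volume.restrict U) (Metric.closedBall x r)}) ?_) ?_
  · rintro x ⟨hx, ε, hδε, hε1, hlt⟩
    have hε : 0 < ε := by linarith
    refine ⟨ε / 2, by positivity, by linarith, ?_⟩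
    set B := Metric.closedBall x ε
    set V := E ∩ I ∩ {y | lam / 4 ≤ ‖cauchyTrunc A δ μ (B.indicator g) y‖} with hV
    have hVm : volume V ≤ ENNReal.ofReal (ε / 2) := by
      refine (hcheb (B.indicator g) (lam / 4) (η ^ 2 * (2 * ε))
        (hg.indicator measurableSet_closedBall) (fun x => (norm_indicator_le_norm_self _ _).trans
        (hη x)) (by positivity) ?_).trans (ENNReal.ofReal_le_ofReal ?_)
      · have hle : ∫ x in I, ‖B.indicator g x‖ ^ 2 ≤ ∫ x, B.indicator (fun _ => η ^ 2) x := by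
          have hFint : Integrable (B.indicator fun _ => η ^ 2) (volume : Measure ℝ) :=
            (integrable_indicator_iff measurableSet_closedBall).2
              (integrableOn_const measure_closedBall_lt_top.ne)
          refine (integral_mono_of_nonneg (ae_of_all _ fun _ => sq_nonneg _) hFint.integrableOn
            (ae_of_all _ fun y => ?_)).trans
            (setIntegral_le_integral hFint (ae_of_all _ fun y => indicator_nonneg
              (fun _ _ => sq_nonneg _) y))
          by_cases hy : y ∈ B
          · simp only [indicator_of_mem hy]
            exact pow_le_pow_left₀ (norm_nonneg _) (hη y) 2
          · simp [indicator_of_notMem hy]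
        refine hle.trans (le_of_eq ?_)
        rw [integral_indicator measurableSet_closedBall, setIntegral_const, Measure.real,
          Real.volume_closedBall, ENNReal.toReal_ofReal (by positivity), smul_eq_mul, mul_comm]
      · rw [div_le_iff₀ (by positivity)]
        have : (28 * M * η) ^ 2 ≤ lam ^ 2 := pow_le_pow_left₀ (by positivity) hM1 2
        nlinarith
    have hsub : Metric.closedBall x (ε / 2) ⊆ (U ∩ Metric.closedBall x (ε / 2)) ∪ V := by
      intro y hy
      have hyx : |y - x| ≤ ε / 2 := by rwa [Metric.mem_closedBall, Real.dist_eq] at hy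
      have hyI : y ∈ I := by
        rw [abs_le] at hyx
        exact ⟨by linarith [hx.1], by linarith [hx.2]⟩
      by_cases hyU : y ∈ U
      · exact Or.inl ⟨hyU, hy⟩
      right
      have hyE : y ∈ E := by
        by_contra h
        exact hyU (Or.inl ⟨hyI, h⟩)
      have hsmall : ‖cauchyTrunc A δ μ g y‖ < lam / 2 := by
        by_contra! h
        exact hyU (Or.inr ⟨⟨hyE, hyI⟩, h⟩)
      refine ⟨⟨hyE, hyI⟩, ?_⟩
      have h := norm_cauchyTrunc_sub_le hA hL (μ := μ) Measure.restrict_le_self hg hη hδ hδε hyx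
      have h1 := norm_le_norm_add_norm_sub' (cauchyTrunc A ε μ g x)
        (cauchyTrunc A δ μ g y - cauchyTrunc A δ μ (B.indicator g) y)
      have h2 := norm_sub_le (cauchyTrunc A δ μ g y) (cauchyTrunc A δ μ (B.indicator g) y)
      change lam / 4 ≤ ‖cauchyTrunc A δ μ (B.indicator g) y‖
      linarith
    have h := (measure_mono (μ := (volume : Measure ℝ)) hsub).trans (measure_union_le _ _)
    rw [Real.volume_closedBall] at h
    rw [Measure.restrict_apply measurableSet_closedBall, inter_comm]
    have h' := h.trans (add_le_add_right hVm _)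
    have e : ENNReal.ofReal (2 * (ε / 2)) =
        ENNReal.ofReal (1 * (ε / 2)) + ENNReal.ofReal (ε / 2) := by
      rw [← ENNReal.ofReal_add (by positivity) (by positivity)]
      congr 1
      ring
    rw [e] at h'
    exact (ENNReal.add_le_add_iff_right ENNReal.ofReal_ne_top).1 h'
  · refine (volume_setOf_exists_le_measure_closedBall _ one_pos 1).trans ?_
    rw [Measure.restrict_apply_univ, ENNReal.ofReal_mul (by norm_num)]
    gcongr
    norm_num

/-- A function of small sup norm has small maximal truncation off a set of small measure. -/
theorem exists_bound_volume_maximal_cauchyTrunc_le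
    (hA : ∀ x₁ x₂ : ℝ, |A x₁ - A x₂| ≤ L * |x₁ - x₂|) (hL : 0 ≤ L) (hR : 0 < R)
    {lam τ : ℝ} (hlam : 0 < lam) (hτ : 0 < τ) :
    ∃ η : ℝ, 0 < η ∧ ∀ g : ℝ → ℂ, Measurable g → (∀ x, ‖g x‖ ≤ η) →
      volume {x | x ∈ Icc (-R + 1) (R - 1) ∧ ∃ ε, 0 < ε ∧ ε ≤ 1 ∧
        lam < ‖cauchyTrunc A ε (volume.restrict (Icc (-R) R)) g x‖} ≤ ENNReal.ofReal τ := by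
  obtain ⟨K, hK, hmax⟩ := exists_volume_maximal_cauchyTrunc_le hA hL hR
  set M := 1 + 16 * K / τ with hMdef
  have hM : 1 ≤ M := by rw [hMdef]; simp; positivity
  have hKM : K / M ≤ τ / 16 := by
    rw [div_le_iff₀ (by positivity), hMdef]
    have : τ / 16 * (1 + 16 * K / τ) = τ / 16 + K := by field_simp
    linarith
  set N := 28 * M + 8 * (1 + L) + 1536 * M ^ 2 * R / τ with hN
  have hN1 : 1 ≤ N := by
    have : 0 ≤ 1536 * M ^ 2 * R / τ := by positivity
    linarith
  have hN0 : 0 < N := by linarith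
  have hη : ∀ c, c ≤ N → c * (lam / N) ≤ lam := fun c hc => by
    rw [mul_div_assoc', div_le_iff₀ hN0, mul_comm]
    gcongr
  refine ⟨lam / N, by positivity, fun g hg hgη => ?_⟩
  have hR1 : 0 ≤ 1536 * M ^ 2 * R / τ := by positivity
  have hb : 8 * (K / M + 96 * M ^ 2 * (lam / N) ^ 2 * R / lam ^ 2) ≤ τ := by
    have e : 96 * M ^ 2 * (lam / N) ^ 2 * R / lam ^ 2 = 96 * M ^ 2 * R / N ^ 2 := by field_simp
    have : 96 * M ^ 2 * R / N ^ 2 ≤ τ / 16 := by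
      rw [div_le_iff₀ (by positivity)]
      have h1 : 1536 * M ^ 2 * R / τ ≤ N ^ 2 := by nlinarith
      rw [div_le_iff₀ hτ] at h1
      linarith
    rw [e]
    linarith
  have hset : {x | x ∈ Icc (-R + 1) (R - 1) ∧ ∃ ε, 0 < ε ∧ ε ≤ 1 ∧
        lam < ‖cauchyTrunc A ε (volume.restrict (Icc (-R) R)) g x‖} ⊆
      ⋃ n : ℕ, {x | x ∈ Icc (-R + 1) (R - 1) ∧ ∃ ε, 2 * (1 / ((n : ℝ) + 1)) ≤ ε ∧ ε ≤ 1 ∧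
        lam < ‖cauchyTrunc A ε (volume.restrict (Icc (-R) R)) g x‖} := by
    rintro x ⟨hx, ε, hε, hε1, h⟩
    obtain ⟨n, hn⟩ := exists_nat_one_div_lt (half_pos hε)
    exact mem_iUnion.2 ⟨n, hx, ε, by linarith, hε1, h⟩
  refine (measure_mono hset).trans ?_
  rw [Monotone.measure_iUnion]
  · refine iSup_le fun n => (hmax _ (by positivity) M hM g (lam / N) lam hg hgη hlam
      (hη _ (by linarith)) (hη _ (by linarith))).trans (ENNReal.ofReal_le_ofReal hb)
  · rintro m n hmn x ⟨hx, ε, hε, h⟩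
    refine ⟨hx, ε, le_trans ?_ hε, h⟩
    gcongr

end MaximalTruncation

section FundamentalTheorem

theorem AbsolutelyContinuousOnInterval.of_dist_le {X Y : Type*} [PseudoMetricSpace X]
    [PseudoMetricSpace Y] {f : ℝ → X} {g : ℝ → Y} {a b : ℝ}
    (hf : AbsolutelyContinuousOnInterval f a b) (h : ∀ x y, dist (g x) (g y) ≤ dist (f x) (f y)) :
    AbsolutelyContinuousOnInterval g a b :=
  squeeze_zero (fun _ => Finset.sum_nonneg fun _ _ => dist_nonneg)
    (fun _ => Finset.sum_le_sum fun _ _ => h _ _) hf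

theorem AbsolutelyContinuousOnInterval.of_re_im {f : ℝ → ℂ} {a b : ℝ}
    (hre : AbsolutelyContinuousOnInterval (fun x => (f x).re) a b)
    (him : AbsolutelyContinuousOnInterval (fun x => (f x).im) a b) :
    AbsolutelyContinuousOnInterval f a b := by
  have h := Tendsto.add hre him
  rw [add_zero] at h
  refine squeeze_zero (fun _ => Finset.sum_nonneg fun _ _ => dist_nonneg) (fun E => ?_) h
  rw [← Finset.sum_add_distrib]
  refine Finset.sum_le_sum fun i _ => ?_
  rw [dist_eq_norm, Real.dist_eq, Real.dist_eq, ← Complex.sub_re, ← Complex.sub_im]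
  exact Complex.norm_le_abs_re_add_abs_im _

theorem IntervalIntegrable.absolutelyContinuousOnInterval_complex {f : ℝ → ℂ} {a b c : ℝ}
    (hf : IntervalIntegrable f volume a b) (hc : c ∈ uIcc a b) :
    AbsolutelyContinuousOnInterval (fun x => ∫ t in c..x, f t) a b := by
  have hre : IntervalIntegrable (fun t => (f t).re) volume a b :=
    ⟨hf.1.re, hf.2.re⟩
  have him : IntervalIntegrable (fun t => (f t).im) volume a b :=
    ⟨hf.1.im, hf.2.im⟩
  have key : ∀ x ∈ uIcc a b, IntervalIntegrable f volume c x := fun x hx =>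
    hf.mono_set (uIcc_subset_uIcc hc hx)
  have aux : ∀ u v : ℝ → ℝ, AbsolutelyContinuousOnInterval u a b → EqOn u v (uIcc a b) →
      AbsolutelyContinuousOnInterval v a b := fun u v hu huv => by
    rw [absolutelyContinuousOnInterval_iff] at hu ⊢
    intro ε hε
    obtain ⟨δ, hδ, h⟩ := hu ε hε
    refine ⟨δ, hδ, fun E hE hlt => lt_of_eq_of_lt (Finset.sum_congr rfl fun i hi => ?_)
      (h E hE hlt)⟩
    rw [huv (hE.1 i hi).1, huv (hE.1 i hi).2]
  refine .of_re_im (aux _ _ (hre.absolutelyContinuousOnInterval_intervalIntegral hc)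
    fun x hx => ?_) (aux _ _ (him.absolutelyContinuousOnInterval_intervalIntegral hc)
    fun x hx => ?_)
  · exact (intervalIntegral.intervalIntegral_re (𝕜 := ℂ) (key x hx))
  · exact (intervalIntegral.intervalIntegral_im (𝕜 := ℂ) (key x hx))

/-- Fundamental theorem of calculus for absolutely continuous complex functions. -/
theorem AbsolutelyContinuousOnInterval.integral_eq_sub {f f' : ℝ → ℂ} {a b : ℝ}
    (hf : AbsolutelyContinuousOnInterval f a b)
    (hd : ∀ᵐ x, x ∈ uIcc a b → HasDerivAt f (f' x) x) :
    IntervalIntegrable f' volume a b ∧ ∫ x in a..b, f' x = f b - f a := by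
  have hre : AbsolutelyContinuousOnInterval (fun x => (f x).re) a b :=
    hf.of_dist_le fun x y => by
      rw [Real.dist_eq, dist_eq_norm, ← Complex.sub_re]
      exact Complex.abs_re_le_norm _
  have him : AbsolutelyContinuousOnInterval (fun x => (f x).im) a b :=
    hf.of_dist_le fun x y => by
      rw [Real.dist_eq, dist_eq_norm, ← Complex.sub_im]
      exact Complex.abs_im_le_norm _
  have e : ∀ᵐ x, x ∈ uIoc a b → ((deriv (fun x => (f x).re) x : ℝ) : ℂ) +
      ((deriv (fun x => (f x).im) x : ℝ) : ℂ) * Complex.I = f' x := by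
    filter_upwards [hd] with x hx hx'
    have h := hx (uIoc_subset_uIcc hx')
    have h1 : HasDerivAt (fun x => (f x).re) (f' x).re x :=
      (Complex.reCLM.hasFDerivAt.comp_hasDerivAt x h)
    have h2 : HasDerivAt (fun x => (f x).im) (f' x).im x :=
      (Complex.imCLM.hasFDerivAt.comp_hasDerivAt x h)
    rw [h1.deriv, h2.deriv, Complex.re_add_im]
  have hofReal : ∀ g : ℝ → ℝ, IntervalIntegrable g volume a b →
      IntervalIntegrable (fun x => (g x : ℂ)) volume a b := fun g hg => ⟨hg.1.ofReal, hg.2.ofReal⟩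
  have i1 := hofReal _ hre.intervalIntegrable_deriv
  have i2 := (hofReal _ him.intervalIntegrable_deriv).mul_const Complex.I
  refine ⟨(i1.add i2).congr_ae ((ae_restrict_iff' measurableSet_uIoc).2 e), ?_⟩
  rw [← intervalIntegral.integral_congr_ae e]
  have := intervalIntegral.integral_add i1 i2
  refine this.trans ?_
  rw [intervalIntegral.integral_mul_const]
  have r1 := intervalIntegral.integral_ofReal (μ := volume) (a := a) (b := b)
    (f := deriv (fun x => (f x).re))
  have r2 := intervalIntegral.integral_ofReal (μ := volume) (a := a) (b := b)
    (f := deriv (fun x => (f x).im))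
  refine (congrArg₂ (fun u v => u + v * Complex.I) r1 r2).trans ?_
  rw [hre.integral_deriv_eq_sub, him.integral_deriv_eq_sub]
  apply Complex.ext <;> simp

end FundamentalTheorem

section SmoothClass

open scoped Topology

variable {A : ℝ → ℝ} {L R : ℝ}

/-- The derivative of the parametrization `x ↦ x + i A(x)`. -/
noncomputable def graphDeriv (A : ℝ → ℝ) (y : ℝ) : ℂ :=
  1 + Complex.I * ((deriv A y : ℝ) : ℂ)

theorem measurable_graphDeriv (A : ℝ → ℝ) : Measurable (graphDeriv A) := by
  unfold graphDeriv
  exact measurable_const.add (measurable_const.mul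
    (Complex.measurable_ofReal.comp (measurable_deriv A)))

theorem one_le_norm_graphDeriv (A : ℝ → ℝ) (y : ℝ) : 1 ≤ ‖graphDeriv A y‖ := by
  have := Complex.abs_re_le_norm (graphDeriv A y)
  simpa [graphDeriv] using this

theorem norm_graphDeriv_le (hA : ∀ x₁ x₂ : ℝ, |A x₁ - A x₂| ≤ L * |x₁ - x₂|) (hL : 0 ≤ L)
    (y : ℝ) : ‖graphDeriv A y‖ ≤ 1 + L := by
  have h : ‖deriv A y‖ ≤ L := norm_deriv_le_of_lip' hL (Eventually.of_forall fun x => hA x y)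
  refine (norm_add_le _ _).trans ?_
  rw [norm_one, norm_mul, Complex.norm_I, one_mul, Complex.norm_real]
  linarith

theorem hasDerivAt_cauchyKernel_denominator {y : ℝ} (h : DifferentiableAt ℝ A y) (x : ℝ) :
    HasDerivAt (fun w : ℝ => (w : ℂ) - (x : ℂ) + Complex.I * ((A w : ℂ) - (A x : ℂ)))
      (graphDeriv A y) y := by
  unfold graphDeriv
  exact ((Complex.ofRealCLM.hasDerivAt (x := y)).sub_const _).add
    ((h.hasDerivAt.ofReal_comp.sub_const _).const_mul _)

theorem ae_differentiableAt_of_abs_sub_le (hA : ∀ x₁ x₂ : ℝ, |A x₁ - A x₂| ≤ L * |x₁ - x₂|) :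
    ∀ᵐ x : ℝ, DifferentiableAt ℝ A x :=
  (LipschitzWith.of_dist_le' (K := L) fun x y => by
    simpa [Real.dist_eq] using hA x y).ae_differentiableAt_real

theorem lipschitzOnWith_log {d : ℝ} (hd : 0 < d) :
    LipschitzOnWith d⁻¹.toNNReal Complex.log {z : ℂ | d ≤ z.re} := by
  have hre : ∀ z ∈ {z : ℂ | d ≤ z.re}, z ∈ Complex.slitPlane := fun z hz =>
    Or.inl (hd.trans_le hz)
  refine Convex.lipschitzOnWith_of_nnnorm_deriv_le (𝕜 := ℂ)
    (fun z hz => Complex.differentiableAt_log (hre z hz)) (fun z hz => ?_)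
    (convex_halfSpace_re_ge d)
  rw [(Complex.hasDerivAt_log (hre z hz)).deriv, ← NNReal.coe_le_coe, coe_nnnorm, norm_inv,
    Real.coe_toNNReal _ (by positivity)]
  refine inv_anti₀ hd (le_trans ?_ (Complex.abs_re_le_norm z))
  exact le_trans hz (le_abs_self _)

theorem integral_cauchyKernel_mul_graphDeriv
    (hA : ∀ x₁ x₂ : ℝ, |A x₁ - A x₂| ≤ L * |x₁ - x₂|) {x a b c d : ℝ} (hd : 0 < d)
    (hc : ∀ y ∈ uIcc a b, d ≤ c * (y - x)) :
    ∫ y in a..b, cauchyKernel A x y * graphDeriv A y =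
      Complex.log (c * ((b : ℂ) - (x : ℂ) + Complex.I * ((A b : ℂ) - (A x : ℂ)))) -
      Complex.log (c * ((a : ℂ) - (x : ℂ) + Complex.I * ((A a : ℂ) - (A x : ℂ)))) := by
  have hc0 : (c : ℂ) ≠ 0 := by
    rintro h
    have h' : c = 0 := by exact_mod_cast h
    have := hc a left_mem_uIcc
    rw [h', zero_mul] at this
    linarith
  have hmem : ∀ y ∈ uIcc a b,
      (c : ℂ) * ((y : ℂ) - (x : ℂ) + Complex.I * ((A y : ℂ) - (A x : ℂ))) ∈
        {z : ℂ | d ≤ z.re} := fun y hy => by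
    have := hc y hy
    simpa using this
  have hlip : LipschitzWith (Real.toNNReal (|c| * (1 + L)))
      fun y : ℝ => (c : ℂ) * ((y : ℂ) - (x : ℂ) + Complex.I * ((A y : ℂ) - (A x : ℂ))) := by
    refine LipschitzWith.of_dist_le' fun y w => ?_
    rw [dist_eq_norm, Real.dist_eq]
    have := norm_cauchyKernel_denominator_le hA w y
    calc _ = ‖(c : ℂ) * ((y : ℂ) - w + Complex.I * ((A y : ℂ) - (A w : ℂ)))‖ := by
            congr 1; ring
      _ ≤ |c| * ((1 + L) * |y - w|) := by
        rw [norm_mul, Complex.norm_real, Real.norm_eq_abs]; gcongr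
      _ = _ := by ring
  have hac := ((lipschitzOnWith_log hd).comp (hlip.lipschitzOnWith (s := uIcc a b))
    hmem).absolutelyContinuousOnInterval
  refine (hac.integral_eq_sub ?_).2
  filter_upwards [ae_differentiableAt_of_abs_sub_le hA] with y hy hyab
  have h := ((hasDerivAt_cauchyKernel_denominator hy x).const_mul (c : ℂ)).clog_real
    (Or.inl (hd.trans_le (hmem y hyab)))
  rw [mul_div_mul_left _ _ hc0, div_eq_mul_inv, mul_comm] at h
  exact h

theorem cauchyTrunc_eq_add {g : ℝ → ℂ} {x δ : ℝ} (hAc : Continuous A) (hδ : 0 < δ)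
    (h1 : -R ≤ x - δ) (h2 : x + δ ≤ R) (hg : IntegrableOn g (Icc (-R) R)) :
    cauchyTrunc A δ (volume.restrict (Icc (-R) R)) g x =
      (∫ y in (-R)..(x - δ), cauchyKernel A x y * g y) +
        ∫ y in (x + δ)..R, cauchyKernel A x y * g y := by
  have hFint := integrable_truncatedKernel_mul hAc hδ hg x
  have hi : ∀ a b, -R ≤ a → a ≤ b → b ≤ R →
      IntervalIntegrable (fun y => truncatedKernel A δ x y * g y) volume a b :=
    fun a b ha hab hb => (intervalIntegrable_iff_integrableOn_Icc_of_le hab).2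
      (IntegrableOn.mono_set hFint (Icc_subset_Icc ha hb))
  unfold cauchyTrunc
  rw [integral_Icc_eq_integral_Ioc, ← intervalIntegral.integral_of_le (by linarith),
    ← intervalIntegral.integral_add_adjacent_intervals (b := x - δ)
      (hi _ _ le_rfl h1 (by linarith)) (hi _ _ h1 (by linarith) le_rfl),
    ← intervalIntegral.integral_add_adjacent_intervals (a := x - δ) (b := x + δ)
      (hi _ _ h1 (by linarith) h2) (hi _ _ (by linarith) h2 le_rfl)]
  have e1 : ∫ y in (-R)..(x - δ), truncatedKernel A δ x y * g y =
      ∫ y in (-R)..(x - δ), cauchyKernel A x y * g y := by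
    refine intervalIntegral.integral_congr_ae ?_
    filter_upwards [Measure.ae_ne volume (x - δ)] with y hy hyI
    rw [uIoc_of_le h1] at hyI
    have hlt : δ < |y - x| := by
      rw [abs_sub_comm]
      exact lt_of_lt_of_le (by linarith [lt_of_le_of_ne hyI.2 hy]) (le_abs_self _)
    rw [truncatedKernel, if_pos hlt]
  have e2 : ∫ y in (x - δ)..(x + δ), truncatedKernel A δ x y * g y = 0 := by
    refine (intervalIntegral.integral_congr (g := fun _ => 0) fun y hy => ?_).trans (by simp)
    rw [uIcc_of_le (by linarith)] at hy
    have hnlt : ¬ δ < |y - x| := not_lt.2 (abs_le.2 ⟨by linarith [hy.1], by linarith [hy.2]⟩)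
    simp only [truncatedKernel, if_neg hnlt, zero_mul]
  have e3 : ∫ y in (x + δ)..R, truncatedKernel A δ x y * g y =
      ∫ y in (x + δ)..R, cauchyKernel A x y * g y := by
    refine intervalIntegral.integral_congr_ae (ae_of_all _ fun y hyI => ?_)
    rw [uIoc_of_le h2] at hyI
    have hlt : δ < |y - x| := lt_of_lt_of_le (by linarith [hyI.1]) (le_abs_self _)
    rw [truncatedKernel, if_pos hlt]
  rw [e1, e2, e3, zero_add]

theorem tendsto_log_sub_log {x : ℝ} (h : DifferentiableAt ℝ A x) :
    Tendsto (fun δ : ℝ =>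
      Complex.log (((-1 : ℝ) : ℂ) * (((x - δ : ℝ) : ℂ) - (x : ℂ) +
        Complex.I * ((A (x - δ) : ℂ) - (A x : ℂ)))) -
      Complex.log (((1 : ℝ) : ℂ) * (((x + δ : ℝ) : ℂ) - (x : ℂ) +
        Complex.I * ((A (x + δ) : ℂ) - (A x : ℂ))))) (𝓝[>] 0) (𝓝 0) := by
  set D : ℝ → ℂ := fun y => (y : ℂ) - (x : ℂ) + Complex.I * ((A y : ℂ) - (A x : ℂ)) with hD
  have hd : HasDerivAt D (graphDeriv A x) x := hasDerivAt_cauchyKernel_denominator h x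
  have hD0 : D x = 0 := by simp [hD]
  have hs : graphDeriv A x ∈ Complex.slitPlane := Or.inl (by simp [graphDeriv])
  have hsl := hasDerivAt_iff_tendsto_slope_zero.1 hd
  have hr : Tendsto (fun δ : ℝ => Complex.log (δ⁻¹ • D (x + δ))) (𝓝[>] 0)
      (𝓝 (Complex.log (graphDeriv A x))) := by
    refine ((continuousAt_clog hs).tendsto.comp (hsl.mono_left
      (nhdsWithin_mono _ fun t ht => (ne_of_gt ht)))).congr fun δ => ?_
    simp [hD0]
  have hneg : Tendsto (fun δ : ℝ => -δ) (𝓝[>] 0) (𝓝[≠] 0) := by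
    refine tendsto_nhdsWithin_iff.2 ⟨?_, ?_⟩
    · exact (Continuous.tendsto' continuous_neg 0 0 neg_zero).mono_left nhdsWithin_le_nhds
    · filter_upwards [self_mem_nhdsWithin] with δ hδ
      exact neg_ne_zero.2 (ne_of_gt hδ)
  have hl : Tendsto (fun δ : ℝ => Complex.log (δ⁻¹ • (((-1 : ℝ) : ℂ) * D (x - δ)))) (𝓝[>] 0)
      (𝓝 (Complex.log (graphDeriv A x))) := by
    refine ((continuousAt_clog hs).tendsto.comp (hsl.comp hneg)).congr fun δ => ?_
    simp only [Function.comp_apply, hD0, sub_zero, ← sub_eq_add_neg, inv_neg, neg_smul]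
    congr 1
    simp
  have h0 := hl.sub hr
  rw [sub_self] at h0
  refine h0.congr' ?_
  filter_upwards [self_mem_nhdsWithin] with δ hδ
  have hδ : 0 < δ := hδ
  have hlog : ∀ z : ℂ, z ≠ 0 →
      Complex.log (δ⁻¹ • z) = Real.log δ⁻¹ + Complex.log z := fun z hz => by
    rw [Complex.real_smul, Complex.log_ofReal_mul (by positivity) hz]
  have hne : ∀ y, y ≠ x → D y ≠ 0 := fun y hy => cauchyKernel_denominator_ne_zero hy
  rw [hlog _ (mul_ne_zero (by simp) (hne _ (by linarith [hδ] : x - δ < x).ne)),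
    hlog _ (hne _ (by linarith [hδ] : x < x + δ).ne')]
  simp only [hD, Complex.ofReal_one, one_mul]
  ring

theorem exists_tendsto_cauchyTrunc_mul_graphDeriv
    (hA : ∀ x₁ x₂ : ℝ, |A x₁ - A x₂| ≤ L * |x₁ - x₂|) (hL : 0 ≤ L) {φ : ℝ → ℂ} {C : ℝ}
    (hφ : ∀ x y, ‖φ y - φ x‖ ≤ C * |y - x|) {x : ℝ} (hx : x ∈ Ioo (-R) R)
    (hAx : DifferentiableAt ℝ A x) :
    ∃ v, Tendsto (fun δ => cauchyTrunc A δ (volume.restrict (Icc (-R) R))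
      (fun y => φ y * graphDeriv A y) x) (𝓝[>] 0) (𝓝 v) := by
  have hAc := continuous_of_abs_sub_le hA
  set μ := (volume : Measure ℝ).restrict (Icc (-R) R) with hμ
  have hC : 0 ≤ C := by
    have := (norm_nonneg _).trans (hφ 0 1)
    simpa using this
  have hφc : Continuous φ := (LipschitzWith.of_dist_le' (K := C) fun y w => by
    rw [dist_eq_norm, Real.dist_eq]; exact hφ w y).continuous
  have hγm := measurable_graphDeriv A
  have hγi : Integrable (graphDeriv A) μ := Integrable.of_bound hγm.aestronglyMeasurable _
    (ae_of_all _ (norm_graphDeriv_le hA hL))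
  have hdiff : ∀ y, ‖(φ y - φ x) * graphDeriv A y‖ ≤ C * |y - x| * (1 + L) := fun y => by
    rw [norm_mul]
    exact mul_le_mul (hφ x y) (norm_graphDeriv_le hA hL y) (norm_nonneg _) (by positivity)
  have hdm : Measurable fun y => (φ y - φ x) * graphDeriv A y :=
    (hφc.measurable.sub_const _).mul hγm
  have hdi : Integrable (fun y => (φ y - φ x) * graphDeriv A y) μ := by
    refine Integrable.of_bound hdm.aestronglyMeasurable (C * (2 * R) * (1 + L)) ?_
    refine (ae_restrict_iff' measurableSet_Icc).2 (ae_of_all _ fun y hy => (hdiff y).trans ?_)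
    have : |y - x| ≤ 2 * R := abs_le.2 ⟨by linarith [hy.1, hx.2], by linarith [hy.2, hx.1]⟩
    gcongr
  have hmain : Tendsto (fun δ => cauchyTrunc A δ μ (fun y => (φ y - φ x) * graphDeriv A y) x)
      (𝓝[>] 0) (𝓝 (∫ y, cauchyKernel A x y * ((φ y - φ x) * graphDeriv A y) ∂μ)) := by
    refine tendsto_integral_filter_of_dominated_convergence (fun _ => C * (1 + L)) ?_ ?_
      (integrable_const _) ?_
    · refine Eventually.of_forall fun δ => ?_
      have hk : Measurable fun y => truncatedKernel A δ x y :=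
        (measurable_truncatedKernel hAc δ).comp (f := fun y => (x, y)) (by fun_prop)
      exact (hk.mul hdm).aestronglyMeasurable
    · refine Eventually.of_forall fun δ => ae_of_all _ fun y => ?_
      rw [norm_mul]
      have hk : ‖truncatedKernel A δ x y‖ ≤ |y - x|⁻¹ := by
        unfold truncatedKernel
        split_ifs
        · exact norm_cauchyKernel_le A x y
        · simp
      refine (mul_le_mul hk (hdiff y) (norm_nonneg _) (by positivity)).trans ?_
      rcases eq_or_ne |y - x| 0 with h | h
      · rw [h]; simp; positivity
      · refine le_of_eq ?_
        field_simp
    · refine ae_of_all _ fun y => ?_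
      rcases eq_or_ne y x with rfl | h
      · simp
      refine tendsto_const_nhds.congr' ?_
      have hpos : 0 < |y - x| := abs_pos.2 (sub_ne_zero.2 h)
      filter_upwards [Ioo_mem_nhdsGT hpos] with δ hδ
      rw [truncatedKernel, if_pos hδ.2]
  have hlog := (tendsto_log_sub_log hAx).add_const
    (Complex.log (((1 : ℝ) : ℂ) * (((R : ℝ) : ℂ) - (x : ℂ) +
        Complex.I * ((A R : ℂ) - (A x : ℂ)))) -
      Complex.log (((-1 : ℝ) : ℂ) * (((-R : ℝ) : ℂ) - (x : ℂ) +
        Complex.I * ((A (-R) : ℂ) - (A x : ℂ)))))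
  refine ⟨_, (hmain.add (hlog.const_mul (φ x))).congr' ?_⟩
  have hRx : 0 < min (x + R) (R - x) := lt_min (by linarith [hx.1]) (by linarith [hx.2])
  filter_upwards [Ioo_mem_nhdsGT hRx] with δ hδ
  have hδ0 : 0 < δ := hδ.1
  have hδ1 : -R ≤ x - δ := by linarith [hδ.2.trans_le (min_le_left _ _)]
  have hδ2 : x + δ ≤ R := by linarith [hδ.2.trans_le (min_le_right _ _)]
  have hsplit : cauchyTrunc A δ μ (fun y => φ y * graphDeriv A y) x =
      cauchyTrunc A δ μ (fun y => (φ y - φ x) * graphDeriv A y) x +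
        φ x * cauchyTrunc A δ μ (graphDeriv A) x := by
    unfold cauchyTrunc
    rw [← integral_const_mul, ← integral_add (integrable_truncatedKernel_mul hAc hδ0 hdi x)
      ((integrable_truncatedKernel_mul hAc hδ0 hγi x).const_mul _)]
    congr 1
    ext y
    ring
  rw [hsplit, cauchyTrunc_eq_add hAc hδ0 hδ1 hδ2 hγi,
    integral_cauchyKernel_mul_graphDeriv hA (c := -1) hδ0 fun y hy => by
      rw [uIcc_of_le hδ1] at hy; linarith [hy.2],
    integral_cauchyKernel_mul_graphDeriv hA (c := 1) hδ0 fun y hy => by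
      rw [uIcc_of_le hδ2] at hy; linarith [hy.1]]
  congr 2
  ring

end SmoothClass

section Primitive

open scoped Topology

variable {A : ℝ → ℝ} {L R : ℝ}

theorem lipschitzOnWith_cauchyKernel (hA : ∀ x₁ x₂ : ℝ, |A x₁ - A x₂| ≤ L * |x₁ - x₂|)
    (hL : 0 ≤ L) (x : ℝ) {δ : ℝ} (hδ : 0 < δ) :
    LipschitzOnWith ((1 + L) * (δ⁻¹ * δ⁻¹)).toNNReal (cauchyKernel A x) {y | δ ≤ |y - x|} := by
  refine LipschitzOnWith.of_dist_le' fun y hy w hw => ?_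
  have hy : δ ≤ |x - y| := by rw [abs_sub_comm]; exact hy
  have hw : δ ≤ |x - w| := by rw [abs_sub_comm]; exact hw
  have h := norm_cauchyKernel_sub_le hA (x := w) (y := y) (w := x)
    (by rintro rfl; simp at hw; linarith) (by rintro rfl; simp at hy; linarith)
  rw [cauchyKernel_swap A x w, cauchyKernel_swap A x y] at h
  rw [dist_eq_norm, Real.dist_eq]
  calc ‖cauchyKernel A x y - cauchyKernel A x w‖
      = ‖-cauchyKernel A x w - -cauchyKernel A x y‖ := by congr 1; ring
    _ ≤ (1 + L) * |y - w| * (|x - w|⁻¹ * |x - y|⁻¹) := h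
    _ ≤ (1 + L) * |y - w| * (δ⁻¹ * δ⁻¹) := by
        have h1 := inv_anti₀ hδ hw
        have h2 := inv_anti₀ hδ hy
        refine mul_le_mul_of_nonneg_left (mul_le_mul h1 h2 (by positivity) (by positivity))
          (by positivity)
    _ = _ := by ring

theorem hasDerivAt_cauchyKernel {x y : ℝ} (hA : DifferentiableAt ℝ A y) (hxy : y ≠ x) :
    HasDerivAt (cauchyKernel A x)
      (-(cauchyKernel A x y * (cauchyKernel A x y * graphDeriv A y))) y := by
  have h := (hasDerivAt_cauchyKernel_denominator hA x).inv (cauchyKernel_denominator_ne_zero hxy)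
  refine HasDerivAt.congr_deriv (f := cauchyKernel A x) h ?_
  unfold cauchyKernel
  rw [div_eq_mul_inv, ← inv_pow]
  ring

theorem integral_cauchyKernel_mul_eq (hA : ∀ x₁ x₂ : ℝ, |A x₁ - A x₂| ≤ L * |x₁ - x₂|)
    (hL : 0 ≤ L) {B r : ℝ → ℂ} {x a b δ : ℝ} (hδ : 0 < δ)
    (hB : AbsolutelyContinuousOnInterval B a b)
    (hBr : ∀ᵐ y, y ∈ uIcc a b → HasDerivAt B (r y) y) (hx : ∀ y ∈ uIcc a b, δ ≤ |y - x|)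
    (hi : IntervalIntegrable
      (fun y => cauchyKernel A x y * (cauchyKernel A x y * graphDeriv A y * B y)) volume a b) :
    ∫ y in a..b, cauchyKernel A x y * r y =
      cauchyKernel A x b * B b - cauchyKernel A x a * B a +
        ∫ y in a..b, cauchyKernel A x y * (cauchyKernel A x y * graphDeriv A y * B y) := by
  have hk : AbsolutelyContinuousOnInterval (cauchyKernel A x) a b :=
    ((lipschitzOnWith_cauchyKernel hA hL x hδ).mono hx).absolutelyContinuousOnInterval
  have h := (hk.smul hB).integral_eq_sub (f' := fun y => cauchyKernel A x y * r y -
    cauchyKernel A x y * (cauchyKernel A x y * graphDeriv A y * B y)) (by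
      filter_upwards [hBr, ae_differentiableAt_of_abs_sub_le hA] with y hy hAy hyab
      have hne : y ≠ x := by
        rintro rfl
        have := hx _ hyab
        simp at this
        linarith
      have := (hasDerivAt_cauchyKernel hAy hne).mul (hy hyab)
      refine HasDerivAt.congr_deriv (f := cauchyKernel A x • B) this ?_
      ring)
  have h2 := intervalIntegral.integral_add h.1 hi
  rw [h.2] at h2
  simp only [sub_add_cancel] at h2
  simpa using h2

theorem tendsto_cauchyKernel_mul {B : ℝ → ℂ} {x : ℝ} (hA : DifferentiableAt ℝ A x)
    (hB : DifferentiableAt ℝ B x) (hB0 : B x = 0) :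
    Tendsto (fun t : ℝ => cauchyKernel A x (x + t) * B (x + t)) (𝓝[≠] 0)
      (𝓝 ((graphDeriv A x)⁻¹ * deriv B x)) := by
  have h1 := hasDerivAt_iff_tendsto_slope_zero.1 (hasDerivAt_cauchyKernel_denominator hA x)
  have h2 := hasDerivAt_iff_tendsto_slope_zero.1 hB.hasDerivAt
  have hne : graphDeriv A x ≠ 0 := norm_pos_iff.1 (one_pos.trans_le (one_le_norm_graphDeriv A x))
  refine ((h1.inv₀ hne).mul h2).congr' ?_
  filter_upwards [self_mem_nhdsWithin] with t ht
  have ht0 : (t : ℂ) ≠ 0 := by exact_mod_cast (show t ≠ 0 from ht)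
  simp only [hB0, sub_self, mul_zero, add_zero, sub_zero, Complex.real_smul, mul_inv]
  unfold cauchyKernel
  push_cast
  field_simp

theorem exists_tendsto_cauchyTrunc_of_primitive
    (hA : ∀ x₁ x₂ : ℝ, |A x₁ - A x₂| ≤ L * |x₁ - x₂|) (hL : 0 ≤ L) {B r : ℝ → ℂ} {x c : ℝ}
    (hx : x ∈ Ioo (-R) R) (hAx : DifferentiableAt ℝ A x)
    (hr : IntegrableOn r (Icc (-R) R))
    (hB : AbsolutelyContinuousOnInterval B (-R) R)
    (hBr : ∀ᵐ y, y ∈ Icc (-R) R → HasDerivAt B (r y) y)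
    (hBx : DifferentiableAt ℝ B x) (hB0 : B x = 0) (hc : 0 ≤ c)
    (hBc : ∀ y ∈ Icc (-R) R, ‖B y‖ ≤ c * |y - x|)
    (hfin : ∫⁻ y in Icc (-R) R, ENNReal.ofReal (‖B y‖ * ((y - x) ^ 2)⁻¹) < ⊤) :
    ∃ v, Tendsto (fun δ => cauchyTrunc A δ (volume.restrict (Icc (-R) R)) r x)
      (𝓝[>] 0) (𝓝 v) := by
  have hAc := continuous_of_abs_sub_le hA
  have hRR : -R ≤ R := by linarith [hx.1, hx.2]
  set μ := (volume : Measure ℝ).restrict (Icc (-R) R) with hμ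
  have hk : Measurable fun y => cauchyKernel A x y :=
    (measurable_cauchyKernel hAc).comp (f := fun y => (x, y)) (by fun_prop)
  have hBm : AEStronglyMeasurable B μ := by
    have := hB.continuousOn
    rw [uIcc_of_le hRR] at this
    exact this.aestronglyMeasurable measurableSet_Icc
  have hsq : ∀ y, |y - x|⁻¹ * |y - x|⁻¹ = ((y - x) ^ 2)⁻¹ := fun y => by
    rw [← sq_abs (y - x), sq, mul_inv]
  have hwi : Integrable (fun y => ‖B y‖ * ((y - x) ^ 2)⁻¹) μ := by
    refine ⟨hBm.norm.mul
      (by fun_prop : Measurable fun y : ℝ => ((y - x) ^ 2)⁻¹).aestronglyMeasurable,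
      ?_⟩
    refine lt_of_le_of_lt (lintegral_mono fun y => ?_) hfin
    rw [Real.enorm_eq_ofReal (by positivity)]
  have hbound : ∀ y (z : ℂ), ‖z‖ ≤ |y - x|⁻¹ →
      ‖z * (cauchyKernel A x y * graphDeriv A y * B y)‖ ≤
        (1 + L) * (‖B y‖ * ((y - x) ^ 2)⁻¹) := fun y z hz => by
    rw [norm_mul, norm_mul, norm_mul, ← hsq]
    calc ‖z‖ * (‖cauchyKernel A x y‖ * ‖graphDeriv A y‖ * ‖B y‖)
        ≤ |y - x|⁻¹ * (|y - x|⁻¹ * (1 + L) * ‖B y‖) := by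
          gcongr
          · exact norm_cauchyKernel_le A x y
          · exact norm_graphDeriv_le hA hL y
      _ = _ := by ring
  have hsm : AEStronglyMeasurable (fun y => cauchyKernel A x y * graphDeriv A y * B y) μ :=
    (hk.mul (measurable_graphDeriv A)).aestronglyMeasurable.mul hBm
  have hsi : Integrable (fun y => cauchyKernel A x y * graphDeriv A y * B y) μ := by
    refine Integrable.of_bound hsm ((1 + L) * c)
      ((ae_restrict_iff' measurableSet_Icc).2 (ae_of_all _ fun y hy => ?_))
    rw [norm_mul, norm_mul]
    calc ‖cauchyKernel A x y‖ * ‖graphDeriv A y‖ * ‖B y‖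
        ≤ |y - x|⁻¹ * (1 + L) * (c * |y - x|) := by
          gcongr
          · exact norm_cauchyKernel_le A x y
          · exact norm_graphDeriv_le hA hL y
          · exact hBc y hy
      _ = (1 + L) * c * (|y - x|⁻¹ * |y - x|) := by ring
      _ ≤ (1 + L) * c * 1 := by
          gcongr
          exact inv_mul_le_one
      _ = _ := mul_one _
  have hki : Integrable (fun y => cauchyKernel A x y *
      (cauchyKernel A x y * graphDeriv A y * B y)) μ :=
    (hwi.const_mul (1 + L)).mono' (hk.aestronglyMeasurable.mul hsm)
      (ae_of_all _ fun y => hbound y _ (norm_cauchyKernel_le A x y))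
  have hmain : Tendsto (fun δ => cauchyTrunc A δ μ
      (fun y => cauchyKernel A x y * graphDeriv A y * B y) x) (𝓝[>] 0)
      (𝓝 (∫ y, cauchyKernel A x y * (cauchyKernel A x y * graphDeriv A y * B y) ∂μ)) := by
    refine tendsto_integral_filter_of_dominated_convergence _ ?_ ?_ (hwi.const_mul (1 + L)) ?_
    · refine Eventually.of_forall fun δ => ?_
      have hk : Measurable fun y => truncatedKernel A δ x y :=
        (measurable_truncatedKernel hAc δ).comp (f := fun y => (x, y)) (by fun_prop)
      exact hk.aestronglyMeasurable.mul hsm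
    · refine Eventually.of_forall fun δ => ae_of_all _ fun y => hbound y _ ?_
      unfold truncatedKernel
      split_ifs
      · exact norm_cauchyKernel_le A x y
      · simp
    · refine ae_of_all _ fun y => ?_
      rcases eq_or_ne y x with rfl | h
      · simp [hB0]
      refine tendsto_const_nhds.congr' ?_
      have hpos : 0 < |y - x| := abs_pos.2 (sub_ne_zero.2 h)
      filter_upwards [Ioo_mem_nhdsGT hpos] with δ hδ
      rw [truncatedKernel, if_pos hδ.2]
  have hbd := tendsto_cauchyKernel_mul hAx hBx hB0
  have hpos : Tendsto (fun δ : ℝ => cauchyKernel A x (x + δ) * B (x + δ)) (𝓝[>] 0)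
      (𝓝 ((graphDeriv A x)⁻¹ * deriv B x)) :=
    hbd.mono_left (nhdsWithin_mono _ fun t ht => ne_of_gt ht)
  have hneg : Tendsto (fun δ : ℝ => cauchyKernel A x (x - δ) * B (x - δ)) (𝓝[>] 0)
      (𝓝 ((graphDeriv A x)⁻¹ * deriv B x)) := by
    refine (hbd.comp (tendsto_nhdsWithin_iff.2 ⟨?_, ?_⟩ :
      Tendsto (fun δ : ℝ => -δ) (𝓝[>] 0) (𝓝[≠] 0))).congr fun δ => ?_
    · exact (Continuous.tendsto' continuous_neg 0 0 neg_zero).mono_left nhdsWithin_le_nhds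
    · filter_upwards [self_mem_nhdsWithin] with δ hδ
      exact neg_ne_zero.2 (ne_of_gt hδ)
    · simp [sub_eq_add_neg]
  refine ⟨_, (hmain.add ((hneg.sub hpos).add_const (cauchyKernel A x R * B R -
    cauchyKernel A x (-R) * B (-R)))).congr' ?_⟩
  have hRx : 0 < min (x + R) (R - x) := lt_min (by linarith [hx.1]) (by linarith [hx.2])
  filter_upwards [Ioo_mem_nhdsGT hRx] with δ hδ
  have hδ0 : 0 < δ := hδ.1
  have hδ1 : -R ≤ x - δ := by linarith [hδ.2.trans_le (min_le_left _ _)]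
  have hδ2 : x + δ ≤ R := by linarith [hδ.2.trans_le (min_le_right _ _)]
  have hs1 : uIcc (-R) (x - δ) ⊆ Icc (-R) R := by
    rw [uIcc_of_le hδ1]; exact Icc_subset_Icc le_rfl (by linarith)
  have hs2 : uIcc (x + δ) R ⊆ Icc (-R) R := by
    rw [uIcc_of_le hδ2]; exact Icc_subset_Icc (by linarith) le_rfl
  have hpart : ∀ a b, uIcc a b ⊆ Icc (-R) R → (∀ y ∈ uIcc a b, δ ≤ |y - x|) →
      ∫ y in a..b, cauchyKernel A x y * r y =
      cauchyKernel A x b * B b - cauchyKernel A x a * B a +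
        ∫ y in a..b, cauchyKernel A x y * (cauchyKernel A x y * graphDeriv A y * B y) := by
    intro a b hab hδab
    refine integral_cauchyKernel_mul_eq hA hL hδ0 (hB.mono (by rwa [uIcc_of_le hRR])) ?_ hδab ?_
    · filter_upwards [hBr] with y hy hyab using hy (hab hyab)
    · rw [intervalIntegrable_iff]
      exact IntegrableOn.mono_set hki (uIoc_subset_uIcc.trans hab)
  rw [cauchyTrunc_eq_add hAc hδ0 hδ1 hδ2 hr, cauchyTrunc_eq_add hAc hδ0 hδ1 hδ2 hsi,
    hpart _ _ hs1 fun y hy => by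
      rw [uIcc_of_le hδ1] at hy
      rw [abs_sub_comm]
      exact le_trans (by linarith [hy.2]) (le_abs_self _),
    hpart _ _ hs2 fun y hy => by
      rw [uIcc_of_le hδ2] at hy
      exact le_trans (by linarith [hy.1]) (le_abs_self _)]
  ring

end Primitive

section Decomposition

open scoped Topology

variable {A : ℝ → ℝ} {L R : ℝ}

theorem norm_intervalIntegral_sub_le {u : ℝ → ℂ} (hu : Integrable u) {a x y η : ℝ} (hη : 0 ≤ η)
    (h : (volume.withDensity fun t => ‖u t‖ₑ) (Metric.closedBall x |y - x|) ≤
      ENNReal.ofReal (η * |y - x|)) :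
    ‖(∫ t in a..y, u t) - ∫ t in a..x, u t‖ ≤ η * |y - x| := by
  rw [intervalIntegral.integral_interval_sub_left hu.intervalIntegrable hu.intervalIntegrable,
    intervalIntegral.norm_integral_eq_norm_integral_uIoc,
    ← ENNReal.ofReal_le_ofReal_iff (by positivity), ofReal_norm]
  refine (enorm_integral_le_lintegral_enorm _).trans (le_trans ?_ h)
  rw [withDensity_apply _ measurableSet_closedBall]
  refine lintegral_mono_set fun t ht => ?_
  rw [Metric.mem_closedBall, Real.dist_eq]
  have := abs_sub_left_of_mem_uIcc (uIoc_subset_uIcc ht)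
  exact this

theorem ae_lintegral_mul_inv_sq_lt_top {B : ℝ → ℂ} (hB : Continuous B) {F : Set ℝ}
    (hF : F.Nonempty) {c : ℝ} (hc : 0 < c)
    (hBc : ∀ x ∈ F, ∀ y ∈ Icc (-R) R, ‖B y‖ ≤ c * |y - x|) :
    ∀ᵐ x, x ∈ F → ∫⁻ y in Icc (-R) R, ENNReal.ofReal (‖B y‖ * ((y - x) ^ 2)⁻¹) < ⊤ := by
  have hm : Measurable fun q : ℝ × ℝ => ENNReal.ofReal (‖B q.2‖ * ((q.2 - q.1) ^ 2)⁻¹) :=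
    ((hB.measurable.comp measurable_snd).norm.mul (by fun_prop)).ennreal_ofReal
  have hdist : ∀ y ∈ Icc (-R) R, ‖B y‖ ≤ c * Metric.infDist y F := fun y hy => by
    rw [← div_le_iff₀' hc]
    refine (Metric.le_infDist hF).2 fun x hx => ?_
    rw [div_le_iff₀' hc, Real.dist_eq]
    exact hBc x hx y hy
  have hinner : ∀ y ∈ Icc (-R) R,
      ∫⁻ x in closure F, ENNReal.ofReal (‖B y‖ * ((y - x) ^ 2)⁻¹) ≤ ENNReal.ofReal (2 * c) := by
    intro y hy
    rcases (Metric.infDist_nonneg (x := y) (s := F)).eq_or_lt with h0 | hd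
    · have := hdist y hy
      rw [← h0, mul_zero] at this
      rw [le_antisymm this (norm_nonneg _)]
      simp
    · set d := Metric.infDist y F
      calc ∫⁻ x in closure F, ENNReal.ofReal (‖B y‖ * ((y - x) ^ 2)⁻¹)
          ≤ ∫⁻ x in {x | d ≤ |x - y|}, ENNReal.ofReal (‖B y‖ * ((y - x) ^ 2)⁻¹) := by
            refine lintegral_mono_set fun x hx => ?_
            have := Metric.infDist_le_dist_of_mem (x := y) hx
            rw [Metric.infDist_closure, Real.dist_eq, abs_sub_comm] at this
            exact this
        _ ≤ ∫⁻ x in {x | d ≤ |x - y|},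
            ENNReal.ofReal (c * d) * ENNReal.ofReal (((x - y) ^ 2)⁻¹) := by
            refine lintegral_mono fun x => ?_
            rw [← ENNReal.ofReal_mul (by positivity)]
            refine ENNReal.ofReal_le_ofReal ?_
            rw [← neg_sub x y, neg_sq]
            exact mul_le_mul_of_nonneg_right (hdist y hy) (by positivity)
        _ ≤ ENNReal.ofReal (c * d) * ENNReal.ofReal (2 / d) := by
            rw [lintegral_const_mul _ (by fun_prop)]
            exact mul_le_mul_right (lintegral_inv_sq_le hd y) _
        _ = ENNReal.ofReal (2 * c) := by
            rw [← ENNReal.ofReal_mul (by positivity)]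
            congr 1
            field_simp
  have htot : ∫⁻ x in closure F, ∫⁻ y in Icc (-R) R,
      ENNReal.ofReal (‖B y‖ * ((y - x) ^ 2)⁻¹) ≠ ⊤ := by
    rw [lintegral_lintegral_swap hm.aemeasurable]
    refine ne_top_of_le_ne_top (b := ∫⁻ _ in Icc (-R) R, ENNReal.ofReal (2 * c)) ?_
      (setLIntegral_mono' measurableSet_Icc hinner)
    rw [setLIntegral_const]
    exact ENNReal.mul_ne_top ENNReal.ofReal_ne_top (by simp)
  have hae := ae_lt_top hm.lintegral_prod_right' htot
  rw [ae_restrict_iff' measurableSet_closure] at hae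
  filter_upwards [hae] with x hx hxF using hx (subset_closure hxF)

/-- An integrable function is the sum of a small bounded function and a function whose principal
value exists off a small set. -/
theorem exists_bounded_add_principal_value
    (hA : ∀ x₁ x₂ : ℝ, |A x₁ - A x₂| ≤ L * |x₁ - x₂|) (hL : 0 ≤ L) {u : ℝ → ℂ}
    (hu : Integrable u) {η : ℝ} (hη : 0 < η) :
    ∃ (g : ℝ → ℂ) (N : Set ℝ), Measurable g ∧
      (∀ x, ‖g x‖ ≤ lipschitzExtensionConstant ℂ * η) ∧
      volume N ≤ ENNReal.ofReal (8 / η) * ∫⁻ x, ‖u x‖ₑ ∧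
      ∀ᵐ x, x ∈ Ioo (-R) R → x ∉ N → ∃ v, Tendsto
        (fun δ => cauchyTrunc A δ (volume.restrict (Icc (-R) R)) (fun y => u y - g y) x)
        (𝓝[>] 0) (𝓝 v) := by
  set ν := volume.withDensity fun t => ‖u t‖ₑ with hν
  set N : Set ℝ := {x | ∃ r, 0 < r ∧ r ≤ 2 * R ∧
    ENNReal.ofReal (η * r) ≤ ν (Metric.closedBall x r)} with hN
  set F := Icc (-R) R \ N with hF
  set H : ℝ → ℂ := fun y => ∫ t in (-R)..y, u t with hH
  have hFH : ∀ x ∈ F, ∀ y ∈ Icc (-R) R, ‖H y - H x‖ ≤ η * |y - x| := by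
    intro x hx y hy
    rcases eq_or_ne y x with rfl | hne
    · simp
    refine norm_intervalIntegral_sub_le hu hη.le ?_
    by_contra! hlt
    refine hx.2 ⟨|y - x|, abs_pos.2 (sub_ne_zero.2 hne), ?_, hlt.le⟩
    exact abs_le.2 ⟨by linarith [hy.1, hx.1.2], by linarith [hy.2, hx.1.1]⟩
  have hHlip : LipschitzOnWith η.toNNReal H F := LipschitzOnWith.of_dist_le' fun x hx y hy => by
    rw [dist_eq_norm, Real.dist_eq]
    exact hFH y hy x hx.1
  obtain ⟨G, hG, hGH⟩ := hHlip.extend_finite_dimension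
  have hKη : ((lipschitzExtensionConstant ℂ * η.toNNReal : NNReal) : ℝ) =
      lipschitzExtensionConstant ℂ * η := by
    rw [NNReal.coe_mul, Real.coe_toNNReal _ hη.le]
  have hgb : ∀ x, ‖deriv G x‖ ≤ lipschitzExtensionConstant ℂ * η := fun x => by
    rw [← hKη]; exact norm_deriv_le_of_lipschitz hG
  refine ⟨deriv G, N, measurable_deriv G, hgb, ?_, ?_⟩
  · refine (volume_setOf_exists_le_measure_closedBall ν hη (2 * R)).trans (le_of_eq ?_)
    rw [hν, withDensity_apply _ MeasurableSet.univ, Measure.restrict_univ]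
  rcases F.eq_empty_or_nonempty with hFe | hFne
  · refine ae_of_all _ fun x hx hxN => ?_
    have : x ∈ F := ⟨Ioo_subset_Icc_self hx, hxN⟩
    rw [hFe] at this
    exact this.elim
  set B : ℝ → ℂ := fun y => H y - G y with hB
  have hHc : Continuous H := intervalIntegral.continuous_primitive
    (fun a b => hu.intervalIntegrable) _
  have hBc : Continuous B := hHc.sub hG.continuous
  set c : ℝ := η + lipschitzExtensionConstant ℂ * η with hc
  have hc0 : 0 < c := by positivity
  have hBle : ∀ x ∈ F, ∀ y ∈ Icc (-R) R, ‖B y‖ ≤ c * |y - x| := by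
    intro x hx y hy
    have h1 := hFH x hx y hy
    have h2 := hG.dist_le_mul x y
    rw [hKη, dist_eq_norm, Real.dist_eq, abs_sub_comm] at h2
    calc ‖B y‖ = ‖(H y - H x) + (G x - G y)‖ := by
          rw [← hGH hx]; congr 1; simp only [hB]; ring
      _ ≤ η * |y - x| + lipschitzExtensionConstant ℂ * η * |y - x| :=
        (norm_add_le _ _).trans (add_le_add h1 h2)
      _ = c * |y - x| := by rw [hc]; ring
  have hBd : ∀ᵐ y, HasDerivAt B (u y - deriv G y) y := by
    filter_upwards [LocallyIntegrable.ae_hasDerivAt_integral hu.locallyIntegrable,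
      hG.ae_differentiableAt_real]
      with y h1 h2
    exact (h1 (-R)).sub h2.hasDerivAt
  have hri : IntegrableOn (fun y => u y - deriv G y) (Icc (-R) R) :=
    hu.integrableOn.sub (Integrable.of_bound (measurable_deriv G).aestronglyMeasurable _
      (ae_of_all _ hgb))
  filter_upwards [ae_lintegral_mul_inv_sq_lt_top hBc hFne hc0 hBle, hBd,
    ae_differentiableAt_of_abs_sub_le hA] with x hfin hBx hAx hx hxN
  have hxF : x ∈ F := ⟨Ioo_subset_Icc_self hx, hxN⟩
  have hac : AbsolutelyContinuousOnInterval B (-R) R :=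
    (hu.intervalIntegrable.absolutelyContinuousOnInterval_complex left_mem_uIcc).sub
      (hG.lipschitzOnWith.absolutelyContinuousOnInterval)
  refine exists_tendsto_cauchyTrunc_of_primitive hA hL hx hAx hri hac
    (hBd.mono fun y hy _ => hy) hBx.differentiableAt ?_ hc0.le (hBle x hxF) (hfin hxF)
  simp only [hB, hGH hxF, sub_self]

end Decomposition

section PrincipalValue

open scoped Topology

variable {A : ℝ → ℝ} {L R : ℝ}

theorem exists_lipschitz_approx
    (hA : ∀ x₁ x₂ : ℝ, |A x₁ - A x₂| ≤ L * |x₁ - x₂|) (hL : 0 ≤ L) {f : ℝ → ℂ}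
    (hf : Integrable f) {ε : ℝ} (hε : 0 < ε) :
    ∃ (φ : ℝ → ℂ) (C : ℝ), (∀ x y, ‖φ y - φ x‖ ≤ C * |y - x|) ∧
      Integrable (fun y => φ y * graphDeriv A y) ∧
      ∫⁻ y, ‖f y - φ y * graphDeriv A y‖ₑ ≤ ENNReal.ofReal ((1 + L) * ε) := by
  have hγm := measurable_graphDeriv A
  have hγ0 : ∀ y, graphDeriv A y ≠ 0 := fun y h => by
    have := one_le_norm_graphDeriv A y
    rw [h, norm_zero] at this
    linarith
  have hq : Integrable fun y => (graphDeriv A y)⁻¹ * f y := by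
    refine hf.bdd_mul (c := 1) hγm.inv.aestronglyMeasurable (ae_of_all _ fun y => ?_)
    rw [norm_inv]
    exact inv_le_one_of_one_le₀ (one_le_norm_graphDeriv A y)
  obtain ⟨φ, hφc, hφs, hφ⟩ := (memLp_one_iff_integrable.2 hq).exist_eLpNorm_sub_le
    ENNReal.one_ne_top le_rfl hε
  obtain ⟨C, hC⟩ := hφs.lipschitzWith_of_hasCompactSupport hφc (by simp)
  refine ⟨φ, C, fun x y => ?_, ?_, ?_⟩
  · have := hC.dist_le_mul y x
    rwa [dist_eq_norm, Real.dist_eq] at this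
  · exact (hφs.continuous.integrable_of_hasCompactSupport hφc).mul_bdd (c := 1 + L)
      hγm.aestronglyMeasurable (ae_of_all _ fun y => norm_graphDeriv_le hA hL y)
  · rw [eLpNorm_one_eq_lintegral_enorm] at hφ
    rw [ENNReal.ofReal_mul (by linarith)]
    refine le_trans ?_ (mul_le_mul_right hφ _)
    rw [← lintegral_const_mul' _ _ ENNReal.ofReal_ne_top]
    refine lintegral_mono fun y => ?_
    have h1 : f y - φ y * graphDeriv A y =
        graphDeriv A y * ((graphDeriv A y)⁻¹ * f y - φ y) := by
      rw [mul_sub, mul_inv_cancel_left₀ (hγ0 y), mul_comm]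
    rw [h1, enorm_mul]
    refine mul_le_mul_left ?_ _
    rw [← ofReal_norm]
    exact ENNReal.ofReal_le_ofReal (norm_graphDeriv_le hA hL y)

theorem cauchyTrunc_add {μ : Measure ℝ} (hA : Continuous A) {ε : ℝ} (hε : 0 < ε) {f g : ℝ → ℂ}
    (hf : Integrable f μ) (hg : Integrable g μ) (x : ℝ) :
    cauchyTrunc A ε μ (fun y => f y + g y) x = cauchyTrunc A ε μ f x + cauchyTrunc A ε μ g x := by
  unfold cauchyTrunc
  rw [← integral_add (integrable_truncatedKernel_mul hA hε hf x)
    (integrable_truncatedKernel_mul hA hε hg x)]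
  simp only [mul_add]

theorem volume_setOf_large_oscillation_le
    (hA : ∀ x₁ x₂ : ℝ, |A x₁ - A x₂| ≤ L * |x₁ - x₂|) (hL : 0 ≤ L) (hR : 0 < R) {f : ℝ → ℂ}
    (hf : Integrable f) {lam τ : ℝ} (hlam : 0 < lam) (hτ : 0 < τ) :
    volume {x | x ∈ Icc (-R + 1) (R - 1) ∧ ¬ ∃ t ∈ 𝓝[>] (0 : ℝ), ∀ δ ∈ t, ∀ δ' ∈ t,
      dist (cauchyTrunc A δ (volume.restrict (Icc (-R) R)) f x)
        (cauchyTrunc A δ' (volume.restrict (Icc (-R) R)) f x) < 3 * lam} ≤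
      ENNReal.ofReal τ + ENNReal.ofReal τ := by
  have hAc := continuous_of_abs_sub_le hA
  set μ := (volume : Measure ℝ).restrict (Icc (-R) R) with hμ
  obtain ⟨η₀, hη₀, hmax⟩ := exists_bound_volume_maximal_cauchyTrunc_le hA hL hR hlam hτ
  set K : ℝ := ((lipschitzExtensionConstant ℂ : NNReal) : ℝ) with hK
  have hKpos : 0 < K := by exact_mod_cast lipschitzExtensionConstant_pos ℂ
  set η := η₀ / K with hη
  have hηpos : 0 < η := by positivity
  have hKη : K * η = η₀ := by rw [hη]; field_simp
  obtain ⟨φ, C, hφ, hφi, hfφ⟩ := exists_lipschitz_approx hA hL hf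
    (ε := τ * η / (8 * (1 + L))) (by positivity)
  set h : ℝ → ℂ := fun y => φ y * graphDeriv A y with hh
  obtain ⟨g, N, hgm, hgb, hN, hpv⟩ :=
    exists_bounded_add_principal_value (R := R) hA hL (hf.sub hφi) hηpos
  simp only [Pi.sub_apply] at hN hpv
  have hNτ : volume N ≤ ENNReal.ofReal τ := by
    refine hN.trans ((mul_le_mul_right hfφ _).trans (le_of_eq ?_))
    rw [← ENNReal.ofReal_mul (by positivity)]
    congr 1
    field_simp
  have hgb' : ∀ x, ‖g x‖ ≤ η₀ := fun x => (hgb x).trans_eq hKη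
  have hgi : Integrable g μ :=
    Integrable.of_bound hgm.aestronglyMeasurable _ (ae_of_all _ hgb')
  refine le_trans ?_ (add_le_add hNτ (hmax g hgm hgb'))
  refine le_trans ?_ (measure_union_le _ _)
  refine measure_mono_ae ?_
  filter_upwards [hpv, ae_differentiableAt_of_abs_sub_le hA] with x hx hAx hxbad
  obtain ⟨hxI, hosc⟩ := hxbad
  by_contra hnot
  have hxN : x ∉ N := fun h => hnot (Or.inl h)
  have hxR : x ∈ Ioo (-R) R := ⟨by linarith [hxI.1], by linarith [hxI.2]⟩
  obtain ⟨v, hv⟩ := hx hxR hxN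
  obtain ⟨v', hv'⟩ := exists_tendsto_cauchyTrunc_mul_graphDeriv hA hL hφ hxR hAx
  have hcau := (hv.add hv').cauchy_map
  obtain ⟨s, hs, hsd⟩ := (Metric.cauchy_iff.1 hcau).2 lam hlam
  refine hosc ⟨_, inter_mem hs (Ioc_mem_nhdsGT one_pos), ?_⟩
  have hsplit : ∀ δ, 0 < δ → cauchyTrunc A δ μ f x =
      (cauchyTrunc A δ μ (fun y => f y - h y - g y) x + cauchyTrunc A δ μ h x) +
        cauchyTrunc A δ μ g x := fun δ hδ => by
    have hri : Integrable (fun y => f y - h y - g y) μ :=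
      (hf.sub hφi).restrict.sub hgi
    rw [← cauchyTrunc_add hAc hδ hri hφi.restrict, ← cauchyTrunc_add hAc hδ _ hgi]
    · congr 1
      ext y
      ring
    · exact hri.add hφi.restrict
  have hgs : ∀ δ, 0 < δ → δ ≤ 1 → ‖cauchyTrunc A δ μ g x‖ ≤ lam := fun δ h0 h1 => by
    by_contra! hlt
    exact hnot (Or.inr ⟨hxI, δ, h0, h1, hlt⟩)
  rintro δ ⟨hδs, hδ⟩ δ' ⟨hδs', hδ'⟩
  rw [hsplit δ hδ.1, hsplit δ' hδ'.1]
  have h1 := hsd _ hδs _ hδs'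
  have h2 : dist (cauchyTrunc A δ μ g x) (cauchyTrunc A δ' μ g x) ≤ lam + lam := by
    rw [dist_eq_norm]
    exact (norm_sub_le _ _).trans (add_le_add (hgs _ hδ.1 hδ.2) (hgs _ hδ'.1 hδ'.2))
  exact (dist_add_add_le _ _ _ _).trans_lt (by linarith)

/-- Principal values of integrable functions along a Lipschitz graph exist almost everywhere. -/
theorem ae_exists_tendsto_cauchyTrunc
    (hA : ∀ x₁ x₂ : ℝ, |A x₁ - A x₂| ≤ L * |x₁ - x₂|) (hL : 0 ≤ L) (hR : 0 < R) {f : ℝ → ℂ}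
    (hf : Integrable f) :
    ∀ᵐ x, x ∈ Icc (-R + 1) (R - 1) → ∃ v, Tendsto
      (fun δ => cauchyTrunc A δ (volume.restrict (Icc (-R) R)) f x) (𝓝[>] 0) (𝓝 v) := by
  have hnull : ∀ n : ℕ, ∀ᵐ x, x ∈ Icc (-R + 1) (R - 1) → ∃ t ∈ 𝓝[>] (0 : ℝ), ∀ δ ∈ t, ∀ δ' ∈ t,
      dist (cauchyTrunc A δ (volume.restrict (Icc (-R) R)) f x)
        (cauchyTrunc A δ' (volume.restrict (Icc (-R) R)) f x) < 3 * (1 / ((n : ℝ) + 1)) := by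
    intro n
    rw [ae_iff]
    simp only [Classical.not_imp]
    refine le_antisymm (ENNReal.le_of_forall_pos_le_add fun τ hτ _ => ?_) zero_le
    refine (volume_setOf_large_oscillation_le hA hL hR hf (lam := 1 / ((n : ℝ) + 1)) (τ := τ / 2)
      (by positivity) (by positivity)).trans (le_of_eq ?_)
    rw [← ENNReal.ofReal_add (by positivity) (by positivity), add_halves, zero_add,
      ENNReal.ofReal_coe_nnreal]
  filter_upwards [ae_all_iff.2 hnull] with x hx hxI
  refine cauchy_map_iff_exists_tendsto.1 (Metric.cauchy_iff.2 ⟨inferInstance, fun ε hε => ?_⟩)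
  obtain ⟨n, hn⟩ := exists_nat_one_div_lt (show 0 < ε / 3 by positivity)
  obtain ⟨t, ht, htd⟩ := hx n hxI
  refine ⟨_, image_mem_map ht, ?_⟩
  rintro _ ⟨δ, hδ, rfl⟩ _ ⟨δ', hδ', rfl⟩
  have := htd δ hδ δ' hδ'
  linarith

end PrincipalValue

section CompactKernel

open scoped Topology

variable {α G E : Type*} [MeasurableSpace α] {μ : Measure α} {p : ℝ≥0∞} [Fact (1 ≤ p)]
  [NormedAddCommGroup G] [NormedSpace ℂ G] [NormedAddCommGroup E] [NormedSpace ℂ E]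

/-- An operator given by pairing with an `L^p` vector-valued kernel is compact. -/
theorem isCompactOperator_compLpL₂_flip (hp : p ≠ ⊤) (B : G →L[ℂ] E →L[ℂ] ℂ) (Φ : Lp E p μ) :
    IsCompactOperator ((B.compLpL₂ p μ).flip Φ) := by
  induction Φ using Lp.induction hp with
  | @indicatorConst c s hs hμs =>
    have h : ((B.compLpL₂ p μ).flip (Lp.simpleFunc.indicatorConst p hs hμs.ne c) :
        G → Lp ℂ p μ) =
          ContinuousLinearMap.toSpanSingleton ℂ (indicatorConstLp p hs hμs.ne (1 : ℂ)) ∘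
          (B.flip c) := by
      ext1 f
      rw [Lp.simpleFunc.coe_indicatorConst, ContinuousLinearMap.flip_apply,
        ContinuousLinearMap.compLpL₂_apply_apply]
      simp only [Function.comp_apply, ContinuousLinearMap.toSpanSingleton_apply,
        ContinuousLinearMap.flip_apply]
      ext1
      filter_upwards [(B f).coeFn_compLp (indicatorConstLp p hs hμs.ne c),
        indicatorConstLp_coeFn (p := p) (hs := hs) (hμs := hμs.ne) (c := c),
        indicatorConstLp_coeFn (p := p) (hs := hs) (hμs := hμs.ne) (c := (1 : ℂ)),
        Lp.coeFn_smul (B f c) (indicatorConstLp p hs hμs.ne (1 : ℂ))] with x h1 h2 h3 h4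
      rw [h1, h2, h4, Pi.smul_apply, h3]
      by_cases hx : x ∈ s
      · simp [hx]
      · simp [hx]
    rw [h]
    exact (isCompactOperator_of_locallyCompactSpace_rng _).comp_clm _
  | add hf hg _ h1 h2 =>
    rw [map_add]
    exact h1.add h2
  | isClosed =>
    have := isClosed_setOfPred_isCompactOperator (𝕜₁ := ℂ) (𝕜₂ := ℂ) (σ₁₂ := RingHom.id ℂ)
      (M₁ := G) (M₂ := Lp ℂ p μ)
    exact this.preimage (B.compLpL₂ p μ).flip.continuous

end CompactKernel

section CommutatorKernel

open scoped Topology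

variable {A b : ℝ → ℝ} {L : ℝ}

/-- The kernel `(b(x) - b(y)) K(x,y)` of the commutator of `b` and the Cauchy integral. -/
noncomputable def commutatorKernel (A b : ℝ → ℝ) (x y : ℝ) : ℂ :=
  ((b x : ℂ) - b y) * cauchyKernel A x y

theorem commutatorKernel_swap (A b : ℝ → ℝ) (x y : ℝ) :
    commutatorKernel A b y x = commutatorKernel A b x y := by
  rw [commutatorKernel, commutatorKernel, cauchyKernel_swap]
  ring

theorem commutatorKernel_self (A b : ℝ → ℝ) (x : ℝ) : commutatorKernel A b x x = 0 := by
  rw [commutatorKernel, sub_self, zero_mul]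

theorem measurable_commutatorKernel (hA : Continuous A) (hb : Continuous b) :
    Measurable fun q : ℝ × ℝ => commutatorKernel A b q.1 q.2 := by
  unfold commutatorKernel
  have h : Measurable fun q : ℝ × ℝ => (b q.1 : ℂ) - b q.2 :=
    Continuous.measurable (by fun_prop)
  exact h.mul (measurable_cauchyKernel hA)

theorem continuousAt_commutatorKernel (hA : Continuous A) (hb : Continuous b) {x y : ℝ}
    (hxy : y ≠ x) : ContinuousAt (fun z => commutatorKernel A b z y) x := by
  unfold commutatorKernel cauchyKernel
  refine ContinuousAt.mul (Continuous.continuousAt (by fun_prop)) (ContinuousAt.inv₀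
    (Continuous.continuousAt (by fun_prop)) (cauchyKernel_denominator_ne_zero hxy))

theorem norm_commutatorKernel_le_of_abs_le {M B ρ : ℝ} (hM : 0 ≤ M)
    (hbM : ∀ x y, |b x - b y| ≤ M * |x - y|) (hbB : ∀ x, |b x| ≤ B) {x : ℝ}
    (hx : |x| ≤ ρ) (y : ℝ) :
    ‖commutatorKernel A b x y‖ ≤
      (M + 2 * B) * (1 + ρ) ^ 2 * ((1 + |x|)⁻¹ * (1 + |y|)⁻¹) := by
  have hB : 0 ≤ B := (abs_nonneg _).trans (hbB 0)
  have hρ : 0 ≤ ρ := (abs_nonneg _).trans hx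
  rcases eq_or_ne y x with rfl | hne
  · rw [commutatorKernel_self, norm_zero]
    positivity
  have hd : 0 < |y - x| := abs_pos.2 (sub_ne_zero.2 hne)
  have hnorm : ‖commutatorKernel A b x y‖ ≤ |b x - b y| * |y - x|⁻¹ := by
    rw [commutatorKernel, norm_mul, ← Complex.ofReal_sub, Complex.norm_real, Real.norm_eq_abs]
    exact mul_le_mul_of_nonneg_left (norm_cauchyKernel_le A x y) (abs_nonneg _)
  have h1 := hbM x y
  rw [abs_sub_comm x y] at h1
  have h2 : |b x - b y| ≤ 2 * B := by
    have := abs_sub (b x) (b y)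
    linarith [hbB x, hbB y]
  have h3 : |b x - b y| * (1 + |y - x|) ≤ (M + 2 * B) * |y - x| := by nlinarith
  have h4 : (1 + |x|) * (1 + |y|) ≤ (1 + ρ) ^ 2 * (1 + |y - x|) := by
    have h5 : |y| ≤ |x| + |y - x| := by
      have := abs_add_le x (y - x)
      rwa [add_sub_cancel] at this
    have h6 : 1 + |y| ≤ (1 + ρ) * (1 + |y - x|) := by nlinarith
    calc (1 + |x|) * (1 + |y|) ≤ (1 + ρ) * ((1 + ρ) * (1 + |y - x|)) :=
          mul_le_mul (by linarith) h6 (by positivity) (by positivity)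
      _ = _ := by ring
  refine hnorm.trans ?_
  rw [← mul_inv, ← div_eq_mul_inv, ← div_eq_mul_inv, div_le_div_iff₀ hd (by positivity)]
  calc |b x - b y| * ((1 + |x|) * (1 + |y|))
      ≤ |b x - b y| * ((1 + ρ) ^ 2 * (1 + |y - x|)) :=
        mul_le_mul_of_nonneg_left h4 (abs_nonneg _)
    _ = (1 + ρ) ^ 2 * (|b x - b y| * (1 + |y - x|)) := by ring
    _ ≤ (1 + ρ) ^ 2 * ((M + 2 * B) * |y - x|) :=
        mul_le_mul_of_nonneg_left h3 (by positivity)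
    _ = _ := by ring

theorem exists_norm_commutatorKernel_le (A : ℝ → ℝ) (hb : ContDiff ℝ (⊤ : ℕ∞) b)
    (hb' : HasCompactSupport b) :
    ∃ C : ℝ, 0 ≤ C ∧
      ∀ x y, ‖commutatorKernel A b x y‖ ≤ C * ((1 + |x|)⁻¹ * (1 + |y|)⁻¹) := by
  obtain ⟨M, hM⟩ := hb.lipschitzWith_of_hasCompactSupport hb' (by simp)
  obtain ⟨B, hB⟩ := hb'.exists_bound_of_continuous hb.continuous
  obtain ⟨ρ, hρ⟩ := hb'.isCompact.isBounded.exists_norm_le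
  have hbM : ∀ x y, |b x - b y| ≤ M * |x - y| := fun x y => hM.dist_le_mul x y
  have hB0 : 0 ≤ B := (norm_nonneg _).trans (hB 0)
  have hC : 0 ≤ (M + 2 * B) * (1 + ρ) ^ 2 := by positivity
  refine ⟨_, hC, fun x y => ?_⟩
  by_cases hx : x ∈ tsupport b
  · exact norm_commutatorKernel_le_of_abs_le M.2 hbM hB (hρ x hx) y
  by_cases hy : y ∈ tsupport b
  · rw [← commutatorKernel_swap, mul_comm (1 + |x|)⁻¹]
    exact norm_commutatorKernel_le_of_abs_le M.2 hbM hB (hρ y hy) x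
  · rw [commutatorKernel, image_eq_zero_of_notMem_tsupport hx, image_eq_zero_of_notMem_tsupport hy,
      sub_self, zero_mul, norm_zero]
    positivity

theorem memLp_inv_one_add_abs {q : ℝ≥0∞} (hq1 : 1 < q) (hq : q ≠ ⊤) :
    MemLp (fun x : ℝ => (1 + |x|)⁻¹) q := by
  have hm : Measurable fun x : ℝ => (1 + |x|)⁻¹ := by fun_prop
  rw [← integrable_norm_rpow_iff hm.aestronglyMeasurable (zero_lt_one.trans hq1).ne' hq]
  have hq1' : (1 : ℝ) < q.toReal := by
    rw [← ENNReal.toReal_one]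
    exact ENNReal.toReal_strict_mono hq hq1
  refine (integrable_one_add_norm (E := ℝ) (μ := volume) (r := q.toReal) (by simpa)).congr
    (ae_of_all _ fun x => ?_)
  have h : (0 : ℝ) ≤ 1 + |x| := by positivity
  simp only [Real.norm_eq_abs]
  rw [abs_of_nonneg (inv_nonneg.2 h), Real.rpow_neg h, Real.inv_rpow h]

end CommutatorKernel

section WeightedPrincipalValue

open scoped Topology

variable {A b : ℝ → ℝ} {L : ℝ}

theorem norm_truncatedKernel_le_inv_one_add_abs (A : ℝ → ℝ) {δ : ℝ} (hδ : 0 < δ) (x y : ℝ) :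
    ‖truncatedKernel A δ x y‖ ≤ ((1 + |x|) / δ + 1) * (1 + |y|)⁻¹ := by
  unfold truncatedKernel
  split_ifs with h
  · refine (norm_cauchyKernel_le A x y).trans ?_
    have hd : 0 < |y - x| := hδ.trans h
    rw [inv_eq_one_div, ← div_eq_mul_inv, div_le_div_iff₀ hd (by positivity), one_mul]
    have h5 : |y| ≤ |x| + |y - x| := by
      have := abs_add_le x (y - x)
      rwa [add_sub_cancel] at this
    have h6 : 1 + |x| ≤ (1 + |x|) / δ * |y - x| := by
      rw [div_mul_eq_mul_div, le_div_iff₀ hδ]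
      exact mul_le_mul_of_nonneg_left h.le (by positivity)
    linarith
  · rw [norm_zero]
    positivity

theorem integrable_truncatedKernel_mul_of_weight (hA : Continuous A) {δ : ℝ} (hδ : 0 < δ)
    {f : ℝ → ℂ} (hfm : AEStronglyMeasurable f)
    (hf : Integrable fun y : ℝ => (1 + |y|)⁻¹ * ‖f y‖) (x : ℝ) :
    Integrable fun y => truncatedKernel A δ x y * f y := by
  refine (hf.const_mul ((1 + |x|) / δ + 1)).mono' ?_ (ae_of_all _ fun y => ?_)
  · exact (((measurable_truncatedKernel hA δ).comp (f := fun y => (x, y))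
      (by fun_prop)).aestronglyMeasurable).mul hfm
  · rw [norm_mul, ← mul_assoc]
    exact mul_le_mul_of_nonneg_right (norm_truncatedKernel_le_inv_one_add_abs A hδ x y)
      (norm_nonneg _)

theorem setIntegral_cauchyKernel_eq (A : ℝ → ℝ) (δ x : ℝ) (f : ℝ → ℂ) :
    ∫ y in {y : ℝ | δ < |y - x|}, cauchyKernel A x y * f y =
      ∫ y, truncatedKernel A δ x y * f y := by
  rw [← integral_indicator (measurableSet_lt (by fun_prop) (by fun_prop))]
  congr 1
  ext y
  by_cases h : δ < |y - x| <;> simp [truncatedKernel, indicator, h]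

theorem ae_exists_cauchyPV
    (hA : ∀ x₁ x₂ : ℝ, |A x₁ - A x₂| ≤ L * |x₁ - x₂|) (hL : 0 ≤ L)
    {f : ℝ → ℂ} (hfm : AEStronglyMeasurable f)
    (hf : Integrable fun y : ℝ => (1 + |y|)⁻¹ * ‖f y‖) :
    ∀ᵐ x, ∃ u, cauchyPV A f x u := by
  have hAc := continuous_of_abs_sub_le hA
  have hloc : ∀ R : ℝ, 0 ≤ R → Integrable ((Icc (-R) R).indicator f) := fun R hR => by
    refine (hf.const_mul (1 + R)).mono' (hfm.indicator measurableSet_Icc)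
      (ae_of_all _ fun y => ?_)
    rw [norm_indicator_eq_indicator_norm]
    by_cases hy : y ∈ Icc (-R) R
    · rw [indicator_of_mem hy, ← mul_assoc]
      refine le_mul_of_one_le_left (norm_nonneg _) ?_
      rw [← div_eq_mul_inv, one_le_div (by positivity)]
      linarith [abs_le.2 hy]
    · rw [indicator_of_notMem hy]
      positivity
  have key := fun n : ℕ => ae_exists_tendsto_cauchyTrunc hA hL (R := n + 2) (by positivity)
    (hloc (n + 2) (by positivity))
  filter_upwards [ae_all_iff.2 key] with x hx
  obtain ⟨n, hn⟩ := exists_nat_ge |x|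
  have hxn := abs_le.1 hn
  obtain ⟨v, hv⟩ := hx n ⟨by linarith [hxn.1], by linarith [hxn.2]⟩
  set I := Icc (-((n : ℝ) + 2)) (n + 2) with hI
  refine ⟨v + ∫ y in Iᶜ, truncatedKernel A 1 x y * f y, ?_⟩
  refine (hv.add_const _).congr' ?_
  filter_upwards [Ioc_mem_nhdsGT one_pos] with δ hδ
  have hFint := integrable_truncatedKernel_mul_of_weight hAc hδ.1 hfm hf x
  rw [setIntegral_cauchyKernel_eq, ← integral_add_compl measurableSet_Icc hFint]
  congr 1
  · refine setIntegral_congr_fun measurableSet_Icc fun y hy => ?_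
    simp only [indicator_of_mem hy]
  · refine setIntegral_congr_fun measurableSet_Icc.compl fun y hy => ?_
    have h1 : 1 < |y - x| := by
      by_contra! hle
      have h2 := abs_le.1 hle
      exact hy ⟨by linarith [h2.1, hxn.1], by linarith [h2.2, hxn.2]⟩
    simp only [truncatedKernel, h1, hδ.2.trans_lt h1, if_true]

theorem norm_commutatorKernel_mul_le {C : ℝ}
    (hC : ∀ x y, ‖commutatorKernel A b x y‖ ≤ C * ((1 + |x|)⁻¹ * (1 + |y|)⁻¹)) (hC0 : 0 ≤ C)
    (f : ℝ → ℂ) (x y : ℝ) :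
    ‖commutatorKernel A b x y * f y‖ ≤ C * ((1 + |y|)⁻¹ * ‖f y‖) := by
  rw [norm_mul, ← mul_assoc]
  refine mul_le_mul_of_nonneg_right ((hC x y).trans ?_) (norm_nonneg _)
  refine mul_le_mul_of_nonneg_left (mul_le_of_le_one_left (by positivity) ?_) hC0
  exact inv_le_one_of_one_le₀ (le_add_of_nonneg_right (abs_nonneg x))

theorem tendsto_integral_truncated_commutatorKernel (hA : Continuous A) (hb : Continuous b)
    {C : ℝ} (hC0 : 0 ≤ C)
    (hC : ∀ x y, ‖commutatorKernel A b x y‖ ≤ C * ((1 + |x|)⁻¹ * (1 + |y|)⁻¹))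
    {f : ℝ → ℂ} (hfm : AEStronglyMeasurable f)
    (hf : Integrable fun y : ℝ => (1 + |y|)⁻¹ * ‖f y‖) (x : ℝ) :
    Tendsto (fun δ => ∫ y, {y : ℝ | δ < |y - x|}.indicator
      (fun y => commutatorKernel A b x y * f y) y) (𝓝[>] 0)
      (𝓝 (∫ y, commutatorKernel A b x y * f y)) := by
  have hm : AEStronglyMeasurable (fun y => commutatorKernel A b x y * f y) :=
    (((measurable_commutatorKernel hA hb).comp (f := fun y => (x, y))
      (by fun_prop)).aestronglyMeasurable).mul hfm
  refine tendsto_integral_filter_of_dominated_convergence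
    (fun y => C * ((1 + |y|)⁻¹ * ‖f y‖)) ?_ ?_ (hf.const_mul C) ?_
  · exact Eventually.of_forall fun δ =>
      hm.indicator (measurableSet_lt (by fun_prop) (by fun_prop))
  · exact Eventually.of_forall fun δ => ae_of_all _ fun y =>
      (norm_indicator_le_norm_self _ _).trans (norm_commutatorKernel_mul_le hC hC0 f x y)
  · refine ae_of_all _ fun y => tendsto_const_nhds.congr' ?_
    rcases eq_or_ne y x with rfl | hne
    · refine Eventually.of_forall fun δ => ?_
      simp [indicator, commutatorKernel_self]
    · filter_upwards [Ioo_mem_nhdsGT (abs_pos.2 (sub_ne_zero.2 hne))] with δ hδ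
      rw [indicator_of_mem (by exact hδ.2)]

/-- The commutator of `b` with the principal value is integration against the commutator
kernel. -/
theorem cauchyPV_mul_of_cauchyPV (hA : Continuous A) (hb : Continuous b)
    {C : ℝ} (hC0 : 0 ≤ C)
    (hC : ∀ x y, ‖commutatorKernel A b x y‖ ≤ C * ((1 + |x|)⁻¹ * (1 + |y|)⁻¹))
    {f : ℝ → ℂ} (hfm : AEStronglyMeasurable f)
    (hf : Integrable fun y : ℝ => (1 + |y|)⁻¹ * ‖f y‖) {x : ℝ} {u : ℂ} (hu : cauchyPV A f x u) :
    cauchyPV A (fun y => (b y : ℂ) * f y) x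
      ((b x : ℂ) * u - ∫ y, commutatorKernel A b x y * f y) := by
  have hκ := tendsto_integral_truncated_commutatorKernel hA hb hC0 hC hfm hf x
  refine ((hu.const_mul (b x : ℂ)).sub hκ).congr' ?_
  filter_upwards [self_mem_nhdsWithin] with δ hδ
  have hFint := integrable_truncatedKernel_mul_of_weight hA hδ hfm hf x
  have hm : AEStronglyMeasurable (fun y => commutatorKernel A b x y * f y) :=
    (((measurable_commutatorKernel hA hb).comp (f := fun y => (x, y))
      (by fun_prop)).aestronglyMeasurable).mul hfm
  rw [setIntegral_cauchyKernel_eq, setIntegral_cauchyKernel_eq, ← integral_const_mul,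
    ← integral_sub (hFint.const_mul _)]
  · congr 1
    ext y
    by_cases h : δ < |y - x|
    · simp only [indicator, truncatedKernel, commutatorKernel, h, if_true, mem_ofPred_eq]
      ring
    · simp [indicator, truncatedKernel, h]
  · exact ((hf.const_mul C).mono' hm (ae_of_all _
      (norm_commutatorKernel_mul_le hC hC0 f x))).indicator
        (measurableSet_lt (by fun_prop) (by fun_prop))

end WeightedPrincipalValue

section CommutatorOperator

open scoped Topology

variable {A b : ℝ → ℝ} {L : ℝ}

theorem continuous_toLp_of_dominated {X α E : Type*} [TopologicalSpace X]
    [FirstCountableTopology X] [MeasurableSpace α] {μ : Measure α} [NormedAddCommGroup E]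
    {q : ℝ≥0∞} [Fact (1 ≤ q)] (hq : q ≠ ⊤) {F : X → α → E} (hF : ∀ x, MemLp (F x) q μ)
    {g : α → ℝ} (hg : MemLp g q μ) (hFg : ∀ x y, ‖F x y‖ ≤ g y)
    (hcont : ∀ x, ∀ᵐ y ∂μ, ContinuousAt (fun z => F z y) x) :
    Continuous fun x => (hF x).toLp (F x) := by
  have hq0 : q ≠ 0 := (zero_lt_one.trans_le Fact.out).ne'
  have hqr : 0 < q.toReal := ENNReal.toReal_pos hq0 hq
  refine continuous_iff_continuousAt.2 fun x => ?_
  refine (Lp.tendsto_Lp_iff_tendsto_eLpNorm'' _ hF _ (hF x)).2 ?_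
  have key : Tendsto (fun z => ∫⁻ y, ‖(F z - F x) y‖ₑ ^ q.toReal ∂μ) (𝓝 x)
      (𝓝 (∫⁻ _, 0 ∂μ)) := by
    refine tendsto_lintegral_filter_of_dominated_convergence'
      (fun y => ‖(2 : ℝ) * g y‖ₑ ^ q.toReal) (Eventually.of_forall fun z => ?_)
      (Eventually.of_forall fun z => ae_of_all _ fun y => ?_) ?_ ?_
    · exact (((hF z).1.sub (hF x).1).enorm).pow_const _
    · refine ENNReal.rpow_le_rpow ?_ hqr.le
      rw [enorm_le_iff_norm_le, Pi.sub_apply]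
      refine (norm_sub_le _ _).trans (le_trans ?_ (Real.le_norm_self _))
      linarith [hFg z y, hFg x y]
    · exact (lintegral_rpow_enorm_lt_top_of_eLpNorm_lt_top hq0 hq
        (hg.const_mul 2).eLpNorm_lt_top).ne
    · filter_upwards [hcont x] with y hy
      have h : Tendsto (fun z => F z y - F x y) (𝓝 x) (𝓝 0) := by
        simpa using hy.tendsto.sub_const (F x y)
      simpa [hqr, Function.comp_def] using
        ((ENNReal.continuous_rpow_const (y := q.toReal)).tendsto _).comp h.enorm
  simp_rw [eLpNorm_eq_lintegral_rpow_enorm_toReal hq0 hq]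
  simpa [hqr, Function.comp_def] using
    ((ENNReal.continuous_rpow_const (y := 1 / q.toReal)).tendsto _).comp key

theorem norm_commutatorKernel_le_right {C : ℝ} (hC0 : 0 ≤ C)
    (hC : ∀ x y, ‖commutatorKernel A b x y‖ ≤ C * ((1 + |x|)⁻¹ * (1 + |y|)⁻¹)) (x y : ℝ) :
    ‖commutatorKernel A b x y‖ ≤ C * (1 + |y|)⁻¹ := by
  refine (hC x y).trans (mul_le_mul_of_nonneg_left (mul_le_of_le_one_left (by positivity) ?_) hC0)
  exact inv_le_one_of_one_le₀ (le_add_of_nonneg_right (abs_nonneg x))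

theorem memLp_commutatorKernel (hA : Continuous A) (hb : Continuous b) {C : ℝ} (hC0 : 0 ≤ C)
    (hC : ∀ x y, ‖commutatorKernel A b x y‖ ≤ C * ((1 + |x|)⁻¹ * (1 + |y|)⁻¹))
    {q : ℝ≥0∞} (hq1 : 1 < q) (hq : q ≠ ⊤) (x : ℝ) : MemLp (commutatorKernel A b x) q := by
  refine ((memLp_inv_one_add_abs hq1 hq).const_mul C).mono' ?_
    (ae_of_all _ (norm_commutatorKernel_le_right hC0 hC x))
  exact ((measurable_commutatorKernel hA hb).comp (f := fun y => (x, y))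
    (by fun_prop)).aestronglyMeasurable

/-- The commutator kernel as an `L^q`-valued function of its first variable is in `L^p`. -/
theorem memLp_toLp_commutatorKernel (hA : Continuous A) (hb : Continuous b) {C : ℝ}
    (hC0 : 0 ≤ C)
    (hC : ∀ x y, ‖commutatorKernel A b x y‖ ≤ C * ((1 + |x|)⁻¹ * (1 + |y|)⁻¹))
    {p q : ℝ≥0∞} (hp1 : 1 < p) (hp : p ≠ ⊤) (hq1 : 1 < q) (hq : q ≠ ⊤) [Fact (1 ≤ q)] :
    MemLp (fun x => (memLp_commutatorKernel hA hb hC0 hC hq1 hq x).toLp) p := by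
  have hw := memLp_inv_one_add_abs hq1 hq
  have hcont : Continuous fun x => (memLp_commutatorKernel hA hb hC0 hC hq1 hq x).toLp := by
    refine continuous_toLp_of_dominated hq _ (hw.const_mul C)
      (norm_commutatorKernel_le_right hC0 hC) fun x => ?_
    filter_upwards [Measure.ae_ne volume x] with y hy
    exact continuousAt_commutatorKernel hA hb hy
  refine (memLp_inv_one_add_abs hp1 hp).of_le_mul (c := C * ‖hw.toLp‖)
    hcont.aestronglyMeasurable (ae_of_all _ fun x => ?_)
  have hx : 0 ≤ (1 + |x|)⁻¹ := by positivity
  have h := Lp.norm_le_mul_norm_of_ae_le_mul (c := C * (1 + |x|)⁻¹)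
    (f := (memLp_commutatorKernel hA hb hC0 hC hq1 hq x).toLp) (g := hw.toLp) ?_
  · rw [Real.norm_of_nonneg hx]
    linarith
  · filter_upwards [(memLp_commutatorKernel hA hb hC0 hC hq1 hq x).coeFn_toLp, hw.coeFn_toLp]
      with y h1 h2
    rw [h1, h2, Real.norm_of_nonneg (by positivity), mul_assoc]
    exact hC x y

theorem exists_isCompactOperator_commutatorKernel (hA : Continuous A) (hb : Continuous b)
    {C : ℝ} (hC0 : 0 ≤ C)
    (hC : ∀ x y, ‖commutatorKernel A b x y‖ ≤ C * ((1 + |x|)⁻¹ * (1 + |y|)⁻¹))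
    {p q : ℝ≥0∞} [Fact (1 ≤ p)] [Fact (1 ≤ q)] [p.HolderConjugate q]
    (hp1 : 1 < p) (hp : p ≠ ⊤) (hq1 : 1 < q) (hq : q ≠ ⊤) :
    ∃ T : Lp ℂ p (volume : Measure ℝ) →L[ℂ] Lp ℂ p (volume : Measure ℝ),
      (∀ f, ∀ᵐ x, T f x = ∫ y, commutatorKernel A b x y * f y) ∧ IsCompactOperator T := by
  have hΦ := memLp_toLp_commutatorKernel hA hb hC0 hC hp1 hp hq1 hq
  let B := (ContinuousLinearMap.mul ℂ ℂ).lpPairing (volume : Measure ℝ) p q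
  refine ⟨(B.compLpL₂ p volume).flip hΦ.toLp, fun f => ?_,
    isCompactOperator_compLpL₂_flip hp B _⟩
  rw [ContinuousLinearMap.flip_apply, ContinuousLinearMap.compLpL₂_apply_apply]
  filter_upwards [(B f).coeFn_compLp hΦ.toLp, hΦ.coeFn_toLp] with x h1 h2
  rw [h1, h2, ContinuousLinearMap.lpPairing_eq_integral]
  refine integral_congr_ae ?_
  filter_upwards [(memLp_commutatorKernel hA hb hC0 hC hq1 hq x).coeFn_toLp] with y hy
  rw [hy, ContinuousLinearMap.mul_apply', mul_comm]

end CommutatorOperator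

/-- For smooth compactly supported `b`, the commutator `[b, C_Γ]` is a compact operator on
`L^p(ℝ)` for `1 < p < ∞`. -/
theorem smooth_compact_support_commutator_compact
    (A : ℝ → ℝ) (L : ℝ) (hL : 0 < L)
    (hA : ∀ x₁ x₂ : ℝ, |A x₁ - A x₂| ≤ L * |x₁ - x₂|)
    (p : ℝ≥0∞) (hp1 : 1 < p) (hp2 : p ≠ ⊤) [Fact (1 ≤ p)]
    (b : ℝ → ℝ) (hb : ContDiff ℝ (⊤ : ℕ∞) b) (hb' : HasCompactSupport b) :
    ∃ T : Lp ℂ p (volume : Measure ℝ) →L[ℂ] Lp ℂ p (volume : Measure ℝ),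
      (∀ f : Lp ℂ p (volume : Measure ℝ), IsCommutatorFn A b ⇑f ⇑(T f)) ∧
      IsCompactOperator (⇑T) := by
  have hAc := continuous_of_abs_sub_le hA
  obtain ⟨C, hC0, hC⟩ := exists_norm_commutatorKernel_le A hb hb'
  have hq1 : 1 < p.conjExponent :=
    (ENNReal.HolderConjugate.lt_top_iff_one_lt p p.conjExponent).1 hp2.lt_top
  have hq : p.conjExponent ≠ ⊤ :=
    ((ENNReal.HolderConjugate.lt_top_iff_one_lt p.conjExponent p).2 hp1).ne
  have : Fact (1 ≤ p.conjExponent) := ⟨hq1.le⟩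
  obtain ⟨T, hT, hTc⟩ := exists_isCompactOperator_commutatorKernel hAc hb.continuous hC0 hC
    hp1 hp2 hq1 hq
  refine ⟨T, fun f => ?_, hTc⟩
  have hf : Integrable fun y : ℝ => (1 + |y|)⁻¹ * ‖f y‖ :=
    (memLp_inv_one_add_abs hq1 hq).integrable_mul (Lp.memLp f).norm
  filter_upwards [ae_exists_cauchyPV hA hL.le (Lp.aestronglyMeasurable f) hf, hT f]
    with x ⟨u, hu⟩ hx
  refine ⟨u, _, hu, cauchyPV_mul_of_cauchyPV hAc hb.continuous hC0 hC
    (Lp.aestronglyMeasurable f) hf hu, ?_⟩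
  rw [hx]
  ring
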